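/- Let ℓ be a prime, r ≥ 1, and let F be a finite field with ℓ^r elements, with ℓ^r ≠ 2. Then H_d(Sp_{2n}(F); F_ℓ) = 0 for all d with 0 < d < n, where F_ℓ is the ℓ-element field with trivial action. -/

import Mathlib

/-! # Group homology via the inhomogeneous bar complex (trivial coefficients) -/

namespace GroupHomologyBar

variable (G : Type) [Group G] (A : Type) [AddCommGroup A]

/-- Inhomogeneous `n`-chains of `G` with coefficients in `A`. -/
abbrev chains (n : ℕ) : Type := (Fin n → G) →₀ A

/-- The differential of the inhomogeneous bar complex with trivial `G`-action on the
coefficients, sending `[g₁|…|g_{n+1}] ⊗ a` to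
`[g₂|…|g_{n+1}] ⊗ a + ∑ⱼ (-1)^{j+1} [g₁|…|gⱼg_{j+1}|…|g_{n+1}] ⊗ a`
(the last summand of the sum being `(-1)^{n+1} [g₁|…|g_n] ⊗ a`). -/
noncomputable def d (n : ℕ) : chains G A (n + 1) →ₗ[ℤ] chains G A n :=
  Finsupp.lsum ℤ fun g =>
    (Finsupp.lsingle (Fin.tail g) : A →ₗ[ℤ] chains G A n)
      + ∑ j : Fin (n + 1),
          ((-1 : ℤ) ^ ((j : ℕ) + 1)) • Finsupp.lsingle (Fin.contractNth j (· * ·) g)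

/-- The `n`-cycles. -/
noncomputable def cycles : (n : ℕ) → Submodule ℤ (chains G A n)
  | 0 => ⊤
  | (n + 1) => LinearMap.ker (d G A n)

/-- The `n`-boundaries, viewed as a submodule of the `n`-cycles. -/
noncomputable def boundaries (n : ℕ) : Submodule ℤ (cycles G A n) :=
  Submodule.comap (cycles G A n).subtype (LinearMap.range (d G A n))

/-- The group homology `H_n(G; A)` of `G` with trivial coefficients in `A`. -/
abbrev Homology (n : ℕ) : Type := cycles G A n ⧸ boundaries G A n

variable {G}
variable {G' : Type} [Group G']

/-- The map on chains induced by a group homomorphism. -/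
noncomputable def chainsMap (φ : G →* G') (n : ℕ) : chains G A n →ₗ[ℤ] chains G' A n :=
  Finsupp.lmapDomain A ℤ fun v => φ ∘ v

lemma chainsMap_single (φ : G →* G') {n : ℕ} (v : Fin n → G) (a : A) :
    chainsMap A φ n (Finsupp.single v a) = Finsupp.single (φ ∘ v) a := by
  simp [chainsMap, Finsupp.mapDomain_single]

lemma d_single {n : ℕ} (g : Fin (n + 1) → G) (a : A) :
    d G A n (Finsupp.single g a)
      = Finsupp.single (Fin.tail g) a
        + ∑ j : Fin (n + 1),
            ((-1 : ℤ) ^ ((j : ℕ) + 1)) • Finsupp.single (Fin.contractNth j (· * ·) g) a := by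
  simp [d, Finsupp.lsum_single]

lemma d_chainsMap (φ : G →* G') (n : ℕ) :
    (d G' A n).comp (chainsMap A φ (n + 1)) = (chainsMap A φ n).comp (d G A n) := by
  apply Finsupp.lhom_ext
  intro g a
  have hc : ∀ j : Fin (n + 1),
      φ ∘ Fin.contractNth j (· * ·) g = Fin.contractNth j (· * ·) (φ ∘ g) := by
    intro j
    funext k
    simp only [Function.comp_apply, Fin.contractNth]
    split_ifs <;> simp
  simp only [LinearMap.comp_apply, chainsMap_single, d_single, map_add, map_sum, map_smul,
    chainsMap_single, Fin.comp_tail, hc]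

lemma chainsMap_mem_cycles (φ : G →* G') (n : ℕ) :
    ∀ x ∈ cycles G A n, chainsMap A φ n x ∈ cycles G' A n := by
  intro x hx
  cases n with
  | zero => trivial
  | succ n =>
    simp only [cycles, LinearMap.mem_ker] at hx ⊢
    have := congrArg (fun L : chains G A (n + 1) →ₗ[ℤ] chains G' A n => L x) (d_chainsMap A φ n)
    simp only [LinearMap.comp_apply] at this
    rw [this, hx, map_zero]

/-- The map on cycles induced by a group homomorphism. -/
noncomputable def cyclesMap (φ : G →* G') (n : ℕ) : cycles G A n →ₗ[ℤ] cycles G' A n :=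
  (chainsMap A φ n).restrict (chainsMap_mem_cycles A φ n)

/-- The map `H_n(G; A) → H_n(G'; A)` on group homology induced by a group
homomorphism `φ : G →* G'`. -/
noncomputable def inducedMap (φ : G →* G') (n : ℕ) :
    Homology G A n →ₗ[ℤ] Homology G' A n :=
  Submodule.mapQ _ _ (cyclesMap A φ n) (by
    rintro ⟨x, hx⟩ hmem
    simp only [boundaries, Submodule.mem_comap, Submodule.subtype_apply,
      LinearMap.mem_range] at hmem ⊢
    obtain ⟨y, hy⟩ := hmem
    refine ⟨chainsMap A φ (n + 1) y, ?_⟩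
    have := congrArg (fun L : chains G A (n + 1) →ₗ[ℤ] chains G' A n => L y) (d_chainsMap A φ n)
    simp only [LinearMap.comp_apply] at this
    rw [this, hy]
    rfl)

end GroupHomologyBar

section Isometries

variable (F : Type) [Field F] {W : Type} [AddCommGroup W] [Module F W]

/-- The group of linear automorphisms of a vector space `V` preserving a
function `Q : V → F` (e.g. a quadratic form). -/
def quadIsoms {V : Type} [AddCommGroup V] [Module F V] (Q : V → F) :
    Subgroup (V ≃ₗ[F] V) where
  carrier := {g | ∀ v, Q (g v) = Q v}
  one_mem' := fun _ => rfl
  mul_mem' := fun {a b} ha hb v => by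
    rw [show (a * b) v = a (b v) from rfl, ha, hb]
  inv_mem' := fun {a} ha v => by
    rw [show (a⁻¹ : V ≃ₗ[F] V) v = a.symm v from rfl, ← ha (a.symm v), a.apply_symm_apply]

/-- The group of linear automorphisms of a vector space `V` preserving a
pairing `ω : V → V → F` (e.g. a bilinear or sesquilinear form). -/
def bilinIsoms {V : Type} [AddCommGroup V] [Module F V] (ω : V → V → F) :
    Subgroup (V ≃ₗ[F] V) where
  carrier := {g | ∀ v w, ω (g v) (g w) = ω v w}
  one_mem' := fun _ _ => rfl
  mul_mem' := fun {a b} ha hb v w => by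
    rw [show (a * b) v = a (b v) from rfl, show (a * b) w = a (b w) from rfl, ha, hb]
  inv_mem' := fun {a} ha v w => by
    rw [show (a⁻¹ : V ≃ₗ[F] V) v = a.symm v from rfl,
      show (a⁻¹ : V ≃ₗ[F] V) w = a.symm w from rfl,
      ← ha (a.symm v) (a.symm w), a.apply_symm_apply, a.apply_symm_apply]

/-- The "orthogonal sum" form `x ↦ ∑ i, q (x i)` on `W^n`. -/
def sumForm (q : W → F) (n : ℕ) (x : Fin n → W) : F := ∑ i, q (x i)

/-- The "orthogonal sum" pairing `(x, y) ↦ ∑ i, β (x i) (y i)` on `W^n`. -/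
def pairForm (β : W → W → F) (n : ℕ) (x y : Fin n → W) : F := ∑ i, β (x i) (y i)

/-- The linear equivalence `W^{n+1} ≃ W^n × W` splitting off the last coordinate. -/
def lastSplit (n : ℕ) : (Fin (n + 1) → W) ≃ₗ[F] (Fin n → W) × W where
  toLinearMap := (LinearMap.funLeft F W Fin.castSucc).prod (LinearMap.proj (Fin.last n))
  invFun p := Fin.snoc p.1 p.2
  left_inv x := Fin.snoc_init_self x
  right_inv p := by
    refine Prod.ext (funext fun i => ?_) ?_
    · exact @Fin.snoc_castSucc n (fun _ => W) p.2 p.1 i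
    · exact @Fin.snoc_last n (fun _ => W) p.2 p.1

lemma lastSplit_symm_apply (n : ℕ) (p : Fin n → W) (w : W) :
    (lastSplit F n).symm (p, w) = Fin.snoc p w := rfl

/-- Extension of an automorphism of `W^n` to `W^{n+1}` by the identity on the
added last coordinate. -/
def stabAut (n : ℕ) (g : (Fin n → W) ≃ₗ[F] (Fin n → W)) :
    (Fin (n + 1) → W) ≃ₗ[F] (Fin (n + 1) → W) :=
  (lastSplit F n).trans ((g.prodCongr (LinearEquiv.refl F W)).trans (lastSplit F n).symm)

lemma stabAut_symm_apply (n : ℕ) (g : (Fin n → W) ≃ₗ[F] (Fin n → W))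
    (p : Fin n → W) (w : W) :
    stabAut F n g ((lastSplit F n).symm (p, w)) = (lastSplit F n).symm (g p, w) := by
  simp [stabAut, LinearEquiv.trans_apply, LinearEquiv.apply_symm_apply, LinearEquiv.prodCongr_apply]

lemma sumForm_snoc (q : W → F) (n : ℕ) (p : Fin n → W) (w : W) :
    sumForm F q (n + 1) ((lastSplit F n).symm (p, w)) = sumForm F q n p + q w := by
  simp [sumForm, lastSplit_symm_apply, Fin.sum_univ_castSucc, Fin.snoc_castSucc, Fin.snoc_last]

lemma pairForm_snoc (β : W → W → F) (n : ℕ) (p p' : Fin n → W) (w w' : W) :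
    pairForm F β (n + 1) ((lastSplit F n).symm (p, w)) ((lastSplit F n).symm (p', w'))
      = pairForm F β n p p' + β w w' := by
  simp [pairForm, lastSplit_symm_apply, Fin.sum_univ_castSucc, Fin.snoc_castSucc, Fin.snoc_last]

/-- The stabilization homomorphism on the isometry group of the form `sumForm q n`,
extending an isometry by the identity on the added summand. -/
def quadStab (q : W → F) (n : ℕ) :
    quadIsoms F (sumForm F q n) →* quadIsoms F (sumForm F q (n + 1)) where
  toFun g := ⟨stabAut F n g.1, by
    intro v
    obtain ⟨⟨p, w⟩, rfl⟩ : ∃ x, (lastSplit F n).symm x = v :=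
      ⟨lastSplit F n v, (lastSplit F n).symm_apply_apply v⟩
    rw [stabAut_symm_apply, sumForm_snoc, sumForm_snoc, g.2 p]⟩
  map_one' := by
    refine Subtype.ext (LinearEquiv.ext fun v => ?_)
    show stabAut F n 1 v = v
    obtain ⟨⟨p, w⟩, rfl⟩ : ∃ x, (lastSplit F n).symm x = v :=
      ⟨lastSplit F n v, (lastSplit F n).symm_apply_apply v⟩
    rw [stabAut_symm_apply]
    rfl
  map_mul' g h := by
    refine Subtype.ext (LinearEquiv.ext fun v => ?_)
    show stabAut F n (g.1 * h.1) v = stabAut F n g.1 (stabAut F n h.1 v)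
    obtain ⟨⟨p, w⟩, rfl⟩ : ∃ x, (lastSplit F n).symm x = v :=
      ⟨lastSplit F n v, (lastSplit F n).symm_apply_apply v⟩
    rw [stabAut_symm_apply, stabAut_symm_apply, stabAut_symm_apply]
    rfl

/-- The stabilization homomorphism on the isometry group of the pairing `pairForm β n`,
extending an isometry by the identity on the added summand. -/
def bilinStab (β : W → W → F) (n : ℕ) :
    bilinIsoms F (pairForm F β n) →* bilinIsoms F (pairForm F β (n + 1)) where
  toFun g := ⟨stabAut F n g.1, by
    intro v v'
    obtain ⟨⟨p, w⟩, rfl⟩ : ∃ x, (lastSplit F n).symm x = v :=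
      ⟨lastSplit F n v, (lastSplit F n).symm_apply_apply v⟩
    obtain ⟨⟨p', w'⟩, rfl⟩ : ∃ x, (lastSplit F n).symm x = v' :=
      ⟨lastSplit F n v', (lastSplit F n).symm_apply_apply v'⟩
    rw [stabAut_symm_apply, stabAut_symm_apply, pairForm_snoc, pairForm_snoc, g.2 p p']⟩
  map_one' := by
    refine Subtype.ext (LinearEquiv.ext fun v => ?_)
    show stabAut F n 1 v = v
    obtain ⟨⟨p, w⟩, rfl⟩ : ∃ x, (lastSplit F n).symm x = v :=
      ⟨lastSplit F n v, (lastSplit F n).symm_apply_apply v⟩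
    rw [stabAut_symm_apply]
    rfl
  map_mul' g h := by
    refine Subtype.ext (LinearEquiv.ext fun v => ?_)
    show stabAut F n (g.1 * h.1) v = stabAut F n g.1 (stabAut F n h.1 v)
    obtain ⟨⟨p, w⟩, rfl⟩ : ∃ x, (lastSplit F n).symm x = v :=
      ⟨lastSplit F n v, (lastSplit F n).symm_apply_apply v⟩
    rw [stabAut_symm_apply, stabAut_symm_apply, stabAut_symm_apply]
    rfl

end Isometries

/-- The standard alternating pairing on the hyperbolic plane `F² = F × F`. -/
def sympPair (F : Type) [Field F] (s t : F × F) : F := s.1 * t.2 - s.2 * t.1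


namespace SpH

open Finsupp

section Bar

variable {k : Type} [Field k]
variable {G : Type} [Group G] {M : Type} [AddCommGroup M] [Module k M]
variable {G' : Type} [Group G'] {M' : Type} [AddCommGroup M'] [Module k M']
variable {G'' : Type} [Group G''] {M'' : Type} [AddCommGroup M''] [Module k M'']

/-- bar differential -/
noncomputable def bd (ρ : Representation k G M) (n : ℕ) :
    ((Fin (n + 1) → G) →₀ M) →ₗ[k] ((Fin n → G) →₀ M) :=
  Finsupp.lsum k fun g =>
    (Finsupp.lsingle (Fin.tail g)).comp (ρ (g 0)⁻¹)
      + ∑ j : Fin (n + 1),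
          ((-1 : k) ^ ((j : ℕ) + 1)) • Finsupp.lsingle (Fin.contractNth j (· * ·) g)

lemma bd_single (ρ : Representation k G M) (n : ℕ) (g : Fin (n + 1) → G) (a : M) :
    bd ρ n (single g a) = single (Fin.tail g) (ρ (g 0)⁻¹ a)
      + ∑ j : Fin (n + 1), ((-1 : k) ^ ((j : ℕ) + 1)) •
        single (Fin.contractNth j (· * ·) g) a := by
  simp [bd, Finsupp.lsum_single]

lemma bd_eq (ρ : Representation k G M) (n : ℕ) (x : (Fin (n + 1) → G) →₀ M) :
    bd ρ n x = (groupHomology.inhomogeneousChains.d (Rep.of ρ) n).hom x := by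
  rfl

lemma bd_bd (ρ : Representation k G M) (n : ℕ) (x : (Fin (n + 1 + 1) → G) →₀ M) :
    bd ρ n (bd ρ (n + 1) x) = 0 := by
  rw [bd_eq, bd_eq]
  have := groupHomology.inhomogeneousChains.d_comp_d (A := Rep.of ρ) n
  exact congrArg (fun f => f.hom x) this

/-- map on chains -/
noncomputable def cmap (f : G →* G') (φ : M →ₗ[k] M') (n : ℕ) :
    ((Fin n → G) →₀ M) →ₗ[k] ((Fin n → G') →₀ M') :=
  Finsupp.lsum k fun g => (Finsupp.lsingle (f ∘ g)).comp φ

@[simp]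
lemma cmap_single (f : G →* G') (φ : M →ₗ[k] M') (n : ℕ) (g : Fin n → G) (a : M) :
    cmap f φ n (single g a) = single (f ∘ g) (φ a) := by
  simp [cmap]

lemma bd_cmap (ρ : Representation k G M) (ρ' : Representation k G' M')
    (f : G →* G') (φ : M →ₗ[k] M') (h : ∀ g m, φ (ρ g m) = ρ' (f g) (φ m)) (n : ℕ)
    (x : (Fin (n + 1) → G) →₀ M) :
    bd ρ' n (cmap f φ (n + 1) x) = cmap f φ n (bd ρ n x) := by
  induction x using Finsupp.induction_linear with
  | zero => simp
  | add x y hx hy => simp [hx, hy]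
  | single g a =>
    have hc : ∀ j : Fin (n + 1),
        f ∘ Fin.contractNth j (· * ·) g = Fin.contractNth j (· * ·) (f ∘ g) := by
      intro j
      funext i
      simp only [Function.comp_apply, Fin.contractNth]
      split_ifs <;> simp
    simp only [cmap_single, bd_single, map_add, map_sum, map_smul, h, map_inv, hc,
      Fin.comp_tail, Function.comp_apply]

/-- cycles -/
noncomputable def cyc (ρ : Representation k G M) : (n : ℕ) → Submodule k ((Fin n → G) →₀ M)
  | 0 => ⊤
  | (n + 1) => LinearMap.ker (bd ρ n)

lemma mem_cyc_zero (ρ : Representation k G M) (z) : z ∈ cyc ρ 0 := trivial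

lemma mem_cyc_succ {ρ : Representation k G M} {n : ℕ} {z} :
    z ∈ cyc ρ (n + 1) ↔ bd ρ n z = 0 := Iff.rfl

/-- boundaries -/
noncomputable def bnd (ρ : Representation k G M) (n : ℕ) : Submodule k ((Fin n → G) →₀ M) :=
  LinearMap.range (bd ρ n)

lemma bnd_le_cyc (ρ : Representation k G M) (n : ℕ) : bnd ρ n ≤ cyc ρ n := by
  cases n with
  | zero => exact le_top
  | succ n =>
    rintro _ ⟨x, rfl⟩
    exact bd_bd ρ n x

/-- homology -/
def Hm (ρ : Representation k G M) (n : ℕ) : Type :=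
  (cyc ρ n) ⧸ (bnd ρ n).comap (cyc ρ n).subtype

noncomputable instance (ρ : Representation k G M) (n : ℕ) : AddCommGroup (Hm ρ n) :=
  inferInstanceAs (AddCommGroup ((cyc ρ n) ⧸ (bnd ρ n).comap (cyc ρ n).subtype))

noncomputable instance (ρ : Representation k G M) (n : ℕ) : Module k (Hm ρ n) :=
  inferInstanceAs (Module k ((cyc ρ n) ⧸ (bnd ρ n).comap (cyc ρ n).subtype))

/-- class of a cycle -/
noncomputable def cls (ρ : Representation k G M) (n : ℕ) : cyc ρ n →ₗ[k] Hm ρ n :=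
  Submodule.mkQ _

lemma cls_surj {ρ : Representation k G M} {n : ℕ} (x : Hm ρ n) :
    ∃ z : (Fin n → G) →₀ M, ∃ hz : z ∈ cyc ρ n, cls ρ n ⟨z, hz⟩ = x := by
  obtain ⟨⟨z, hz⟩, rfl⟩ := Submodule.mkQ_surjective _ x
  exact ⟨z, hz, rfl⟩

lemma cls_eq_zero {ρ : Representation k G M} {n : ℕ} (z : cyc ρ n) :
    cls ρ n z = 0 ↔ (z : (Fin n → G) →₀ M) ∈ bnd ρ n := by
  unfold cls
  exact Submodule.Quotient.mk_eq_zero _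

lemma cls_eq {ρ : Representation k G M} {n : ℕ} (z w : cyc ρ n) :
    cls ρ n z = cls ρ n w ↔ (z : (Fin n → G) →₀ M) - w ∈ bnd ρ n := by
  rw [← sub_eq_zero, ← map_sub, cls_eq_zero]
  rfl

/-- a pair (f, φ) is compatible with the actions -/
abbrev Compat (ρ : Representation k G M) (ρ' : Representation k G' M')
    (f : G →* G') (φ : M →ₗ[k] M') : Prop := ∀ g m, φ (ρ g m) = ρ' (f g) (φ m)

lemma cmap_cyc {ρ : Representation k G M} {ρ' : Representation k G' M'}
    {f : G →* G'} {φ : M →ₗ[k] M'} (h : Compat ρ ρ' f φ) (n : ℕ) :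
    ∀ z ∈ cyc ρ n, cmap f φ n z ∈ cyc ρ' n := by
  intro z hz
  cases n with
  | zero => trivial
  | succ n =>
    have hz' : bd ρ n z = 0 := hz
    show bd ρ' n _ = 0
    rw [bd_cmap ρ ρ' f φ h, hz', map_zero]

lemma cmap_bnd {ρ : Representation k G M} {ρ' : Representation k G' M'}
    {f : G →* G'} {φ : M →ₗ[k] M'} (h : Compat ρ ρ' f φ) (n : ℕ) :
    ∀ z ∈ bnd ρ n, cmap f φ n z ∈ bnd ρ' n := by
  rintro _ ⟨x, rfl⟩
  exact ⟨cmap f φ (n + 1) x, bd_cmap ρ ρ' f φ h n x⟩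

/-- functoriality of homology -/
noncomputable def Hmap {ρ : Representation k G M} {ρ' : Representation k G' M'}
    (f : G →* G') (φ : M →ₗ[k] M') (h : Compat ρ ρ' f φ) (n : ℕ) : Hm ρ n →ₗ[k] Hm ρ' n :=
  Submodule.mapQ _ _ ((cmap f φ n).restrict (cmap_cyc h n)) (by
    rintro ⟨z, hz⟩ hm
    exact cmap_bnd h n z hm)

lemma Hmap_cls {ρ : Representation k G M} {ρ' : Representation k G' M'}
    (f : G →* G') (φ : M →ₗ[k] M') (h : Compat ρ ρ' f φ) (n : ℕ) (z) (hz : z ∈ cyc ρ n) :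
    Hmap f φ h n (cls ρ n ⟨z, hz⟩) = cls ρ' n ⟨cmap f φ n z, cmap_cyc h n z hz⟩ := rfl

lemma Compat.id (ρ : Representation k G M) : Compat ρ ρ (MonoidHom.id G) LinearMap.id :=
  fun _ _ => rfl

lemma Compat.comp {ρ : Representation k G M} {ρ' : Representation k G' M'}
    {ρ'' : Representation k G'' M''} {f : G →* G'} {φ : M →ₗ[k] M'}
    {f' : G' →* G''} {φ' : M' →ₗ[k] M''}
    (h' : Compat ρ' ρ'' f' φ') (h : Compat ρ ρ' f φ) : Compat ρ ρ'' (f'.comp f) (φ' ∘ₗ φ) := by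
  intro g m
  simp [h g m, h' (f g)]

lemma cmap_id (n : ℕ) (x) : cmap (k := k) (M := M) (MonoidHom.id G) LinearMap.id n x = x := by
  induction x using Finsupp.induction_linear with
  | zero => simp
  | add x y hx hy => simp [hx, hy]
  | single g a => rw [cmap_single]; rfl

lemma cmap_comp (f : G →* G') (φ : M →ₗ[k] M') (f' : G' →* G'') (φ' : M' →ₗ[k] M'') (n : ℕ) (x) :
    cmap f' φ' n (cmap f φ n x) = cmap (f'.comp f) (φ' ∘ₗ φ) n x := by
  induction x using Finsupp.induction_linear with
  | zero => simp
  | add x y hx hy => simp [hx, hy]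
  | single g a => simp only [cmap_single]; rfl

lemma Hmap_id {ρ : Representation k G M} (h : Compat ρ ρ (MonoidHom.id G) LinearMap.id) (n : ℕ)
    (x : Hm ρ n) : Hmap (MonoidHom.id G) LinearMap.id h n x = x := by
  obtain ⟨z, hz, rfl⟩ := cls_surj x
  simp only [Hmap_cls, cmap_id]

lemma Hmap_comp {ρ : Representation k G M} {ρ' : Representation k G' M'}
    {ρ'' : Representation k G'' M''} {f : G →* G'} {φ : M →ₗ[k] M'}
    {f' : G' →* G''} {φ' : M' →ₗ[k] M''}
    (h' : Compat ρ' ρ'' f' φ') (h : Compat ρ ρ' f φ) (n : ℕ) (x : Hm ρ n) :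
    Hmap f' φ' h' n (Hmap f φ h n x) = Hmap (f'.comp f) (φ' ∘ₗ φ) (h'.comp h) n x := by
  obtain ⟨z, hz, rfl⟩ := cls_surj x
  simp only [Hmap_cls, cmap_comp]

lemma Hmap_congr {ρ : Representation k G M} {ρ' : Representation k G' M'}
    {f f' : G →* G'} {φ φ' : M →ₗ[k] M'} (h : Compat ρ ρ' f φ) (h' : Compat ρ ρ' f' φ')
    (hf : f = f') (hφ : φ = φ') (n : ℕ) (x : Hm ρ n) :
    Hmap f φ h n x = Hmap f' φ' h' n x := by
  subst hf; subst hφ; rfl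

/-! degree zero -/

/-- the map from the module to H_0 -/
noncomputable def toH0 (ρ : Representation k G M) : M →ₗ[k] Hm ρ 0 :=
  (cls ρ 0).comp ((Finsupp.lsingle default).codRestrict _ (fun _ => mem_cyc_zero _ _))

lemma toH0_eq (ρ : Representation k G M) (m : M) :
    toH0 ρ m = cls ρ 0 ⟨single default m, mem_cyc_zero _ _⟩ := rfl

lemma toH0_surj (ρ : Representation k G M) : Function.Surjective (toH0 ρ) := by
  intro x
  obtain ⟨z, hz, rfl⟩ := cls_surj x
  refine ⟨z default, ?_⟩
  rw [toH0_eq]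
  congr 2
  ext
  simp

lemma toH0_act (ρ : Representation k G M) (g : G) (m : M) : toH0 ρ (ρ g m) = toH0 ρ m := by
  rw [toH0_eq, toH0_eq, cls_eq]
  refine ⟨single (fun _ => g⁻¹) m, ?_⟩
  rw [bd_single]
  simp only [Fin.sum_univ_succ, Finset.univ_eq_empty, Finset.sum_empty, Fin.val_zero]
  rw [Subsingleton.elim (Fin.tail fun _ => g⁻¹) (default : Fin 0 → G),
    Subsingleton.elim (Fin.contractNth _ _ _) (default : Fin 0 → G)]
  simp [sub_eq_add_neg]

lemma H0_lift (ρ : Representation k G M) {V : Type} [AddCommGroup V] [Module k V]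
    (φ : M →ₗ[k] V) (h : ∀ g m, φ (ρ g m) = φ m) :
    ∃ ψ : Hm ρ 0 →ₗ[k] V, ∀ m, ψ (toH0 ρ m) = φ m := by
  let Φ : ((Fin 0 → G) →₀ M) →ₗ[k] V := Finsupp.lsum k fun _ => φ
  have hs : ∀ v m, Φ (single v m) = φ m := by intro v m; simp [Φ]
  have hΦ : ∀ x, Φ (bd ρ 0 x) = 0 := by
    intro x
    induction x using Finsupp.induction_linear with
    | zero => simp
    | add x y hx hy => rw [map_add, map_add, hx, hy, add_zero]
    | single g a =>
      rw [bd_single, map_add, hs, h]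
      simp only [Fin.sum_univ_succ, Finset.univ_eq_empty, Finset.sum_empty, Fin.val_zero,
        add_zero, map_smul, hs]
      simp
  refine ⟨Submodule.liftQ _ (Φ.comp (cyc ρ 0).subtype) ?_, ?_⟩
  · rintro ⟨z, hz⟩ ⟨x, rfl⟩
    exact hΦ x
  · intro m
    exact hs default m

@[simp]
lemma Hmap_toH0 {ρ : Representation k G M} {ρ' : Representation k G' M'}
    (f : G →* G') (φ : M →ₗ[k] M') (h : Compat ρ ρ' f φ) (m : M) :
    Hmap f φ h 0 (toH0 ρ m) = toH0 ρ' (φ m) := by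
  rw [toH0_eq, toH0_eq, Hmap_cls]
  congr 2
  rw [cmap_single]
  congr 1
  exact Subsingleton.elim _ _

end Bar

end SpH


namespace SpH

open Finsupp

section LES

variable {k : Type} [Field k]
variable {G : Type} [Group G] {M : Type} [AddCommGroup M] [Module k M]
variable {M₁ : Type} [AddCommGroup M₁] [Module k M₁] {M₂ : Type} [AddCommGroup M₂] [Module k M₂]
variable {M₃ : Type} [AddCommGroup M₃] [Module k M₃]
variable {G' : Type} [Group G'] {M' : Type} [AddCommGroup M'] [Module k M']
variable {M₁' : Type} [AddCommGroup M₁'] [Module k M₁']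
variable {M₂' : Type} [AddCommGroup M₂'] [Module k M₂']
variable {M₃' : Type} [AddCommGroup M₃'] [Module k M₃']

/-- short exact sequences of representations -/
structure SES (ρ₁ : Representation k G M₁) (ρ₂ : Representation k G M₂)
    (ρ₃ : Representation k G M₃) where
  i : M₁ →ₗ[k] M₂
  p : M₂ →ₗ[k] M₃
  hi : ∀ g m, i (ρ₁ g m) = ρ₂ g (i m)
  hp : ∀ g m, p (ρ₂ g m) = ρ₃ g (p m)
  inj : Function.Injective i
  surj : Function.Surjective p
  pi : ∀ m, p (i m) = 0
  exact : ∀ m, p m = 0 → ∃ m', i m' = m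

variable {ρ₁ : Representation k G M₁} {ρ₂ : Representation k G M₂} {ρ₃ : Representation k G M₃}
variable {ρ₁' : Representation k G' M₁'} {ρ₂' : Representation k G' M₂'}
  {ρ₃' : Representation k G' M₃'}

namespace SES

variable (S : SES ρ₁ ρ₂ ρ₃)

lemma ci : Compat ρ₁ ρ₂ (MonoidHom.id G) S.i := S.hi
lemma cp : Compat ρ₂ ρ₃ (MonoidHom.id G) S.p := S.hp

/-- a linear section -/
noncomputable def s : M₃ →ₗ[k] M₂ :=
  (LinearMap.exists_rightInverse_of_surjective S.p (LinearMap.range_eq_top.2 S.surj)).choose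

lemma ps (m : M₃) : S.p (S.s m) = m := by
  have := (LinearMap.exists_rightInverse_of_surjective S.p
    (LinearMap.range_eq_top.2 S.surj)).choose_spec
  exact congrArg (fun f => f m) this

/-- a linear retraction -/
noncomputable def r : M₂ →ₗ[k] M₁ :=
  (LinearMap.exists_leftInverse_of_injective S.i (LinearMap.ker_eq_bot.2 S.inj)).choose

lemma ri (m : M₁) : S.r (S.i m) = m := by
  have := (LinearMap.exists_leftInverse_of_injective S.i
    (LinearMap.ker_eq_bot.2 S.inj)).choose_spec
  exact congrArg (fun f => f m) this

lemma ir (m : M₂) (h : S.p m = 0) : S.i (S.r m) = m := by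
  obtain ⟨m', rfl⟩ := S.exact m h
  rw [ri]

/-- inclusion on chains -/
noncomputable abbrev I (n : ℕ) := cmap (MonoidHom.id G) S.i n
/-- projection on chains -/
noncomputable abbrev Q (n : ℕ) := cmap (MonoidHom.id G) S.p n

end SES

lemma cmap_id_apply (φ : M →ₗ[k] M') (n : ℕ) (x : (Fin n → G) →₀ M) (v) :
    cmap (MonoidHom.id G) φ n x v = φ (x v) := by
  induction x using Finsupp.induction_linear with
  | zero => simp
  | add x y hx hy => simp [hx, hy]
  | single g a =>
    classical
    rw [cmap_single]
    simp only [MonoidHom.coe_id, Function.id_comp, single_apply]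
    split_ifs <;> simp

namespace SES

variable (S : SES ρ₁ ρ₂ ρ₃)

lemma I_inj {n : ℕ} {x y : (Fin n → G) →₀ M₁} (h : S.I n x = S.I n y) : x = y := by
  ext v
  apply S.inj
  rw [← cmap_id_apply, ← cmap_id_apply]
  exact congrArg (fun f => f v) h

lemma I_r {n : ℕ} (x : (Fin n → G) →₀ M₂) (h : S.Q n x = 0) :
    S.I n (cmap (MonoidHom.id G) S.r n x) = x := by
  ext v
  rw [cmap_id_apply, cmap_id_apply, S.ir]
  rw [← cmap_id_apply, h]; rfl

lemma Q_s {n : ℕ} (x : (Fin n → G) →₀ M₃) : S.Q n (cmap (MonoidHom.id G) S.s n x) = x := by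
  ext v
  rw [cmap_id_apply, cmap_id_apply, S.ps]

lemma Q_I {n : ℕ} (x : (Fin n → G) →₀ M₁) : S.Q n (S.I n x) = 0 := by
  ext v
  rw [cmap_id_apply, cmap_id_apply, S.pi]; rfl

lemma bd_I (n : ℕ) (x) : bd ρ₂ n (S.I (n + 1) x) = S.I n (bd ρ₁ n x) :=
  bd_cmap _ _ _ _ S.ci n x

lemma bd_Q (n : ℕ) (x) : bd ρ₃ n (S.Q (n + 1) x) = S.Q n (bd ρ₂ n x) :=
  bd_cmap _ _ _ _ S.cp n x

/-- connecting map on chains -/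
noncomputable def dc (n : ℕ) : ((Fin (n + 1) → G) →₀ M₃) →ₗ[k] ((Fin n → G) →₀ M₁) :=
  (cmap (MonoidHom.id G) S.r n) ∘ₗ (bd ρ₂ n) ∘ₗ (cmap (MonoidHom.id G) S.s (n + 1))

lemma I_dc (n : ℕ) (z) (hz : z ∈ cyc ρ₃ (n + 1)) :
    S.I n (S.dc n z) = bd ρ₂ n (cmap (MonoidHom.id G) S.s (n + 1) z) := by
  apply S.I_r
  show S.Q n (bd ρ₂ n _) = 0
  rw [← bd_Q, Q_s]
  exact hz

lemma dc_cyc (n : ℕ) (z) (hz : z ∈ cyc ρ₃ (n + 1)) : S.dc n z ∈ cyc ρ₁ n := by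
  cases n with
  | zero => exact mem_cyc_zero _ _
  | succ n =>
    rw [mem_cyc_succ]
    apply S.I_inj
    rw [← bd_I, I_dc _ _ _ hz, bd_bd, map_zero]

/-- any lift computes the connecting map -/
lemma dc_lift (n : ℕ) (z) (hz : z ∈ cyc ρ₃ (n + 1)) (y : (Fin (n + 1) → G) →₀ M₂)
    (hy : S.Q _ y = z) (x : (Fin n → G) →₀ M₁) (hx : S.I n x = bd ρ₂ n y) :
    x - S.dc n z ∈ bnd ρ₁ n := by
  have h0 : S.Q _ (y - cmap (MonoidHom.id G) S.s (n + 1) z) = 0 := by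
    rw [map_sub, Q_s, hy, sub_self]
  refine ⟨cmap (MonoidHom.id G) S.r (n + 1) (y - cmap (MonoidHom.id G) S.s (n + 1) z), ?_⟩
  apply S.I_inj
  rw [← bd_I, S.I_r _ h0, map_sub, map_sub, hx, S.I_dc _ _ hz]

/-- connecting homomorphism -/
noncomputable def δ (n : ℕ) : Hm ρ₃ (n + 1) →ₗ[k] Hm ρ₁ n :=
  Submodule.mapQ _ _ ((S.dc n).restrict (S.dc_cyc n)) (by
    rintro ⟨z, hz⟩ ⟨w, hw⟩
    have hw : bd ρ₃ (n + 1) w = z := hw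
    have := S.dc_lift n z hz (bd ρ₂ (n + 1) (cmap (MonoidHom.id G) S.s _ w))
      (by rw [← bd_Q, Q_s, hw]) 0 (by rw [bd_bd, map_zero])
    rw [zero_sub] at this
    have := (Submodule.neg_mem_iff _).1 this
    exact this)

lemma δ_cls (n : ℕ) (z) (hz : z ∈ cyc ρ₃ (n + 1)) :
    S.δ n (cls ρ₃ (n + 1) ⟨z, hz⟩) = cls ρ₁ n ⟨S.dc n z, S.dc_cyc n z hz⟩ := rfl

/-- map induced by i -/
noncomputable abbrev Hi (n : ℕ) := Hmap (MonoidHom.id G) S.i S.ci n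
/-- map induced by p -/
noncomputable abbrev Hp (n : ℕ) := Hmap (MonoidHom.id G) S.p S.cp n

lemma exact₂ (n : ℕ) (x : Hm ρ₂ n) (h : S.Hp n x = 0) : ∃ y, S.Hi n y = x := by
  obtain ⟨z, hz, rfl⟩ := cls_surj x
  rw [Hmap_cls, cls_eq_zero] at h
  obtain ⟨w, hw⟩ := h
  set z' := z - bd ρ₂ n (cmap (MonoidHom.id G) S.s _ w) with hz'
  have h1 : S.Q n z' = 0 := by
    rw [hz', map_sub, ← bd_Q, Q_s, hw]; exact sub_self _
  have h2 : z' ∈ cyc ρ₂ n := Submodule.sub_mem _ hz (bnd_le_cyc _ _ ⟨_, rfl⟩)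
  have h3 : cmap (MonoidHom.id G) S.r n z' ∈ cyc ρ₁ n := by
    cases n with
    | zero => exact mem_cyc_zero _ _
    | succ n =>
      rw [mem_cyc_succ]
      apply S.I_inj
      rw [← bd_I, S.I_r _ h1, map_zero]
      exact h2
  refine ⟨cls ρ₁ n ⟨_, h3⟩, ?_⟩
  rw [Hmap_cls, cls_eq]
  show S.I n _ - z ∈ _
  rw [S.I_r _ h1, hz']
  refine ⟨- cmap (MonoidHom.id G) S.s _ w, ?_⟩
  rw [map_neg]; abel

lemma HpHi (n : ℕ) (y) : S.Hp n (S.Hi n y) = 0 := by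
  obtain ⟨z, hz, rfl⟩ := cls_surj y
  rw [Hmap_cls, Hmap_cls, cls_eq_zero]
  show S.Q n (S.I n z) ∈ _
  rw [Q_I]; exact Submodule.zero_mem _

lemma Hiδ (n : ℕ) (x) : S.Hi n (S.δ n x) = 0 := by
  obtain ⟨z, hz, rfl⟩ := cls_surj x
  rw [δ_cls, Hmap_cls, cls_eq_zero]
  exact ⟨_, (S.I_dc n z hz).symm⟩

lemma δHp (n : ℕ) (x) : S.δ n (S.Hp (n + 1) x) = 0 := by
  obtain ⟨z, hz, rfl⟩ := cls_surj x
  rw [Hmap_cls, δ_cls, cls_eq_zero]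
  have := S.dc_lift n (S.Q _ z) (cmap_cyc S.cp _ z hz) z rfl 0
    (by rw [map_zero]; exact (mem_cyc_succ.1 hz).symm)
  rw [zero_sub] at this
  exact (Submodule.neg_mem_iff _).1 this

lemma exact₁ (n : ℕ) (x : Hm ρ₁ n) (h : S.Hi n x = 0) : ∃ y, S.δ n y = x := by
  obtain ⟨z, hz, rfl⟩ := cls_surj x
  rw [Hmap_cls, cls_eq_zero] at h
  obtain ⟨w, hw⟩ := h
  have hw : bd ρ₂ n w = S.I n z := hw
  have h1 : S.Q _ w ∈ cyc ρ₃ (n + 1) := by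
    rw [mem_cyc_succ, bd_Q, hw, Q_I]
  refine ⟨cls ρ₃ (n + 1) ⟨_, h1⟩, ?_⟩
  rw [δ_cls, eq_comm, cls_eq]
  exact S.dc_lift n _ h1 w rfl z hw.symm

lemma exact₃ (n : ℕ) (x : Hm ρ₃ (n + 1)) (h : S.δ n x = 0) : ∃ y, S.Hp (n + 1) y = x := by
  obtain ⟨z, hz, rfl⟩ := cls_surj x
  rw [δ_cls, cls_eq_zero] at h
  obtain ⟨w, hw⟩ := h
  have hw : bd ρ₁ n w = S.dc n z := hw
  have h1 : cmap (MonoidHom.id G) S.s (n + 1) z - S.I _ w ∈ cyc ρ₂ (n + 1) := by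
    rw [mem_cyc_succ, map_sub, ← S.I_dc n z hz, bd_I, hw, sub_self]
  refine ⟨cls ρ₂ (n + 1) ⟨_, h1⟩, ?_⟩
  rw [Hmap_cls, cls_eq]
  show S.Q _ _ - z ∈ _
  rw [map_sub, Q_s, Q_I, sub_zero, sub_self]
  exact Submodule.zero_mem _

lemma Hp0_surj : Function.Surjective (S.Hp 0) := by
  intro x
  obtain ⟨m, rfl⟩ := toH0_surj _ x
  obtain ⟨m', rfl⟩ := S.surj m
  exact ⟨toH0 _ m', Hmap_toH0 _ _ _ _⟩

/-- naturality of the connecting map -/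
lemma δ_nat (S' : SES ρ₁' ρ₂' ρ₃') (f : G →* G')
    (φ₁ : M₁ →ₗ[k] M₁') (φ₂ : M₂ →ₗ[k] M₂') (φ₃ : M₃ →ₗ[k] M₃')
    (h₁ : Compat ρ₁ ρ₁' f φ₁) (h₂ : Compat ρ₂ ρ₂' f φ₂) (h₃ : Compat ρ₃ ρ₃' f φ₃)
    (hi : ∀ m, φ₂ (S.i m) = S'.i (φ₁ m)) (hp : ∀ m, φ₃ (S.p m) = S'.p (φ₂ m)) (n : ℕ) (x) :
    Hmap f φ₁ h₁ n (S.δ n x) = S'.δ n (Hmap f φ₃ h₃ (n + 1) x) := by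
  obtain ⟨z, hz, rfl⟩ := cls_surj x
  rw [δ_cls, Hmap_cls, Hmap_cls, δ_cls, cls_eq]
  have e1 : ∀ n y, S'.I n (cmap f φ₁ n y) = cmap f φ₂ n (S.I n y) := by
    intro n y
    rw [cmap_comp, cmap_comp]
    congr 2
    ext m; simp [hi]
  have e2 : ∀ n y, S'.Q n (cmap f φ₂ n y) = cmap f φ₃ n (S.Q n y) := by
    intro n y
    rw [cmap_comp, cmap_comp]
    congr 2
    ext m; simp [hp]
  refine S'.dc_lift n _ (cmap_cyc h₃ _ z hz) (cmap f φ₂ _ (cmap (MonoidHom.id G) S.s (n + 1) z))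
    ?_ _ ?_
  · rw [e2, Q_s]
  · rw [e1, I_dc _ _ _ hz, bd_cmap _ _ _ _ h₂]

end SES

end LES

/-! Higman criterion -/
section Higman

variable {k : Type} [Field k]
variable {G : Type} [Group G] {M : Type} [AddCommGroup M] [Module k M]

lemma contractNth_cons_succ {n : ℕ} (x : G) (g : Fin (n + 1) → G) (j : Fin (n + 1)) :
    Fin.contractNth j.succ (· * ·) (Fin.cons x g : Fin (n + 2) → G)
      = Fin.cons x (Fin.contractNth j (· * ·) g) := by
  funext i
  refine Fin.cases ?_ (fun i => ?_) i
  · simp [Fin.contractNth]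
  · simp only [Fin.cons_succ, Fin.contractNth, Fin.val_succ]
    split_ifs with h1 h2 h3 h4 h5 h6 <;> first | rfl | omega

lemma contractNth_cons_zero {n : ℕ} (x : G) (g : Fin (n + 1) → G) :
    Fin.contractNth 0 (· * ·) (Fin.cons x g : Fin (n + 2) → G)
      = Fin.cons (x * g 0) (Fin.tail g) := by
  funext i
  refine Fin.cases ?_ (fun i => ?_) i
  · simp [Fin.contractNth]
  · simp [Fin.contractNth, Fin.tail]

variable [Fintype G]

/-- contraction -/
noncomputable def hcon (ρ : Representation k G M) (e : M →ₗ[k] M) (n : ℕ) :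
    ((Fin n → G) →₀ M) →ₗ[k] ((Fin (n + 1) → G) →₀ M) :=
  Finsupp.lsum k fun g => ∑ x : G, (Finsupp.lsingle (Fin.cons x g : Fin (n + 1) → G)).comp
    (e ∘ₗ ρ x)

lemma hcon_single (ρ : Representation k G M) (e : M →ₗ[k] M) (n : ℕ) (g : Fin n → G) (m : M) :
    hcon ρ e n (single g m) = ∑ x : G, single (Fin.cons x g : Fin (n + 1) → G) (e (ρ x m)) := by
  simp [hcon]

/-- Higman: relative projectivity implies acyclicity. -/
def Higman (ρ : Representation k G M) : Prop :=
  ∃ e : M →ₗ[k] M, ∀ m, ∑ x : G, ρ x⁻¹ (e (ρ x m)) = m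

lemma Higman.acyclic {ρ : Representation k G M} (h : Higman ρ) (n : ℕ) (x : Hm ρ (n + 1)) :
    x = 0 := by
  obtain ⟨e, he⟩ := h
  have key : ∀ z, bd ρ (n + 1) (hcon ρ e (n + 1) z) = z - hcon ρ e n (bd ρ n z) := by
    intro z
    induction z using Finsupp.induction_linear with
    | zero => simp
    | add x y hx hy => simp only [map_add, hx, hy]; abel
    | single g m =>
      rw [hcon_single, map_sum]
      simp only [bd_single]
      rw [Finset.sum_add_distrib, map_add, map_sum]
      simp only [map_smul, hcon_single]
      have h1 : ∑ x : G, single (Fin.tail (Fin.cons x g : Fin (n + 2) → G))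
          (ρ ((Fin.cons x g : Fin (n + 2) → G) 0)⁻¹ (e (ρ x m))) = single g m := by
        simp only [Fin.tail_cons, Fin.cons_zero]
        rw [← Finsupp.single_finsetSum, he]
      rw [h1]
      have h2 : ∑ x : G, single (Fin.cons (x * g 0) (Fin.tail g) : Fin (n + 1) → G) (e (ρ x m))
          = ∑ x : G, single (Fin.cons x (Fin.tail g) : Fin (n + 1) → G)
              (e (ρ x (ρ (g 0)⁻¹ m))) := by
        refine Fintype.sum_equiv (Equiv.mulRight (g 0)) _ _ fun x => ?_
        simp [← Module.End.mul_apply, ← map_mul]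
      simp only [Fin.sum_univ_succ (n := n + 1), contractNth_cons_zero, contractNth_cons_succ]
      rw [Finset.sum_add_distrib]
      simp only [Fin.val_zero, zero_add, pow_one, neg_smul, one_smul, Finset.sum_neg_distrib, h2]
      rw [Finset.sum_comm]
      simp only [Fin.val_succ, pow_succ _ (_ + 1), mul_neg, mul_one, neg_smul,
        Finset.sum_neg_distrib, Finset.smul_sum]
      abel
  obtain ⟨z, hz, rfl⟩ := cls_surj x
  rw [cls_eq_zero]
  refine ⟨hcon ρ e (n + 1) z, ?_⟩
  rw [key, mem_cyc_succ.1 hz, map_zero]; exact sub_zero _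

end Higman

end SpH


namespace SpH

open Finsupp

/-- monoid action by endomorphisms -/
structure Act (𝓜 : Type) [Monoid 𝓜] (G : Type) [Group G] where
  hom : 𝓜 → (G →* G)
  one : hom 1 = MonoidHom.id G
  mul : ∀ a b, hom (a * b) = (hom a).comp (hom b)

instance (𝓜 : Type) [Monoid 𝓜] (G : Type) [Group G] :
    CoeFun (Act 𝓜 G) (fun _ => 𝓜 → (G →* G)) := ⟨Act.hom⟩

section Eq

variable {k : Type} [Field k]
variable {G : Type} [Group G] {M : Type} [AddCommGroup M] [Module k M]
variable {M' : Type} [AddCommGroup M'] [Module k M']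
variable {𝓜 : Type} [Monoid 𝓜] {θ : Act 𝓜 G}

/-- element of monoid algebra kills a representation -/
def Kills (τ : Representation k 𝓜 M) (ε : MonoidAlgebra k 𝓜) : Prop :=
  ∀ v, τ.asAlgebraHom ε v = 0

lemma asAlg_comm {τ : Representation k 𝓜 M} {τ' : Representation k 𝓜 M'} (f : M →ₗ[k] M')
    (h : ∀ q v, f (τ q v) = τ' q (f v)) (ε : MonoidAlgebra k 𝓜) (v : M) :
    f (τ.asAlgebraHom ε v) = τ'.asAlgebraHom ε (f v) := by
  induction ε using MonoidAlgebra.induction_linear with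
  | zero => simp
  | add x y hx hy => simp [hx, hy]
  | single g a => simp [Representation.asAlgebraHom_single, h]

lemma Kills.of_inj {τ : Representation k 𝓜 M} {τ' : Representation k 𝓜 M'} (f : M →ₗ[k] M')
    (h : ∀ q v, f (τ q v) = τ' q (f v)) (hf : Function.Injective f) {ε : MonoidAlgebra k 𝓜}
    (H : Kills τ' ε) : Kills τ ε := by
  intro v
  apply hf
  rw [asAlg_comm f h, H, map_zero]

lemma Kills.of_surj {τ : Representation k 𝓜 M} {τ' : Representation k 𝓜 M'} (f : M →ₗ[k] M')
    (h : ∀ q v, f (τ q v) = τ' q (f v)) (hf : Function.Surjective f) {ε : MonoidAlgebra k 𝓜}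
    (H : Kills τ ε) : Kills τ' ε := by
  intro v
  obtain ⟨w, rfl⟩ := hf v
  rw [← asAlg_comm f h, H, map_zero]

lemma asAlg_idem (τ : Representation k 𝓜 M) {ε : MonoidAlgebra k 𝓜} (hε : ε * ε = ε) (v : M) :
    τ.asAlgebraHom ε (τ.asAlgebraHom ε v) = τ.asAlgebraHom ε v := by
  rw [← Module.End.mul_apply, ← map_mul, hε]

/-- a module over G and an operator monoid 𝓜 acting on G by endomorphisms -/
structure EqRep (k : Type) [Field k] {G : Type} [Group G] {𝓜 : Type} [Monoid 𝓜]
    (θ : Act 𝓜 G) (M : Type) [AddCommGroup M] [Module k M] where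
  ρ : Representation k G M
  τ : Representation k 𝓜 M
  comm : ∀ q g v, τ q (ρ g v) = ρ (θ q g) (τ q v)

namespace EqRep

variable (X : EqRep k θ M) (Y : EqRep k θ M')

lemma compat (q : 𝓜) : Compat X.ρ X.ρ (θ q) (X.τ q) := X.comm q

/-- operators on homology -/
noncomputable def op (n : ℕ) : Representation k 𝓜 (Hm X.ρ n) where
  toFun q := Hmap (θ q) (X.τ q) (X.compat q) n
  map_one' := by
    ext x
    rw [Hmap_congr (X.compat 1) (Compat.id X.ρ) θ.one (by rw [map_one]; rfl),
      Hmap_id]; rfl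
  map_mul' a b := by
    ext x
    rw [Module.End.mul_apply, Hmap_comp]
    exact Hmap_congr _ _ (θ.mul a b) (by rw [map_mul]; rfl) _ _

lemma op_apply (n : ℕ) (q : 𝓜) (x) :
    X.op n q x = Hmap (θ q) (X.τ q) (X.compat q) n x := rfl

/-- equivariant maps commute with operators -/
lemma op_map (φ : M →ₗ[k] M') (hρ : ∀ g v, φ (X.ρ g v) = Y.ρ g (φ v))
    (hτ : ∀ q v, φ (X.τ q v) = Y.τ q (φ v)) (n : ℕ) (q : 𝓜) (x : Hm X.ρ n) :
    Hmap (ρ' := Y.ρ) (MonoidHom.id G) φ hρ n (X.op n q x)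
      = Y.op n q (Hmap (MonoidHom.id G) φ hρ n x) := by
  rw [op_apply, op_apply, Hmap_comp, Hmap_comp]
  exact Hmap_congr _ _ rfl (LinearMap.ext (hτ q)) _ _

/-- sub-object -/
def sub (W : Submodule k M) (hρ : ∀ g, ∀ v ∈ W, X.ρ g v ∈ W) (hτ : ∀ q, ∀ v ∈ W, X.τ q v ∈ W) :
    EqRep k θ W where
  ρ :=
    { toFun := fun g => (X.ρ g).restrict (hρ g)
      map_one' := by ext v; simp
      map_mul' := fun a b => by ext v; simp }
  τ :=
    { toFun := fun g => (X.τ g).restrict (hτ g)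
      map_one' := by ext v; simp
      map_mul' := fun a b => by ext v; simp }
  comm q g v := by
    apply Subtype.ext
    exact X.comm q g v

lemma sub_ρ (W : Submodule k M) (hρ) (hτ) (g) (v : W) :
    (((X.sub W hρ hτ).ρ g v : W) : M) = X.ρ g v := rfl
lemma sub_τ (W : Submodule k M) (hρ) (hτ) (g) (v : W) :
    (((X.sub W hρ hτ).τ g v : W) : M) = X.τ g v := rfl

/-- kernel of an equivariant map -/
def ker (φ : M →ₗ[k] M') (hρ : ∀ g v, φ (X.ρ g v) = Y.ρ g (φ v))
    (hτ : ∀ q v, φ (X.τ q v) = Y.τ q (φ v)) : EqRep k θ (LinearMap.ker φ) :=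
  X.sub (LinearMap.ker φ) (fun g v hv => by
    rw [LinearMap.mem_ker] at hv ⊢; rw [hρ, hv, map_zero])
    (fun q v hv => by rw [LinearMap.mem_ker] at hv ⊢; rw [hτ, hv, map_zero])

/-- the short exact sequence of a surjective equivariant map -/
def kerSES (φ : M →ₗ[k] M') (hρ : ∀ g v, φ (X.ρ g v) = Y.ρ g (φ v))
    (hτ : ∀ q v, φ (X.τ q v) = Y.τ q (φ v)) (hs : Function.Surjective φ) :
    SES (X.ker Y φ hρ hτ).ρ X.ρ Y.ρ where
  i := (LinearMap.ker φ).subtype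
  p := φ
  hi _ _ := rfl
  hp := hρ
  inj := Subtype.val_injective
  surj := hs
  pi m := m.2
  exact m hm := ⟨⟨m, hm⟩, rfl⟩

/-- k[G] ⊗ M -/
noncomputable def free : EqRep k θ (G →₀ M) where
  ρ :=
    { toFun := fun g => Finsupp.lsum k fun x => (Finsupp.lsingle (g * x)).comp (X.ρ g)
      map_one' := by ext; simp
      map_mul' := fun a b => by ext; simp [mul_assoc] }
  τ :=
    { toFun := fun g => Finsupp.lsum k fun x => (Finsupp.lsingle (θ g x)).comp (X.τ g)
      map_one' := by ext; simp [θ.one]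
      map_mul' := fun a b => by ext; simp [θ.mul] }
  comm q g v := by
    induction v using Finsupp.induction_linear with
    | zero => simp
    | add x y hx hy => simp only [map_add, hx, hy]
    | single x a => simp [X.comm]

@[simp]
lemma free_ρ (g x : G) (m : M) : X.free.ρ g (single x m) = single (g * x) (X.ρ g m) := by
  simp [free]

@[simp]
lemma free_τ (q : 𝓜) (x : G) (m : M) : X.free.τ q (single x m) = single (θ q x) (X.τ q m) := by
  simp [free]

/-- augmentation -/
noncomputable def aug : (G →₀ M) →ₗ[k] M := Finsupp.lsum k fun _ => LinearMap.id

@[simp]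
lemma aug_single (x : G) (m : M) : aug (k := k) (single x m) = m := by simp [aug]

lemma aug_ρ (g : G) (v) : aug (k := k) (X.free.ρ g v) = X.ρ g (aug (k := k) v) := by
  induction v using Finsupp.induction_linear with
  | zero => simp
  | add x y hx hy => simp only [map_add, hx, hy]
  | single x a => simp

lemma aug_τ (q : 𝓜) (v) : aug (k := k) (X.free.τ q v) = X.τ q (aug (k := k) v) := by
  induction v using Finsupp.induction_linear with
  | zero => simp
  | add x y hx hy => simp only [map_add, hx, hy]
  | single x a => simp

lemma aug_surj : Function.Surjective (aug (k := k) : (G →₀ M) →ₗ[k] M) :=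
  fun m => ⟨single 1 m, aug_single 1 m⟩

/-- syzygy -/
noncomputable def syz : EqRep k θ (LinearMap.ker (aug (k := k) : (G →₀ M) →ₗ[k] M)) :=
  X.free.ker X aug X.aug_ρ X.aug_τ

/-- standard exact sequence -/
noncomputable def std : SES X.syz.ρ X.free.ρ X.ρ := X.free.kerSES X aug X.aug_ρ X.aug_τ aug_surj

/-- projection on the 1-component -/
noncomputable def pr1 : (G →₀ M) →ₗ[k] (G →₀ M) := by
  classical
  exact Finsupp.lsum k fun x => if x = 1 then Finsupp.lsingle 1 else 0

lemma free_pr1 [Fintype G] (v) : ∑ x : G, X.free.ρ x⁻¹ (pr1 (k := k) (X.free.ρ x v)) = v := by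
  classical
  induction v using Finsupp.induction_linear with
  | zero => simp
  | add x y hx hy => simp only [map_add, Finset.sum_add_distrib, hx, hy]
  | single y a =>
    rw [Finset.sum_eq_single y⁻¹]
    · simp [pr1]
    · intro b _ hb
      have : ¬ (b * y = 1) := fun h => hb (eq_inv_of_mul_eq_one_left h)
      simp [pr1, this]
    · simp

lemma free_higman [Fintype G] : Higman X.free.ρ := ⟨pr1, X.free_pr1⟩

end EqRep

lemma Higman.comp_inj [Fintype G] {S : Type} [Group S] [Fintype S] {ρ : Representation k G M}
    (h : Higman ρ) (f : S →* G) (hf : Function.Injective f) :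
    Higman (ρ.comp f : Representation k S M) := by
  classical
  obtain ⟨e, he⟩ := h
  have hbij : Function.Bijective
      (fun x : (G ⧸ f.range) × f.range => x.1.out * (x.2 : G)) := by
    constructor
    · rintro ⟨q, s⟩ ⟨q', s'⟩ h
      have h : q.out * (s : G) = q'.out * (s' : G) := h
      have h1 : ∀ (q : G ⧸ f.range) (s : f.range), ((q.out * (s : G) : G) : G ⧸ f.range) = q := by
        intro q s
        rw [QuotientGroup.mk_mul_of_mem _ s.2]
        exact Quotient.out_eq q
      have h2 : q = q' := by rw [← h1 q s, h, h1]
      subst h2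
      have h3 : s = s' := Subtype.ext (mul_left_cancel h)
      rw [h3]
    · intro g
      refine ⟨(g, ⟨(g : G ⧸ f.range).out⁻¹ * g, ?_⟩), by simp⟩
      rw [← QuotientGroup.eq]
      exact Quotient.out_eq _
  let E : G ≃ (G ⧸ f.range) × f.range := (Equiv.ofBijective _ hbij).symm
  have hE : ∀ q s, E.symm (q, s) = q.out * s := by
    intro q s
    rfl
  refine ⟨∑ q : G ⧸ f.range, ρ (q.out)⁻¹ ∘ₗ e ∘ₗ ρ q.out, fun m => ?_⟩
  conv_rhs => rw [← he m]
  rw [← Equiv.sum_comp E.symm, Fintype.sum_prod_type, Finset.sum_comm]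
  let F : S ≃ f.range := Equiv.ofBijective f.rangeRestrict
    ⟨fun a b hab => hf (congrArg Subtype.val hab), f.rangeRestrict_surjective⟩
  rw [← Equiv.sum_comp F]
  refine Finset.sum_congr rfl fun s _ => ?_
  simp only [LinearMap.sum_apply, map_sum, LinearMap.comp_apply, hE]
  refine Finset.sum_congr rfl fun q _ => ?_
  have hF : (F s : G) = f s := rfl
  rw [hF]
  simp [map_mul]

lemma Higman.of_card [Fintype G] (ρ : Representation k G M)
    (h : (Fintype.card G : k) ≠ 0) : Higman ρ := by
  refine ⟨(Fintype.card G : k)⁻¹ • LinearMap.id, fun m => ?_⟩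
  simp only [LinearMap.smul_apply, LinearMap.id_apply, map_smul]
  have : ∀ x, ρ x⁻¹ (ρ x m) = m := by
    intro x; rw [← Module.End.mul_apply, ← map_mul]; simp
  simp only [this, Finset.sum_const, Finset.card_univ]
  rw [← Nat.cast_smul_eq_nsmul k, smul_smul, mul_inv_cancel₀ h, one_smul]

/-- trivial action -/
def Act.triv (𝓜 : Type) [Monoid 𝓜] (G : Type) [Group G] : Act 𝓜 G :=
  ⟨fun _ => MonoidHom.id G, rfl, fun _ _ => rfl⟩

/-- trivial operators -/
def EqRep.ofRep (ρ : Representation k G M) :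
    EqRep k (Act.triv Unit G) M :=
  ⟨ρ, 1, fun _ _ _ => rfl⟩

lemma EqRep.std_δ_inj [Fintype G] (X : EqRep k θ M) (n : ℕ) :
    Function.Injective (X.std.δ n) := by
  rw [injective_iff_map_eq_zero]
  intro y hy
  obtain ⟨u, hu⟩ := X.std.exact₃ n _ hy
  rw [← hu, X.free_higman.acyclic n u, map_zero]

lemma inner_compat (ρ : Representation k G M) (w : G) :
    Compat ρ ρ (MulAut.conj w).toMonoidHom (ρ w) := by
  intro g m
  simp [← Module.End.mul_apply, ← map_mul]

/-- inner automorphisms act trivially -/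
lemma inner_triv' [Fintype G] (n : ℕ) : ∀ {M : Type} [AddCommGroup M] [Module k M]
    (X : EqRep k (Act.triv Unit G) M) (w : G) (x : Hm X.ρ n),
    Hmap (MulAut.conj w).toMonoidHom (X.ρ w) (inner_compat X.ρ w) n x = x := by
  induction n with
  | zero =>
    intro M _ _ X w x
    obtain ⟨m, rfl⟩ := toH0_surj _ x
    rw [Hmap_toH0, toH0_act]
  | succ n ih =>
    intro M _ _ X w x
    apply X.std_δ_inj
    rw [← X.std.δ_nat X.std (MulAut.conj w).toMonoidHom (X.syz.ρ w) (X.free.ρ w) (X.ρ w)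
      (inner_compat _ _) (inner_compat _ _) (inner_compat _ _)
      (fun m => X.std.hi w m) (fun m => (X.std.hp w m).symm) n x, ih]

lemma inner_triv [Fintype G] (n : ℕ) (ρ : Representation k G M) (w : G) (x : Hm ρ n) :
    Hmap (MulAut.conj w).toMonoidHom (ρ w) (inner_compat ρ w) n x = x :=
  inner_triv' n (EqRep.ofRep ρ) w x

end Eq

end SpH


namespace SpH

open Finsupp

section Split

variable {k : Type} [Field k]
variable {G : Type} [Group G] {M : Type} [AddCommGroup M] [Module k M]
variable {M' : Type} [AddCommGroup M'] [Module k M']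
variable {N₁ : Type} [Group N₁] {N₂ : Type} [Group N₂]
variable {𝓜 : Type} [Monoid 𝓜] {θ : Act 𝓜 G} {θ₁ : Act 𝓜 N₁} {θ₂ : Act 𝓜 N₂}

/-- split extension with operators -/
structure Split (θ : Act 𝓜 G) (θ₁ : Act 𝓜 N₁) (θ₂ : Act 𝓜 N₂) where
  i₁ : N₁ →* G
  i₂ : N₂ →* G
  α : Act N₂ N₁
  conj : ∀ a b, i₂ b * i₁ a = i₁ (α b a) * i₂ b
  bij : Function.Bijective (fun x : N₁ × N₂ => i₁ x.1 * i₂ x.2)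
  h₁ : ∀ q a, θ q (i₁ a) = i₁ (θ₁ q a)
  h₂ : ∀ q b, θ q (i₂ b) = i₂ (θ₂ q b)

namespace Split

variable (S : Split θ θ₁ θ₂) (X : EqRep k θ M) (Y : EqRep k θ M')

lemma inj₁ : Function.Injective S.i₁ := by
  intro a b h
  have := @S.bij.1 (a, 1) (b, 1) (by simp [h])
  exact congrArg Prod.fst this

lemma inj₂ : Function.Injective S.i₂ := by
  intro a b h
  have := @S.bij.1 (1, a) (1, b) (by simp [h])
  exact congrArg Prod.snd this

lemma α_θ (q : 𝓜) (a : N₁) (b : N₂) : θ₁ q (S.α b a) = S.α (θ₂ q b) (θ₁ q a) := by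
  apply S.inj₁
  apply mul_right_cancel (b := S.i₂ (θ₂ q b))
  rw [← S.conj, ← S.h₁, ← S.h₁, ← S.h₂, ← map_mul, ← map_mul, S.conj]

/-- restriction to N₁ with its 𝓜-operators -/
noncomputable abbrev res : EqRep k θ₁ M :=
  ⟨X.ρ.comp S.i₁, X.τ, fun q g v => by
    show X.τ q (X.ρ (S.i₁ g) v) = X.ρ (S.i₁ _) _
    rw [X.comm, S.h₁]⟩

/-- restriction to N₁ with its N₂-operators -/
noncomputable abbrev resN : EqRep k S.α M :=
  ⟨X.ρ.comp S.i₁, X.ρ.comp S.i₂, fun q g v => by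
    show X.ρ (S.i₂ q) (X.ρ (S.i₁ g) v) = X.ρ (S.i₁ _) (X.ρ (S.i₂ q) _)
    rw [← Module.End.mul_apply, ← Module.End.mul_apply, ← map_mul, ← map_mul, S.conj]⟩

/-- homology of N₁ as a module over N₂ and 𝓜 -/
noncomputable def HN (b : ℕ) : EqRep k θ₂ (Hm (X.ρ.comp S.i₁) b) where
  ρ := (S.resN X).op b
  τ := (S.res X).op b
  comm q g v := by
    rw [EqRep.op_apply, EqRep.op_apply, EqRep.op_apply, EqRep.op_apply, Hmap_comp, Hmap_comp]
    refine Hmap_congr _ _ ?_ ?_ _ _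
    · ext a; simp [S.α_θ]
    · ext m
      show X.τ q (X.ρ (S.i₂ g) m) = X.ρ (S.i₂ _) (X.τ q m)
      rw [X.comm, S.h₂]

lemma HN_ρ (b : ℕ) (y : N₂) (x) : (S.HN X b).ρ y x = (S.resN X).op b y x := rfl
lemma HN_τ (b : ℕ) (y : 𝓜) (x) : (S.HN X b).τ y x = (S.res X).op b y x := rfl

lemma HN_ρ_toH0 (y : N₂) (m : M) :
    (S.HN X 0).ρ y (toH0 (X.ρ.comp S.i₁) m) = toH0 (X.ρ.comp S.i₁) (X.ρ (S.i₂ y) m) :=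
  Hmap_toH0 _ _ ((S.resN X).compat y) _

lemma HN_τ_toH0 (y : 𝓜) (m : M) :
    (S.HN X 0).τ y (toH0 (X.ρ.comp S.i₁) m) = toH0 (X.ρ.comp S.i₁) (X.τ y m) :=
  Hmap_toH0 _ _ ((S.res X).compat y) _

/-- restriction of compatible maps -/
lemma res_compat {X : EqRep k θ M} {Y : EqRep k θ M'} {φ : M →ₗ[k] M'}
    (hρ : ∀ g v, φ (X.ρ g v) = Y.ρ g (φ v)) :
    Compat (X.ρ.comp S.i₁ : Representation k N₁ M) (Y.ρ.comp S.i₁ : Representation k N₁ M')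
      (MonoidHom.id N₁) φ := fun g v => hρ (S.i₁ g) v

/-- map on HN -/
noncomputable def HNmap {X : EqRep k θ M} {Y : EqRep k θ M'} (φ : M →ₗ[k] M')
    (hρ : ∀ g v, φ (X.ρ g v) = Y.ρ g (φ v)) (b : ℕ) :
    Hm (X.ρ.comp S.i₁ : Representation k N₁ M) b →ₗ[k]
      Hm (Y.ρ.comp S.i₁ : Representation k N₁ M') b :=
  Hmap (MonoidHom.id N₁) φ (S.res_compat hρ) b

lemma HNmap_ρ (φ : M →ₗ[k] M') (hρ : ∀ g v, φ (X.ρ g v) = Y.ρ g (φ v)) (b : ℕ) (y : N₂) (x) :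
    S.HNmap φ hρ b ((S.HN X b).ρ y x) = (S.HN Y b).ρ y (S.HNmap φ hρ b x) :=
  (S.resN X).op_map (S.resN Y) φ (fun g v => hρ (S.i₁ g) v) (fun g v => hρ (S.i₂ g) v) b y x

lemma HNmap_τ (φ : M →ₗ[k] M') (hρ : ∀ g v, φ (X.ρ g v) = Y.ρ g (φ v))
    (hτ : ∀ g v, φ (X.τ g v) = Y.τ g (φ v)) (b : ℕ) (y : 𝓜) (x) :
    S.HNmap φ hρ b ((S.HN X b).τ y x) = (S.HN Y b).τ y (S.HNmap φ hρ b x) :=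
  (S.res X).op_map (S.res Y) φ (fun g v => hρ (S.i₁ g) v) hτ b y x

/-- restricting exact sequences -/
def resSES {M₁ M₂ M₃ : Type} [AddCommGroup M₁] [Module k M₁] [AddCommGroup M₂] [Module k M₂]
    [AddCommGroup M₃] [Module k M₃] {ρ₁ : Representation k G M₁} {ρ₂ : Representation k G M₂}
    {ρ₃ : Representation k G M₃} {N : Type} [Group N] (f : N →* G) (T : SES ρ₁ ρ₂ ρ₃) :
    SES (ρ₁.comp f : Representation k N M₁) (ρ₂.comp f : Representation k N M₂)
      (ρ₃.comp f : Representation k N M₃) where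
  i := T.i
  p := T.p
  hi g m := T.hi (f g) m
  hp g m := T.hp (f g) m
  inj := T.inj
  surj := T.surj
  pi := T.pi
  exact := T.exact

/-- the connecting map for N₁ of the standard sequence -/
noncomputable def δN (b : ℕ) : Hm (X.ρ.comp S.i₁ : Representation k N₁ M) (b + 1) →ₗ[k]
    Hm (X.syz.ρ.comp S.i₁ : Representation k N₁ _) b := (resSES S.i₁ X.std).δ b

lemma δN_ρ (b : ℕ) (y : N₂) (x) :
    S.δN X b ((S.HN X (b + 1)).ρ y x) = (S.HN X.syz b).ρ y (S.δN X b x) := by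
  symm
  exact (resSES S.i₁ X.std).δ_nat (resSES S.i₁ X.std) (S.α y) (X.syz.ρ (S.i₂ y))
    (X.free.ρ (S.i₂ y)) (X.ρ (S.i₂ y)) ((S.resN X.syz).compat y) ((S.resN X.free).compat y)
    ((S.resN X).compat y) (fun m => X.std.hi (S.i₂ y) m)
    (fun m => (X.std.hp (S.i₂ y) m).symm) b x

lemma δN_τ (b : ℕ) (y : 𝓜) (x) :
    S.δN X b ((S.HN X (b + 1)).τ y x) = (S.HN X.syz b).τ y (S.δN X b x) := by
  symm
  exact (resSES S.i₁ X.std).δ_nat (resSES S.i₁ X.std) (θ₁ y) (X.syz.τ y)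
    (X.free.τ y) (X.τ y) ((S.res X.syz).compat y) ((S.res X.free).compat y)
    ((S.res X).compat y) (fun m => rfl)
    (fun m => (X.aug_τ y m).symm) b x

section fin
variable [Fintype G] [Fintype N₁] [Fintype N₂]

lemma free_acyc₁ (b : ℕ) (x : Hm (X.free.ρ.comp S.i₁ : Representation k N₁ _) (b + 1)) : x = 0 :=
  (X.free_higman.comp_inj S.i₁ S.inj₁).acyclic b x

lemma δN_inj (b : ℕ) : Function.Injective (S.δN X b) := by
  rw [injective_iff_map_eq_zero]
  intro y hy
  obtain ⟨u, hu⟩ := (resSES S.i₁ X.std).exact₃ b _ hy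
  rw [← hu, S.free_acyc₁ X b u, map_zero]

lemma δN_surj (b : ℕ) : Function.Surjective (S.δN X (b + 1)) := by
  intro y
  apply (resSES S.i₁ X.std).exact₁ (b + 1)
  exact S.free_acyc₁ X b _

lemma free_HN0_higman : Higman (S.HN X.free 0).ρ := by
  classical
  let e : (G →₀ M) →ₗ[k] (G →₀ M) :=
    ∑ a : N₁, X.free.ρ (S.i₁ a)⁻¹ ∘ₗ EqRep.pr1 ∘ₗ X.free.ρ (S.i₁ a)
  have he : ∀ c m, e (X.free.ρ (S.i₁ c) m) = X.free.ρ (S.i₁ c) (e m) := by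
    intro c m
    simp only [e, LinearMap.sum_apply, LinearMap.comp_apply, map_sum]
    refine Fintype.sum_equiv (Equiv.mulRight c) _ _ fun a => ?_
    simp only [Equiv.coe_mulRight, ← Module.End.mul_apply, ← map_mul]
    simp only [Module.End.mul_apply, ← map_mul]
    simp
  obtain ⟨e', he'⟩ := H0_lift (X.free.ρ.comp S.i₁ : Representation k N₁ _)
    ((toH0 (X.free.ρ.comp S.i₁ : Representation k N₁ _)).comp e) (fun c m => by
      show toH0 _ (e (X.free.ρ (S.i₁ c) m)) = _
      rw [he]
      exact toH0_act (X.free.ρ.comp S.i₁ : Representation k N₁ _) c _)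
  refine ⟨e', fun x => ?_⟩
  obtain ⟨m, rfl⟩ := toH0_surj _ x
  simp only [HN_ρ_toH0, he', LinearMap.comp_apply]
  rw [← map_sum]
  congr 1
  conv_rhs => rw [← X.free_pr1 m]
  rw [← Function.Bijective.sum_comp S.bij
    (fun x : G => X.free.ρ x⁻¹ (EqRep.pr1 (k := k) (X.free.ρ x m))),
    Fintype.sum_prod_type, Finset.sum_comm]
  refine Finset.sum_congr rfl fun b _ => ?_
  simp only [e, LinearMap.sum_apply, LinearMap.comp_apply, map_sum]
  refine Finset.sum_congr rfl fun a _ => ?_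
  simp [map_mul]

end fin

/-- comparison in degree zero -/
lemma H0_iso : ∃ κ : Hm X.ρ 0 →ₗ[k] Hm (S.HN X 0).ρ 0, Function.Injective κ ∧
    ∀ m, κ (toH0 X.ρ m) = toH0 (S.HN X 0).ρ (toH0 (X.ρ.comp S.i₁) m) := by
  obtain ⟨κ, hκ⟩ := H0_lift X.ρ ((toH0 (S.HN X 0).ρ).comp (toH0 (X.ρ.comp S.i₁))) (by
    intro g m
    obtain ⟨⟨a, b⟩, rfl⟩ := S.bij.2 g
    simp only [LinearMap.comp_apply, map_mul, Module.End.mul_apply]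
    have : toH0 (X.ρ.comp S.i₁) (X.ρ (S.i₁ a) (X.ρ (S.i₂ b) m))
      = toH0 (X.ρ.comp S.i₁) (X.ρ (S.i₂ b) m) :=
      toH0_act (X.ρ.comp S.i₁ : Representation k N₁ M) a _
    rw [this, ← HN_ρ_toH0, toH0_act])
  obtain ⟨η, hη⟩ := H0_lift (X.ρ.comp S.i₁) (toH0 X.ρ) (fun a m => toH0_act X.ρ (S.i₁ a) m)
  obtain ⟨μ, hμ⟩ := H0_lift (S.HN X 0).ρ η (by
    intro y x
    obtain ⟨m, rfl⟩ := toH0_surj _ x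
    rw [HN_ρ_toH0, hη, hη, toH0_act])
  refine ⟨κ, ?_, hκ⟩
  intro x y hxy
  obtain ⟨m, rfl⟩ := toH0_surj _ x
  obtain ⟨m', rfl⟩ := toH0_surj _ y
  have := congrArg μ hxy
  rw [hκ, hκ] at this
  simp only [LinearMap.comp_apply] at this
  rwa [hμ, hμ, hη, hη] at this

end Split

end Split

end SpH


namespace SpH

open Finsupp

section T2

variable {k : Type} [Field k]
variable {G : Type} [Group G]
variable {𝓜 : Type} [Monoid 𝓜] {θ : Act 𝓜 G}

/-- the connecting map is equivariant -/
lemma EqRep.kerSES_δ {M M' : Type} [AddCommGroup M] [Module k M] [AddCommGroup M'] [Module k M']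
    (X : EqRep k θ M) (Y : EqRep k θ M') (φ : M →ₗ[k] M') (hρ) (hτ) (hs) (n : ℕ) (q : 𝓜) (x) :
    (X.kerSES Y φ hρ hτ hs).δ n (Y.op (n + 1) q x)
      = (X.ker Y φ hρ hτ).op n q ((X.kerSES Y φ hρ hτ hs).δ n x) := by
  symm
  exact (X.kerSES Y φ hρ hτ hs).δ_nat (X.kerSES Y φ hρ hτ hs) (θ q) ((X.ker Y φ hρ hτ).τ q)
    (X.τ q) (Y.τ q) ((X.ker Y φ hρ hτ).compat q) (X.compat q) (Y.compat q) (fun m => rfl)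
    (fun m => (hτ q m).symm) n x

lemma EqRep.std_δ_op {M : Type} [AddCommGroup M] [Module k M] (X : EqRep k θ M)
    (n : ℕ) (q : 𝓜) (x) :
    X.std.δ n (X.op (n + 1) q x) = X.syz.op n q (X.std.δ n x) :=
  X.free.kerSES_δ X _ _ _ _ n q x

/-- four term lemma -/
lemma four_term {A B P Q : Type} [AddCommGroup A] [Module k A] [AddCommGroup B] [Module k B]
    [AddCommGroup P] [Module k P] [AddCommGroup Q] [Module k Q]
    (XA : EqRep k θ A) (XB : EqRep k θ B) (XP : EqRep k θ P) (XQ : EqRep k θ Q)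
    (i : A →ₗ[k] B) (hiρ : ∀ g v, i (XA.ρ g v) = XB.ρ g (i v))
    (hiτ : ∀ g v, i (XA.τ g v) = XB.τ g (i v))
    (j : B →ₗ[k] P) (hjρ : ∀ g v, j (XB.ρ g v) = XP.ρ g (j v))
    (hjτ : ∀ g v, j (XB.τ g v) = XP.τ g (j v))
    (q : P →ₗ[k] Q) (hqρ : ∀ g v, q (XP.ρ g v) = XQ.ρ g (q v))
    (hqτ : ∀ g v, q (XP.τ g v) = XQ.τ g (q v))
    (inj : Function.Injective i) (ji : ∀ a, j (i a) = 0) (ex : ∀ b, j b = 0 → ∃ a, i a = b)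
    (qj : ∀ a, q (j a) = 0) (ex' : ∀ b, q b = 0 → ∃ a, j a = b) (surj : Function.Surjective q)
    {ε : MonoidAlgebra k 𝓜} (hε : ε * ε = ε) (n : ℕ)
    (hA : Kills (XA.op n) ε) (hQ : Kills (XQ.op (n + 1)) ε) (y : Hm XB.ρ n)
    (hy : Hmap (ρ' := XP.ρ) (MonoidHom.id G) j hjρ n y = 0) :
    (XB.op n).asAlgebraHom ε y = 0 := by
  let S' := XP.kerSES XQ q hqρ hqτ surj
  let XC := XP.ker XQ q hqρ hqτ
  let p : B →ₗ[k] LinearMap.ker q := j.codRestrict _ (fun a => qj a)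
  have hpρ : ∀ g v, p (XB.ρ g v) = XC.ρ g (p v) := fun g v => Subtype.ext (hjρ g v)
  have hpτ : ∀ g v, p (XB.τ g v) = XC.τ g (p v) := fun g v => Subtype.ext (hjτ g v)
  let S : SES XA.ρ XB.ρ XC.ρ :=
    { i := i, p := p, hi := hiρ, hp := hpρ, inj := inj
      surj := fun c => by
        obtain ⟨a, ha⟩ := ex' c.1 c.2
        exact ⟨a, Subtype.ext ha⟩
      pi := fun m => Subtype.ext (ji m)
      exact := fun m hm => ex m (congrArg Subtype.val hm) }
  have h1 : S'.Hi n (S.Hp n y) = 0 := by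
    rw [← hy]
    show Hmap _ _ _ n (Hmap _ _ _ n y) = _
    rw [Hmap_comp]
    exact Hmap_congr _ _ rfl rfl _ _
  obtain ⟨z, hz⟩ := S'.exact₁ n _ h1
  have h2 : (XC.op n).asAlgebraHom ε (S.Hp n y) = 0 := by
    rw [← hz, ← asAlg_comm (S'.δ n) (fun q' x => XP.kerSES_δ XQ q hqρ hqτ surj n q' x), hQ,
      map_zero]
  have h3 : S.Hp n ((XB.op n).asAlgebraHom ε y) = 0 := by
    rw [← h2]
    exact asAlg_comm (S.Hp n) (fun q' x => XB.op_map XC p hpρ hpτ n q' x) ε y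
  obtain ⟨w, hw⟩ := S.exact₂ n _ h3
  rw [← asAlg_idem _ hε, ← hw]
  have h4 := asAlg_comm (S.Hi n) (fun q' x => XA.op_map XB i hiρ hiτ n q' x) ε w
  rw [← h4, hA, map_zero]

namespace Split

variable {N₁ : Type} [Group N₁] {N₂ : Type} [Group N₂]
variable {θ₁ : Act 𝓜 N₁} {θ₂ : Act 𝓜 N₂}
variable (S : Split θ θ₁ θ₂) [Fintype G] [Fintype N₁] [Fintype N₂]

lemma lemma_b0 {M : Type} [AddCommGroup M] [Module k M] (X : EqRep k θ M)
    {ε : MonoidAlgebra k 𝓜} (hε : ε * ε = ε) (n : ℕ)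
    (hA : Kills ((S.HN X 1).op n) ε) (hQ : Kills ((S.HN X 0).op (n + 1)) ε)
    (y : Hm (S.HN X.syz 0).ρ n)
    (hy : Hmap (ρ' := (S.HN X.free 0).ρ) (MonoidHom.id N₂)
      (S.HNmap (X := X.syz) (Y := X.free) X.std.i X.std.hi 0)
      (fun g v => S.HNmap_ρ X.syz X.free _ _ 0 g v) n y = 0) :
    ((S.HN X.syz 0).op n).asAlgebraHom ε y = 0 := by
  refine four_term (S.HN X 1) (S.HN X.syz 0) (S.HN X.free 0) (S.HN X 0)
    (S.δN X 0) (S.δN_ρ X 0) (S.δN_τ X 0)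
    (S.HNmap (X := X.syz) (Y := X.free) X.std.i X.std.hi 0) (S.HNmap_ρ X.syz X.free _ _ 0)
    (S.HNmap_τ X.syz X.free _ _ (fun _ _ => rfl) 0)
    (S.HNmap (X := X.free) (Y := X) X.std.p X.std.hp 0) (S.HNmap_ρ X.free X _ _ 0)
    (S.HNmap_τ X.free X _ _ X.aug_τ 0)
    (S.δN_inj X 0) ?_ ?_ ?_ ?_ ?_ hε n hA hQ y hy
  · exact fun a => (resSES S.i₁ X.std).Hiδ 0 a
  · exact fun a => (resSES S.i₁ X.std).exact₁ 0 a
  · exact fun a => (resSES S.i₁ X.std).HpHi 0 a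
  · exact fun a => (resSES S.i₁ X.std).exact₂ 0 a
  · exact (resSES S.i₁ X.std).Hp0_surj

/-- T2 -/
theorem kills {ε : MonoidAlgebra k 𝓜} (hε : ε * ε = ε) (n : ℕ) :
    ∀ {M : Type} [AddCommGroup M] [Module k M] (X : EqRep k θ M),
    (∀ a b, a + b = n → Kills ((S.HN X b).op a) ε) → Kills (X.op n) ε := by
  have base : ∀ {M : Type} [AddCommGroup M] [Module k M] (X : EqRep k θ M)
      (κ : Hm X.ρ 0 →ₗ[k] Hm (S.HN X 0).ρ 0)
      (_ : ∀ m, κ (toH0 X.ρ m) = toH0 (S.HN X 0).ρ (toH0 (X.ρ.comp S.i₁) m)) (q : 𝓜) (x),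
      κ (X.op 0 q x) = (S.HN X 0).op 0 q (κ x) := by
    intro M _ _ X κ hκ q x
    obtain ⟨m, rfl⟩ := toH0_surj _ x
    rw [EqRep.op_apply, EqRep.op_apply, hκ, Hmap_toH0, Hmap_toH0, hκ, HN_τ_toH0]
  induction n with
  | zero =>
    intro M _ _ X h
    obtain ⟨κ, hκi, hκ⟩ := S.H0_iso X
    exact Kills.of_inj κ (base X κ hκ) hκi (h 0 0 rfl)
  | succ n ih =>
    intro M _ _ X h x
    apply X.std_δ_inj
    rw [asAlg_comm (X.std.δ n) (fun q x => X.std_δ_op n q x), map_zero]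
    have hy0 : X.std.Hi n (X.std.δ n x) = 0 := X.std.Hiδ n x
    generalize X.std.δ n x = y at hy0 ⊢
    cases n with
    | succ n =>
      refine ih X.syz ?_ y
      intro a b hab
      cases b with
      | zero =>
        subst hab
        intro y
        refine S.lemma_b0 X hε _ (h _ _ rfl) (h _ _ rfl) y ?_
        exact (S.free_HN0_higman X).acyclic _ _
      | succ b =>
        refine Kills.of_surj (Hmap (ρ' := (S.HN X.syz (b+1)).ρ) (MonoidHom.id N₂) (S.δN X (b + 1))
          (S.δN_ρ X (b+1)) a)
          (fun q x => (S.HN X (b+1+1)).op_map (S.HN X.syz (b+1)) _ _ (S.δN_τ X (b+1)) a q x) ?_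
          (h a (b + 1 + 1) (by omega))
        intro z
        let E := LinearEquiv.ofBijective (S.δN X (b+1)) ⟨S.δN_inj X _, S.δN_surj X _⟩
        have hE : ∀ v, S.δN X (b+1) (E.symm v) = v := fun v => E.apply_symm_apply v
        have hc : Compat (S.HN X.syz (b+1)).ρ (S.HN X (b+1+1)).ρ (MonoidHom.id N₂)
          E.symm.toLinearMap := by
          intro g v
          apply S.δN_inj X
          show S.δN X (b+1) (E.symm _) = S.δN X (b+1) ((S.HN X (b+1+1)).ρ g (E.symm _))
          rw [hE, S.δN_ρ, hE]
        refine ⟨Hmap _ _ hc a z, ?_⟩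
        rw [Hmap_comp]
        exact (Hmap_congr _ (Compat.id _) rfl (LinearMap.ext hE) _ _).trans (Hmap_id _ _ _)
    | zero =>
      obtain ⟨κ, hκi, hκ⟩ := S.H0_iso X.syz
      obtain ⟨κ', hκi', hκ'⟩ := S.H0_iso X.free
      apply hκi
      rw [asAlg_comm κ (base X.syz κ hκ), map_zero]
      refine S.lemma_b0 X hε _ (h _ _ rfl) (h _ _ rfl) _ ?_
      rw [← map_zero κ', ← hy0]
      obtain ⟨m, rfl⟩ := toH0_surj _ y
      rw [hκ]
      show _ = κ' (Hmap _ _ _ 0 _)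
      rw [Hmap_toH0, Hmap_toH0, hκ']
      congr 1
      exact Hmap_toH0 _ _ (S.res_compat X.std.hi) _

/-- vanishing version of T2 -/
theorem vanish (n : ℕ) {M : Type} [AddCommGroup M] [Module k M] (X : EqRep k θ M)
    (h : ∀ a b, a + b = n → ∀ x : Hm (S.HN X b).ρ a, x = 0) (x : Hm X.ρ n) : x = 0 := by
  have := S.kills (ε := 1) (one_mul 1) n X (fun a b hab v => h a b hab _) x
  simpa using this

end Split

end T2

end SpH


namespace SpH

open Finsupp

section Lin
variable {k : Type} [Field k]
variable {G : Type} [Group G] {M : Type} [AddCommGroup M] [Module k M]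
variable {G' : Type} [Group G'] {M' : Type} [AddCommGroup M'] [Module k M']
variable {ρ : Representation k G M} {ρ' : Representation k G' M'}

lemma cmap_add_φ (f : G →* G') (φ ψ : M →ₗ[k] M') (n : ℕ) (x) :
    cmap f (φ + ψ) n x = cmap f φ n x + cmap f ψ n x := by
  induction x using Finsupp.induction_linear with
  | zero => simp
  | add x y hx hy => simp only [map_add, hx, hy]; abel
  | single x a => simp [cmap_single]

lemma cmap_smul_φ (f : G →* G') (c : k) (φ : M →ₗ[k] M') (n : ℕ) (x) :
    cmap f (c • φ) n x = c • cmap f φ n x := by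
  induction x using Finsupp.induction_linear with
  | zero => simp
  | add x y hx hy => simp only [map_add, hx, hy, smul_add]
  | single x a => simp [cmap_single]

lemma Hmap_add_φ {f : G →* G'} {φ ψ χ : M →ₗ[k] M'} (h : Compat ρ ρ' f φ) (h' : Compat ρ ρ' f ψ)
    (h'' : Compat ρ ρ' f χ) (he : χ = φ + ψ) (n : ℕ) (x : Hm ρ n) :
    Hmap f χ h'' n x = Hmap f φ h n x + Hmap f ψ h' n x := by
  subst he
  obtain ⟨z, hz, rfl⟩ := cls_surj x
  rw [Hmap_cls, Hmap_cls, Hmap_cls, ← map_add]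
  congr 1
  exact Subtype.ext (cmap_add_φ f φ ψ n z)

lemma Hmap_smul_φ {f : G →* G'} {φ χ : M →ₗ[k] M'} (h : Compat ρ ρ' f φ) (c : k)
    (h'' : Compat ρ ρ' f χ) (he : χ = c • φ) (n : ℕ) (x : Hm ρ n) :
    Hmap f χ h'' n x = c • Hmap f φ h n x := by
  subst he
  obtain ⟨z, hz, rfl⟩ := cls_surj x
  rw [Hmap_cls, Hmap_cls, ← map_smul]
  congr 1
  exact Subtype.ext (cmap_smul_φ f c φ n z)

lemma Hmap_zero_φ {f : G →* G'} {χ : M →ₗ[k] M'}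
    (h'' : Compat ρ ρ' f χ) (he : χ = 0) (n : ℕ) (x : Hm ρ n) :
    Hmap f χ h'' n x = 0 := by
  rw [Hmap_smul_φ h'' 0 h'' (by rw [zero_smul, he]), zero_smul]

lemma Hmap_sum_φ {f : G →* G'} {ι : Type} (s : Finset ι) {φ : ι → (M →ₗ[k] M')}
    (h : ∀ i, Compat ρ ρ' f (φ i)) {χ : M →ₗ[k] M'}
    (h'' : Compat ρ ρ' f χ) (he : χ = ∑ i ∈ s, φ i) (n : ℕ) (x : Hm ρ n) :
    Hmap f χ h'' n x = ∑ i ∈ s, Hmap f (φ i) (h i) n x := by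
  classical
  induction s using Finset.induction_on generalizing χ with
  | empty => simpa using Hmap_zero_φ h'' (by simpa using he) n x
  | insert a s ha ih =>
    rw [Finset.sum_insert ha]
    rw [Finset.sum_insert ha] at he
    have hc : Compat ρ ρ' f (∑ i ∈ s, φ i) := by
      intro g m
      simp only [LinearMap.sum_apply, map_sum]
      exact Finset.sum_congr rfl fun i _ => h i g m
    rw [Hmap_add_φ (h a) hc h'' he, ih hc rfl]

end Lin

section Sh

variable {k : Type} [Field k]
variable {G : Type} [Group G] {M : Type} [AddCommGroup M] [Module k M]
variable {M' : Type} [AddCommGroup M'] [Module k M']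
variable (Y : Type) [MulAction G Y]

/-- `k[Y] ⊗ M` with the diagonal action -/
noncomputable def yRep (ρ : Representation k G M) : Representation k G (Y →₀ M) where
  toFun := fun g => Finsupp.lsum k fun x => (Finsupp.lsingle (g • x)).comp (ρ g)
  map_one' := by ext; simp
  map_mul' := fun a b => by ext; simp [mul_smul]

@[simp]
lemma yRep_single (ρ : Representation k G M) (g : G) (y : Y) (m : M) :
    yRep Y ρ g (single y m) = single (g • y) (ρ g m) := by
  simp [yRep]

/-- functoriality in M -/
noncomputable def yMap (φ : M →ₗ[k] M') : (Y →₀ M) →ₗ[k] (Y →₀ M') := Finsupp.mapRange.linearMap φ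

@[simp]
lemma yMap_single (φ : M →ₗ[k] M') (y : Y) (m : M) :
    yMap Y φ (single y m) = single y (φ m) := by
  simp [yMap]

lemma yMap_compat {ρ : Representation k G M} {ρ' : Representation k G M'} (φ : M →ₗ[k] M')
    (h : ∀ g m, φ (ρ g m) = ρ' g (φ m)) (g : G) (v) :
    yMap Y φ (yRep Y ρ g v) = yRep Y ρ' g (yMap Y φ v) := by
  induction v using Finsupp.induction_linear with
  | zero => simp
  | add x y hx hy => simp only [map_add, hx, hy]
  | single x a => simp [h]

lemma Higman.yRep [Fintype G] {ρ : Representation k G M} (h : Higman ρ) : Higman (yRep Y ρ) := by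
  obtain ⟨e, he⟩ := h
  refine ⟨yMap Y e, fun v => ?_⟩
  induction v using Finsupp.induction_linear with
  | zero => simp
  | add x y hx hy => simp only [map_add, Finset.sum_add_distrib, hx, hy]
  | single x a =>
    simp only [yRep_single, yMap_single, inv_smul_smul]
    conv_rhs => rw [← he a]
    exact (map_sum (Finsupp.singleAddHom x) _ _).symm

/-- exactness of k[Y] ⊗ - -/
noncomputable def ySES {M₁ M₂ M₃ : Type} [AddCommGroup M₁] [Module k M₁] [AddCommGroup M₂]
    [Module k M₂]
    [AddCommGroup M₃] [Module k M₃] {ρ₁ : Representation k G M₁} {ρ₂ : Representation k G M₂}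
    {ρ₃ : Representation k G M₃} (T : SES ρ₁ ρ₂ ρ₃) :
    SES (yRep Y ρ₁) (yRep Y ρ₂) (yRep Y ρ₃) where
  i := yMap Y T.i
  p := yMap Y T.p
  hi := yMap_compat Y T.i T.hi
  hp := yMap_compat Y T.p T.hp
  inj := Finsupp.mapRange_injective _ (map_zero _) T.inj
  surj := Finsupp.mapRange_surjective _ (map_zero _) T.surj
  pi m := by
    ext y
    simp [yMap, T.pi]
  exact m hm := by
    have : ∀ y, ∃ a, T.i a = m y := fun y => T.exact _ (by
      have := DFunLike.congr_fun hm y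
      simpa [yMap] using this)
    choose a ha using this
    classical
    refine ⟨Finsupp.onFinset m.support a (fun y hy => ?_), ?_⟩
    · rw [Finsupp.mem_support_iff]
      intro h0
      apply hy
      apply T.inj
      rw [ha, h0, map_zero]
    · ext y
      simp [yMap, ha]

variable {Y}
variable {S : Type} [Group S] (f : S →* G) (y0 : Y)

lemma sh_compat (hst : ∀ s, f s • y0 = y0) (ρ : Representation k G M) :
    Compat (ρ.comp f : Representation k S M) (yRep Y ρ) f (Finsupp.lsingle y0) := by
  intro s m
  simp [hst]

theorem shapiro' [Fintype G] [Fintype S] [MulAction.IsPretransitive G Y]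
    (hf : Function.Injective f)
    (hst : ∀ s, f s • y0 = y0) (hst' : ∀ g : G, g • y0 = y0 → ∃ s, f s = g) (n : ℕ) :
    ∀ {M : Type} [AddCommGroup M] [Module k M] (X : EqRep k (Act.triv Unit G) M),
    Function.Bijective (Hmap f (Finsupp.lsingle y0) (sh_compat f y0 hst X.ρ) n) := by
  induction n with
  | zero =>
    intro M _ _ X
    choose c hc using MulAction.exists_smul_eq G y0 (α := Y)
    obtain ⟨ψ, hψ⟩ := H0_lift (yRep Y X.ρ)
      (Finsupp.lsum k fun y => (toH0 (X.ρ.comp f : Representation k S M)).comp (X.ρ (c y)⁻¹)) (by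
      intro g v
      induction v using Finsupp.induction_linear with
      | zero => simp
      | add x y hx hy => simp only [map_add, hx, hy]
      | single y m =>
        simp only [yRep_single, lsum_single, LinearMap.comp_apply]
        obtain ⟨s, hs⟩ := hst' ((c (g • y))⁻¹ * g * c y) (by
          rw [mul_smul, mul_smul, hc, inv_smul_eq_iff, hc])
        have := toH0_act (X.ρ.comp f : Representation k S M) s (X.ρ (c y)⁻¹ m)
        rw [← this]
        congr 1
        show _ = X.ρ (f s) _
        rw [hs, ← Module.End.mul_apply, ← Module.End.mul_apply, ← map_mul, ← map_mul]
        simp)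
    constructor
    · intro x y hxy
      have key : ∀ m, ψ (Hmap f (Finsupp.lsingle y0) (sh_compat f y0 hst X.ρ) 0
          (toH0 (X.ρ.comp f : Representation k S M) m)) = toH0 (X.ρ.comp f) m := by
        intro m
        rw [Hmap_toH0, hψ]
        simp only [lsum_single, LinearMap.comp_apply, lsingle_apply]
        obtain ⟨s, hs⟩ := hst' (c y0)⁻¹ (by rw [inv_smul_eq_iff, hc])
        rw [← hs]
        exact toH0_act (X.ρ.comp f : Representation k S M) s m
      obtain ⟨m, rfl⟩ := toH0_surj _ x
      obtain ⟨m', rfl⟩ := toH0_surj _ y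
      rw [← key, hxy, key]
    · intro x
      obtain ⟨v, rfl⟩ := toH0_surj _ x
      induction v using Finsupp.induction_linear with
      | zero => exact ⟨0, by simp⟩
      | add x y hx hy =>
        obtain ⟨a, ha⟩ := hx
        obtain ⟨b, hb⟩ := hy
        exact ⟨a + b, by rw [map_add, map_add, ha, hb]⟩
      | single y m =>
        refine ⟨toH0 _ (X.ρ (c y)⁻¹ m), ?_⟩
        rw [Hmap_toH0, ← toH0_act _ (c y)]
        congr 1
        simp [hc]
  | succ n ih =>
    intro M _ _ X
    let T := Split.resSES f X.std
    let T' := ySES Y X.std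
    have nat : ∀ x, Hmap f (Finsupp.lsingle y0) (sh_compat f y0 hst X.syz.ρ) n (T.δ n x)
      = T'.δ n (Hmap f (Finsupp.lsingle y0) (sh_compat f y0 hst X.ρ) (n + 1) x) := by
      intro x
      exact T.δ_nat T' f (Finsupp.lsingle y0) (Finsupp.lsingle y0) (Finsupp.lsingle y0)
        (sh_compat f y0 hst X.syz.ρ) (sh_compat f y0 hst X.free.ρ) (sh_compat f y0 hst X.ρ)
        (fun m => (yMap_single Y X.std.i y0 m).symm)
        (fun m => (yMap_single Y X.std.p y0 m).symm) n x
    have hT : Function.Injective (T.δ n) := by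
      rw [injective_iff_map_eq_zero]
      intro y hy
      obtain ⟨u, hu⟩ := T.exact₃ n _ hy
      rw [← hu, (X.free_higman.comp_inj f hf).acyclic n u, map_zero]
    have hT' : Function.Injective (T'.δ n) := by
      rw [injective_iff_map_eq_zero]
      intro y hy
      obtain ⟨u, hu⟩ := T'.exact₃ n _ hy
      rw [← hu, (X.free_higman.yRep Y).acyclic n u, map_zero]
    constructor
    · intro x y hxy
      apply hT
      apply (ih X.syz).1
      rw [nat, nat, hxy]
    · intro y
      obtain ⟨u, hu⟩ := (ih X.syz).2 (T'.δ n y)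
      have h1 : T.Hi n u = 0 := by
        apply (ih X.free).1
        rw [map_zero, ← T'.Hiδ n y, ← hu]
        show Hmap _ _ _ n (Hmap _ _ _ n _) = Hmap _ _ _ n (Hmap _ _ _ n _)
        rw [Hmap_comp, Hmap_comp]
        refine Hmap_congr _ _ rfl (LinearMap.ext fun m => ?_) _ _
        exact (yMap_single Y X.std.i y0 m).symm
      obtain ⟨x, hx⟩ := T.exact₁ n u h1
      refine ⟨x, ?_⟩
      apply hT'
      rw [← nat, hx, hu]

/-- Shapiro's lemma -/
theorem shapiro [Fintype G] [Fintype S] [MulAction.IsPretransitive G Y]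
    (hf : Function.Injective f)
    (hst : ∀ s, f s • y0 = y0) (hst' : ∀ g : G, g • y0 = y0 → ∃ s, f s = g) (n : ℕ)
    (ρ : Representation k G M) :
    Function.Bijective (Hmap f (Finsupp.lsingle y0) (sh_compat f y0 hst ρ) n) :=
  shapiro' f y0 hf hst hst' n (EqRep.ofRep ρ)

/-- norm map -/
noncomputable def yNorm (k : Type) [Field k] (Y : Type) [Fintype Y] {M : Type} [AddCommGroup M]
    [Module k M] : M →ₗ[k] (Y →₀ M) :=
  ∑ y : Y, Finsupp.lsingle y

lemma yNorm_compat [Fintype Y] (ρ : Representation k G M) :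
    Compat ρ (yRep Y ρ) (MonoidHom.id G) (yNorm k Y) := by
  intro g m
  simp only [yNorm, LinearMap.sum_apply, lsingle_apply, map_sum, yRep_single, MonoidHom.id_apply]
  exact (Equiv.sum_comp (MulAction.toPerm g) (fun y : Y => single y (ρ g m))).symm

/-- augmentation -/
noncomputable def yAug (k : Type) [Field k] (Y : Type) {M : Type} [AddCommGroup M]
    [Module k M] : (Y →₀ M) →ₗ[k] M := Finsupp.lsum k fun _ => LinearMap.id

@[simp]
lemma yAug_single (y : Y) (m : M) : yAug k Y (single y m) = m := by simp [yAug]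

lemma yAug_compat (ρ : Representation k G M) :
    Compat (yRep Y ρ) ρ (MonoidHom.id G) (yAug k Y) := by
  intro g v
  induction v using Finsupp.induction_linear with
  | zero => simp
  | add x y hx hy => simp only [map_add, hx, hy]
  | single x a => simp

theorem transfer' [Fintype G] [Fintype S] [Fintype Y] [MulAction.IsPretransitive G Y]
    (hf : Function.Injective f)
    (hst : ∀ s, f s • y0 = y0) (hst' : ∀ g : G, g • y0 = y0 → ∃ s, f s = g) (n : ℕ)
    (ρ : Representation k G M) (hY : (Fintype.card Y : k) ≠ 0)
    (h : ∀ x : Hm (ρ.comp f : Representation k S M) n, x = 0) (x : Hm ρ n) : x = 0 := by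
  have h1 : ∀ z : Hm (yRep Y ρ) n, z = 0 := by
    intro z
    obtain ⟨u, rfl⟩ := (shapiro f y0 hf hst hst' n ρ).2 z
    rw [h u, map_zero]
  have h2 : Hmap _ _ (yAug_compat (Y := Y) ρ) n (Hmap _ _ (yNorm_compat (Y := Y) ρ) n x) = 0 := by
    rw [h1 (Hmap _ _ (yNorm_compat (Y := Y) ρ) n x), map_zero]
  rw [Hmap_comp, Hmap_smul_φ (f := (MonoidHom.id G).comp (MonoidHom.id G)) (Compat.id ρ)
    (Fintype.card Y : k) _ ?_] at h2
  · have h3 := (smul_eq_zero.1 h2).resolve_left hY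
    exact (Hmap_id (Compat.id ρ) n x).symm.trans h3
  · ext m
    simp only [yNorm, LinearMap.comp_apply, LinearMap.sum_apply, map_sum, lsingle_apply,
      yAug_single, Finset.sum_const, Finset.card_univ, LinearMap.smul_apply, LinearMap.id_apply]
    rw [Nat.cast_smul_eq_nsmul]

/-- transfer -/
theorem transfer [Fintype G] [Fintype S] (f : S →* G)
    (hf : Function.Injective f) (n : ℕ)
    (ρ : Representation k G M) (hY : (f.range.index : k) ≠ 0)
    (h : ∀ x : Hm (ρ.comp f : Representation k S M) n, x = 0) (x : Hm ρ n) : x = 0 := by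
  classical
  have hs := MulAction.stabilizer_quotient f.range
  refine transfer' (Y := G ⧸ f.range) f ((1 : G) : G ⧸ f.range) hf ?_ ?_ n ρ ?_ h x
  · intro s
    rw [← MulAction.mem_stabilizer_iff, hs]
    exact ⟨s, rfl⟩
  · intro g hg
    rw [← MulAction.mem_stabilizer_iff, hs] at hg
    exact hg
  · rwa [← Nat.card_eq_fintype_card]

end Sh

end SpH


namespace SpH

set_option linter.unusedSectionVars false
set_option linter.unusedSimpArgs false

open Finsupp

section H1
variable {k : Type} [Field k]
variable {G : Type} [Group G] {M : Type} [AddCommGroup M] [Module k M]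
variable {G' : Type} [Group G'] {M' : Type} [AddCommGroup M'] [Module k M']

lemma H1_cyc {ρ : Representation k G M} (hρ : ∀ g m, ρ g m = m) (z) : z ∈ cyc ρ 1 := by
  rw [mem_cyc_succ]
  induction z using Finsupp.induction_linear with
  | zero => simp
  | add x y hx hy => rw [map_add, hx, hy, add_zero]
  | single g a =>
    rw [bd_single, hρ]
    simp only [Fin.sum_univ_succ, Finset.univ_eq_empty, Finset.sum_empty, Fin.val_zero]
    rw [Subsingleton.elim (Fin.tail g) (default : Fin 0 → G),
      Subsingleton.elim (Fin.contractNth _ _ _) (default : Fin 0 → G)]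
    simp

/-- the basic classes in H_1 with trivial action -/
noncomputable def L1 {ρ : Representation k G M} (hρ : ∀ g m, ρ g m = m) (g : G) :
    M →ₗ[k] Hm ρ 1 :=
  (cls ρ 1).comp ((Finsupp.lsingle (fun _ => g)).codRestrict _ (fun _ => H1_cyc hρ _))

lemma L1_mul {ρ : Representation k G M} (hρ : ∀ g m, ρ g m = m) (g h : G) (m : M) :
    L1 hρ (g * h) m = L1 hρ g m + L1 hρ h m := by
  symm
  rw [← sub_eq_zero]
  show cls ρ 1 ⟨single _ m, _⟩ + cls ρ 1 ⟨single _ m, _⟩ - cls ρ 1 ⟨single _ m, _⟩ = 0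
  rw [← map_add, ← map_sub, cls_eq_zero]
  refine ⟨single ![g, h] m, ?_⟩
  rw [bd_single, hρ]
  show _ = single _ m + single _ m - single _ m
  rw [Fin.sum_univ_two]
  have h1 : (Fin.tail ![g, h]) = fun _ => h := by
    funext i; fin_cases i; rfl
  have h2 : Fin.contractNth (0 : Fin 2) (· * ·) ![g, h] = fun _ => g * h := by
    funext i; fin_cases i; rfl
  have h3 : Fin.contractNth (1 : Fin 2) (· * ·) ![g, h] = fun _ => g := by
    funext i; fin_cases i; rfl
  rw [h1, h2, h3]
  simp
  abel

lemma L1_ind {ρ : Representation k G M} (hρ : ∀ g m, ρ g m = m) {P : Hm ρ 1 → Prop}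
    (h0 : P 0) (ha : ∀ x y, P x → P y → P (x + y)) (hL : ∀ g m, P (L1 hρ g m)) (x) : P x := by
  obtain ⟨z, hz, rfl⟩ := cls_surj x
  revert hz
  suffices h : P (cls ρ 1 ⟨z, H1_cyc hρ z⟩) from fun _ => h
  induction z using Finsupp.induction_linear with
  | zero => convert h0; exact (map_zero (cls ρ 1))
  | add x y hx hy =>
    have := ha _ _ hx hy
    rw [← map_add] at this
    exact this
  | single g a =>
    have := hL (g 0) a
    have h1 : g = fun _ => g 0 := by
      funext i; rw [Subsingleton.elim i 0]
    rw [show (⟨single g a, _⟩ : cyc ρ 1) = ⟨single (fun _ => g 0) a, H1_cyc hρ _⟩ from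
      Subtype.ext (by rw [← h1])]
    exact this

lemma L1_ker {ρ : Representation k G M} (hρ : ∀ g m, ρ g m = m) {W : Type} [AddCommGroup W]
    [Module k W] (f : Hm ρ 1 →ₗ[k] W) (h : ∀ g m, f (L1 hρ g m) = 0) (x) : f x = 0 :=
  L1_ind hρ (P := fun x => f x = 0) (map_zero f)
    (fun x y hx hy => by rw [map_add, hx, hy, add_zero]) h x

lemma L1_map {ρ : Representation k G M} (hρ : ∀ g m, ρ g m = m) {ρ' : Representation k G' M'}
    (hρ' : ∀ g m, ρ' g m = m) {f : G →* G'} {φ : M →ₗ[k] M'} (h : Compat ρ ρ' f φ) (g : G)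
    (m : M) : Hmap f φ h 1 (L1 hρ g m) = L1 hρ' (f g) (φ m) := by
  exact congrArg (cls ρ' 1) (Subtype.ext (cmap_single f φ 1 (fun _ => g) m))

lemma L1_one {ρ : Representation k G M} (hρ : ∀ g m, ρ g m = m) (m : M) : L1 hρ 1 m = 0 := by
  have := L1_mul hρ 1 1 m
  rw [mul_one] at this
  simpa using this

lemma L1_sum {ρ : Representation k G M} (hρ : ∀ g m, ρ g m = m) {V : Type} [AddCommGroup V]
    (f : V → G) (hf : ∀ a b, f (a + b) = f a * f b) {ι : Type} (s : Finset ι) (v : ι → V) (m : M) :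
    ∑ i ∈ s, L1 hρ (f (v i)) m = L1 hρ (f (∑ i ∈ s, v i)) m := by
  classical
  have f0 : f 0 = 1 := by
    have := hf 0 0
    rw [add_zero] at this
    exact left_eq_mul.1 this
  induction s using Finset.induction_on with
  | empty => simp [f0, L1_one]
  | insert a s ha ih => rw [Finset.sum_insert ha, Finset.sum_insert ha, ih, hf, L1_mul]

end H1

section Deg

variable (k : Type) [Field k] (F : Type) [Field F] [Fintype F]
variable {ι : Type} [Fintype ι] [DecidableEq ι]

/-- the idempotents -/
noncomputable def eS (s : ι) (c : ℕ) : MonoidAlgebra k (ι → F) :=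
  if c = 0 then 1 else if c = 1 then 1 - MonoidAlgebra.of k _ (Pi.mulSingle s 0)
  else - ∑ t : F, MonoidAlgebra.of k _ (Pi.mulSingle s t)

lemma eS_zero (s : ι) : eS k F s 0 = 1 := rfl
lemma eS_one (s : ι) : eS k F s 1 = 1 - MonoidAlgebra.of k _ (Pi.mulSingle s 0) := rfl
lemma eS_two (s : ι) : eS k F s 2 = - ∑ t : F, MonoidAlgebra.of k _ (Pi.mulSingle s t) := rfl

/-- product idempotents -/
noncomputable def eW (w : ι → Fin 3) : MonoidAlgebra k (ι → F) := ∏ s, eS k F s (w s)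

variable {k F}

lemma of_mulSingle_mul (s : ι) (t t' : F) :
    MonoidAlgebra.of k (ι → F) (Pi.mulSingle s t) * MonoidAlgebra.of k _ (Pi.mulSingle s t')
      = MonoidAlgebra.of k _ (Pi.mulSingle s (t * t')) := by
  rw [← map_mul, ← Pi.mulSingle_mul]

lemma eS_idem (hq : (Fintype.card F : k) = 0) (s : ι) (c : Fin 3) :
    eS k F s c * eS k F s c = eS k F s c := by
  classical
  fin_cases c
  · show (1 : MonoidAlgebra k (ι → F)) * 1 = 1
    rw [one_mul]
  · show eS k F s 1 * eS k F s 1 = eS k F s 1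
    rw [eS_one, mul_sub, sub_mul, sub_mul, of_mulSingle_mul]
    simp
  · show eS k F s 2 * eS k F s 2 = eS k F s 2
    rw [eS_two, neg_mul_neg, Finset.sum_mul]
    have h0 : ∀ f : F → MonoidAlgebra k (ι → F), ∑ t : F, f t = f 0 + ∑ t : Fˣ, f t := by
      intro f
      rw [← Finset.add_sum_erase _ _ (Finset.mem_univ (0 : F))]
      congr 1
      have := Fintype.sum_equiv (unitsEquivNeZero (G₀ := F)) (fun t => f t) (fun t => f t.1) (fun _ => rfl)
      rw [this]
      rw [← Finset.sum_subtype (Finset.univ.erase (0 : F)) (by simp) f]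
    rw [h0]
    simp only [Finset.mul_sum, of_mulSingle_mul, zero_mul, Finset.sum_const, Finset.card_univ]
    have h1 : ∀ t : Fˣ, ∑ x : F, MonoidAlgebra.of k (ι → F) (Pi.mulSingle s ((t : F) * x))
        = ∑ x : F, MonoidAlgebra.of k (ι → F) (Pi.mulSingle s x) := by
      intro t
      exact Fintype.sum_equiv (Units.mulLeft t) _ _ (fun x => rfl)
    simp only [h1, Finset.sum_const, Finset.card_univ, Fintype.card_units]
    rw [← Nat.cast_smul_eq_nsmul k, hq, zero_smul, zero_add, ← Nat.cast_smul_eq_nsmul k,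
      Nat.cast_sub Fintype.card_pos, hq]
    simp

lemma eW_idem (hq : (Fintype.card F : k) = 0) (w : ι → Fin 3) :
    eW k F w * eW k F w = eW k F w := by
  unfold eW
  rw [← Finset.prod_mul_distrib]
  exact Finset.prod_congr rfl fun s _ => eS_idem hq s _

lemma eW_split (w : ι → Fin 3) (s : ι) :
    eW k F w = eS k F s (w s) * eW k F (Function.update w s 0) := by
  unfold eW
  rw [← Finset.mul_prod_erase _ _ (Finset.mem_univ s)]
  congr 1
  rw [← Finset.mul_prod_erase Finset.univ (fun x => eS k F x (Function.update w s 0 x))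
    (Finset.mem_univ s)]
  simp only [Function.update_self]
  rw [show eS k F s ((0 : Fin 3) : ℕ) = 1 from rfl, one_mul]
  refine Finset.prod_congr rfl fun x hx => ?_
  rw [Function.update_of_ne (Finset.ne_of_mem_erase hx)]

/-- weight -/
def wt (w : ι → Fin 3) : ℕ := ∑ s, (w s : ℕ)

lemma wt_update (w : ι → Fin 3) (s : ι) (c : Fin 3) :
    wt (Function.update w s c) + (w s : ℕ) = wt w + c := by
  unfold wt
  rw [← Finset.add_sum_erase _ _ (Finset.mem_univ s),
    ← Finset.add_sum_erase Finset.univ (fun s => (w s : ℕ)) (Finset.mem_univ s)]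
  simp only [Function.update_self]
  have : ∑ x ∈ Finset.univ.erase s, (Function.update w s c x : ℕ)
      = ∑ x ∈ Finset.univ.erase s, (w x : ℕ) := by
    refine Finset.sum_congr rfl fun x hx => ?_
    rw [Function.update_of_ne (Finset.ne_of_mem_erase hx)]
  rw [this]
  omega

variable {M : Type} [AddCommGroup M] [Module k M] {M' : Type} [AddCommGroup M'] [Module k M']
variable {M'' : Type} [AddCommGroup M''] [Module k M'']

/-- degree less than d -/
def DegLt (τ : Representation k (ι → F) M) (d : ℕ) : Prop :=
  ∀ w : ι → Fin 3, d ≤ wt w → Kills τ (eW k F w)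

lemma DegLt.mono {τ : Representation k (ι → F) M} {d d' : ℕ} (h : DegLt τ d) (hd : d ≤ d') :
    DegLt τ d' := fun w hw => h w (hd.trans hw)

lemma DegLt.of_inj {τ : Representation k (ι → F) M} {τ' : Representation k (ι → F) M'}
    (f : M →ₗ[k] M') (h : ∀ q v, f (τ q v) = τ' q (f v)) (hf : Function.Injective f) {d : ℕ}
    (H : DegLt τ' d) : DegLt τ d := fun w hw => (H w hw).of_inj f h hf

lemma DegLt.of_surj {τ : Representation k (ι → F) M} {τ' : Representation k (ι → F) M'}
    (f : M →ₗ[k] M') (h : ∀ q v, f (τ q v) = τ' q (f v)) (hf : Function.Surjective f) {d : ℕ}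
    (H : DegLt τ d) : DegLt τ' d := fun w hw => (H w hw).of_surj f h hf

lemma DegLt.ext (hq : (Fintype.card F : k) = 0)
    {τ : Representation k (ι → F) M} {τ' : Representation k (ι → F) M'}
    {τ'' : Representation k (ι → F) M''}
    (f : M →ₗ[k] M') (hf : ∀ q v, f (τ q v) = τ' q (f v))
    (g : M' →ₗ[k] M'') (hg : ∀ q v, g (τ' q v) = τ'' q (g v))
    (ex : ∀ v, g v = 0 → ∃ u, f u = v) {d : ℕ}
    (H : DegLt τ d) (H'' : DegLt τ'' d) : DegLt τ' d := by
  intro w hw v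
  obtain ⟨u, hu⟩ := ex (τ'.asAlgebraHom (eW k F w) v) (by rw [asAlg_comm g hg, H'' w hw])
  rw [← asAlg_idem _ (eW_idem hq w), ← hu, ← asAlg_comm f hf, H w hw, map_zero]

lemma Kills.mul_left {𝓜 : Type} [Monoid 𝓜] {τ : Representation k 𝓜 M} {a : MonoidAlgebra k 𝓜}
    (b : MonoidAlgebra k 𝓜)
    (h : Kills τ a) : Kills τ (b * a) := by
  intro v
  rw [map_mul, Module.End.mul_apply, h, map_zero]

lemma asAlg_of {𝓜 : Type} [Monoid 𝓜] (τ : Representation k 𝓜 M) (q : 𝓜) (v : M) :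
    τ.asAlgebraHom (MonoidAlgebra.of k _ q) v = τ q v := by
  rw [Representation.asAlgebraHom_of]

lemma DegLt.triv (hq : (Fintype.card F : k) = 0) (τ : Representation k (ι → F) M)
    (h : ∀ q v, τ q v = v) : DegLt τ 1 := by
  intro w hw
  obtain ⟨s, hs⟩ : ∃ s, w s ≠ 0 := by
    by_contra! hc
    have : wt w = 0 := Finset.sum_eq_zero fun s _ => by simp [hc s]
    omega
  rw [eW_split w s, mul_comm]
  apply Kills.mul_left
  have : w s = 1 ∨ w s = 2 := by
    generalize w s = c at hs
    fin_cases c <;> simp at hs ⊢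
  intro v
  rcases this with h1 | h1 <;> rw [h1]
  · show τ.asAlgebraHom (eS k F s 1) v = 0
    rw [eS_one, map_sub, map_one, LinearMap.sub_apply, asAlg_of, h]
    simp
  · show τ.asAlgebraHom (eS k F s 2) v = 0
    rw [eS_two, map_neg, map_sum, LinearMap.neg_apply, LinearMap.sum_apply]
    simp only [asAlg_of, h]
    rw [Finset.sum_const, Finset.card_univ, ← Nat.cast_smul_eq_nsmul k, hq, zero_smul, neg_zero]

end Deg

end SpH


namespace SpH

set_option linter.unusedSectionVars false
set_option linter.unusedSimpArgs false

open Finsupp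

section Through
variable {k : Type} [Field k]
variable {G : Type} [Group G] {M : Type} [AddCommGroup M] [Module k M]
variable {𝓜 : Type} [CommMonoid 𝓜] {θ : Act 𝓜 G} (X : EqRep k θ M)

/-- operators that act through the coefficients -/
def Through (b : ℕ) (ε : MonoidAlgebra k 𝓜) : Prop :=
  ∃ h : Compat X.ρ X.ρ (MonoidHom.id G) (X.τ.asAlgebraHom ε),
    ∀ x, (X.op b).asAlgebraHom ε x = Hmap (MonoidHom.id G) _ h b x

variable {X}

lemma Through.of {b : ℕ} {q : 𝓜} (hq : θ q = MonoidHom.id G) :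
    Through X b (MonoidAlgebra.of k _ q) := by
  refine ⟨fun g m => ?_, fun x => ?_⟩
  · rw [asAlg_of, asAlg_of, X.comm, hq]
  · rw [asAlg_of, EqRep.op_apply]
    exact Hmap_congr _ _ hq (by rw [Representation.asAlgebraHom_of]) _ _

lemma Through.one {b : ℕ} : Through X b (1 : MonoidAlgebra k 𝓜) := by
  have := Through.of (X := X) (b := b) (q := 1) θ.one
  rwa [map_one] at this

lemma Through.mul {b : ℕ} {ε ε' : MonoidAlgebra k 𝓜} (h : Through X b ε) (h' : Through X b ε') :
    Through X b (ε * ε') := by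
  obtain ⟨h1, h2⟩ := h
  obtain ⟨h1', h2'⟩ := h'
  refine ⟨fun g m => ?_, fun x => ?_⟩
  · rw [map_mul, Module.End.mul_apply, Module.End.mul_apply, h1', h1]; rfl
  · rw [map_mul, Module.End.mul_apply, h2', h2, Hmap_comp]
    exact Hmap_congr _ _ rfl (by rw [map_mul]; rfl) _ _

lemma Through.add {b : ℕ} {ε ε' : MonoidAlgebra k 𝓜} (h : Through X b ε) (h' : Through X b ε') :
    Through X b (ε + ε') := by
  obtain ⟨h1, h2⟩ := h
  obtain ⟨h1', h2'⟩ := h'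
  have hc : Compat X.ρ X.ρ (MonoidHom.id G) (X.τ.asAlgebraHom (ε + ε')) := fun g m => by
    rw [map_add, LinearMap.add_apply, LinearMap.add_apply, h1', h1, map_add]
  refine ⟨hc, fun x => ?_⟩
  rw [map_add, LinearMap.add_apply, h2', h2, Hmap_add_φ h1 h1' hc (map_add _ _ _)]

lemma Through.neg {b : ℕ} {ε : MonoidAlgebra k 𝓜} (h : Through X b ε) :
    Through X b (-ε) := by
  obtain ⟨h1, h2⟩ := h
  have hc : Compat X.ρ X.ρ (MonoidHom.id G) (X.τ.asAlgebraHom (-ε)) := fun g m => by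
    rw [map_neg, LinearMap.neg_apply, LinearMap.neg_apply, h1, map_neg]
  refine ⟨hc, fun x => ?_⟩
  rw [map_neg, LinearMap.neg_apply, h2, Hmap_smul_φ h1 (-1) hc (by rw [map_neg]; simp)]
  simp

lemma Through.sum {b : ℕ} {J : Type} (s : Finset J) {ε : J → MonoidAlgebra k 𝓜}
    (h : ∀ j ∈ s, Through X b (ε j)) : Through X b (∑ j ∈ s, ε j) := by
  refine Finset.sum_induction ε (Through X b) (fun _ _ => Through.add) ?_ h
  have := (Through.one (X := X) (b := b)).add Through.one.neg
  rwa [add_neg_cancel] at this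

lemma Through.prod {b : ℕ} {J : Type} (s : Finset J) {ε : J → MonoidAlgebra k 𝓜}
    (h : ∀ j ∈ s, Through X b (ε j)) : Through X b (∏ j ∈ s, ε j) :=
  Finset.prod_induction ε (Through X b) (fun _ _ => Through.mul) Through.one h

lemma Through.kills {b : ℕ} {ε : MonoidAlgebra k 𝓜} (h : Through X b ε)
    (hk : Kills X.τ ε) : Kills (X.op b) ε := by
  obtain ⟨h1, h2⟩ := h
  intro x
  rw [h2]
  exact Hmap_zero_φ _ (LinearMap.ext hk) _ _

/-- image of an operator -/
noncomputable def EqRep.img (X : EqRep k θ M) (ε : MonoidAlgebra k 𝓜)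
    (h : Compat X.ρ X.ρ (MonoidHom.id G) (X.τ.asAlgebraHom ε)) :
    EqRep k θ (LinearMap.range (X.τ.asAlgebraHom ε)) :=
  X.sub _ (by
    rintro g _ ⟨u, rfl⟩
    exact ⟨X.ρ g u, h g u⟩) (by
    rintro q _ ⟨u, rfl⟩
    refine ⟨X.τ q u, ?_⟩
    rw [← asAlg_of X.τ q, ← asAlg_of X.τ q, ← Module.End.mul_apply, ← Module.End.mul_apply,
      ← map_mul, ← map_mul, mul_comm])

lemma Through.kills_mul {b : ℕ} {ε η : MonoidAlgebra k 𝓜} (h : Through X b ε)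
    (hk : Kills ((X.img ε h.1).op b) η) : Kills (X.op b) (η * ε) := by
  obtain ⟨h1, h2⟩ := h
  intro x
  let φ : M →ₗ[k] LinearMap.range (X.τ.asAlgebraHom ε) := (X.τ.asAlgebraHom ε).rangeRestrict
  have hφ : Compat X.ρ (X.img ε h1).ρ (MonoidHom.id G) φ := fun g m => Subtype.ext (h1 g m)
  have hi : Compat (X.img ε h1).ρ X.ρ (MonoidHom.id G) (Submodule.subtype _) := fun g m => rfl
  have e1 : Hmap _ _ h1 b x = Hmap _ _ hi b (Hmap _ _ hφ b x) := by
    rw [Hmap_comp]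
    exact Hmap_congr _ _ rfl rfl _ _
  rw [map_mul, Module.End.mul_apply, h2, e1,
    ← asAlg_comm (Hmap _ _ hi b) (fun q x => (X.img ε h1).op_map X _ hi (fun _ _ => rfl) b q x),
    hk, map_zero]

lemma Kills.img {ε η : MonoidAlgebra k 𝓜}
    (h : Compat X.ρ X.ρ (MonoidHom.id G) (X.τ.asAlgebraHom ε))
    (hk : Kills X.τ (η * ε)) : Kills (X.img ε h).τ η := by
  rintro ⟨_, u, rfl⟩
  apply Subtype.ext
  have := asAlg_comm (τ := (X.img ε h).τ) (τ' := X.τ) (Submodule.subtype _)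
    (fun q v => rfl) η ⟨_, u, rfl⟩
  refine Eq.trans this ?_
  show X.τ.asAlgebraHom η (X.τ.asAlgebraHom ε u) = 0
  rw [← Module.End.mul_apply, ← map_mul, hk]

end Through

section SE

variable {k : Type} [Field k] {F : Type} [Field F] [Fintype F]
variable {ι : Type} [Fintype ι] [DecidableEq ι]
variable {V : Type} [AddCommGroup V] [Module F V]
variable {M : Type} [AddCommGroup M] [Module k M]

/-- scalar action through a character -/
def scal (V : Type) [AddCommGroup V] [Module F V] (χ : (ι → F) →* F) :
    Act (ι → F) (Multiplicative V) where
  hom t := AddMonoidHom.toMultiplicative (DistribSMul.toAddMonoidHom V (χ t))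
  one := by ext x; simp
  mul a b := by
    ext x
    exact congrArg Multiplicative.ofAdd ((congrArg (· • x) (map_mul χ a b)).trans
      (mul_smul _ _ _))

lemma scal_apply (χ : (ι → F) →* F) (t) (v : V) :
    scal V χ t (Multiplicative.ofAdd v) = Multiplicative.ofAdd (χ t • v) := rfl

lemma through_eW {G : Type} [Group G] {θ : Act (ι → F) G} {X : EqRep k θ M} {b : ℕ}
    {w : ι → Fin 3} (h : ∀ s t, w s ≠ 0 → θ (Pi.mulSingle s t) = MonoidHom.id G) :
    Through X b (eW k F w) := by
  refine Through.prod _ fun s _ => ?_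
  by_cases hs : w s = 0
  · rw [hs]; exact Through.one
  · have := h s
    have h2 : w s = 1 ∨ w s = 2 := by
      generalize w s = c at hs
      fin_cases c <;> simp at hs ⊢
    rcases h2 with h1 | h1 <;> rw [h1]
    · show Through X b (eS k F s 1)
      rw [eS_one, sub_eq_add_neg]
      exact Through.one.add (Through.of (h s 0 hs)).neg
    · show Through X b (eS k F s 2)
      rw [eS_two]
      exact (Through.sum _ fun t _ => Through.of (h s t hs)).neg

lemma DegLt.op_zero {G : Type} [Group G] {θ : Act (ι → F) G} {X : EqRep k θ M} {d : ℕ}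
    (h : DegLt X.τ d) : DegLt (X.op 0) d :=
  h.of_surj (toH0 X.ρ) (fun q v => (Hmap_toH0 _ _ (X.compat q) v).symm) (toH0_surj _)

lemma sum_F_zero (hq2 : Fintype.card F ≠ 2) : ∑ t : F, t = 0 := by
  have h1 := Fintype.one_lt_card (α := F)
  have := FiniteField.sum_pow_lt_card_sub_one F 1 (by omega)
  simpa using this

lemma alpha_L {χ : (ι → F) →* F} (hq2 : Fintype.card F ≠ 2)
    (X : EqRep k (scal V χ) M) (hρ : ∀ g m, X.ρ g m = m) (s : ι)
    (hχ : ∀ t, χ (Pi.mulSingle s t) = t) (g) (m : M) (hm : X.τ (Pi.mulSingle s 0) m = m) :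
    (X.op 1).asAlgebraHom (eS k F s 2) (L1 hρ g m) = 0 := by
  have ht : ∀ t, X.τ (Pi.mulSingle s t) m = m := by
    intro t
    rw [← hm, ← Module.End.mul_apply, ← map_mul, ← Pi.mulSingle_mul, mul_zero]
  rw [eS_two, map_neg, map_sum, LinearMap.neg_apply, LinearMap.sum_apply, neg_eq_zero]
  simp only [asAlg_of, EqRep.op_apply, L1_map hρ hρ, ht]
  have := L1_sum hρ (fun v : V => Multiplicative.ofAdd v) (fun _ _ => rfl) Finset.univ
    (fun t : F => t • g.toAdd) m
  have h2 : ∀ t, scal V χ (Pi.mulSingle s t) g = Multiplicative.ofAdd (t • g.toAdd) := by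
    intro t
    have := scal_apply (V := V) χ (Pi.mulSingle s t) g.toAdd
    rw [hχ] at this
    exact this
  simp only [h2]
  rw [this, ← Finset.sum_smul, sum_F_zero hq2, zero_smul]
  exact L1_one hρ m

/-- uniform degree bound -/
def DegBound (k : Type) [Field k] {F : Type} [Field F] [Fintype F]
    {ι : Type} [Fintype ι] [DecidableEq ι] {G : Type} [Group G] (θ : Act (ι → F) G) (c : ℕ) :
    Prop :=
  ∀ (M : Type) [AddCommGroup M] [Module k M] (X : EqRep k θ M) (d : ℕ), DegLt X.τ d →
    ∀ j, DegLt (X.op j) (d + c * j)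

lemma scal_zero {χ : (ι → F) →* F} {q} (h : χ q = 0) (g) : scal V χ q g = 1 := by
  have := scal_apply (V := V) χ q g.toAdd
  rw [h, zero_smul] at this
  exact this

lemma scal_one {χ : (ι → F) →* F} {q} (h : χ q = 1) : scal V χ q = MonoidHom.id _ := by
  ext g
  have := scal_apply (V := V) χ q g
  rw [h, one_smul] at this
  exact this

lemma SE_triv {χ : (ι → F) →* F} (X : EqRep k (scal V χ) M) (s l : ι)
    (h0 : χ (Pi.mulSingle s 0) = 0) (h0' : χ (Pi.mulSingle l 0) = 0)
    (h : Kills X.τ (eS k F s 1 * eS k F l 1)) :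
    (∀ v, v = X.τ (Pi.mulSingle s 0) v + X.τ (Pi.mulSingle l 0) v
      - X.τ (Pi.mulSingle s 0) (X.τ (Pi.mulSingle l 0) v)) ∧
    ∀ g m, X.ρ g m = m := by
  have h1 : ∀ v, v = X.τ (Pi.mulSingle s 0) v + X.τ (Pi.mulSingle l 0) v
      - X.τ (Pi.mulSingle s 0) (X.τ (Pi.mulSingle l 0) v) := by
    intro v
    have := h v
    rw [eS_one, eS_one, map_mul, Module.End.mul_apply, map_sub, map_sub, map_one,
      LinearMap.sub_apply, LinearMap.sub_apply, asAlg_of, asAlg_of] at this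
    simp only [Module.End.one_apply, map_sub] at this
    rw [← sub_eq_zero, ← this]
    abel
  refine ⟨h1, fun g m => ?_⟩
  rw [h1 (X.ρ g m), X.comm, X.comm, scal_zero h0, scal_zero h0']
  simp only [map_one, Module.End.one_apply]
  exact (h1 m).symm

/-- SE -/
theorem SE (hq2 : Fintype.card F ≠ 2) (s : ι)
    {χ : (ι → F) →* F} (hχ : ∀ t, χ (Pi.mulSingle s t) = t)
    (hχ' : ∀ l t, l ≠ s → χ (Pi.mulSingle l t) = 1) :
    DegBound k (scal V χ) 1 := by
  intro M _ _ X d hd b w hw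
  rcases Nat.eq_zero_or_pos b with rfl | hb
  · exact hd.op_zero w (by omega)
  set w0 := Function.update w s 0 with hw0
  have hwt := wt_update w s 0
  rw [← hw0] at hwt
  have hT : Through X b (eW k F w0) := by
    apply through_eW
    intro l t hl
    apply scal_one
    apply hχ'
    rintro rfl
    simp [hw0] at hl
  rw [eW_split w s, ← hw0]
  by_cases hc : d ≤ wt w0
  · exact (hT.kills (hd w0 hc)).mul_left _
  · have hs := (w s).2
    simp only [Fin.val_zero] at hwt
    have hs2 : (w s : ℕ) = 2 := by omega
    have hb1 : b = 1 := by omega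
    subst hb1
    rw [hs2]
    apply hT.kills_mul
    have hk : Kills (X.img _ hT.1).τ (eS k F s 1) := by
      apply Kills.img
      have := hd (Function.update w s 1) (by
        have := wt_update w s 1
        simp only [Fin.val_one] at this
        omega)
      rw [eW_split _ s] at this
      simpa [hw0] using this
    have hk' : Kills (X.img _ hT.1).τ (eS k F s 1 * eS k F s 1) := hk.mul_left _
    have h0 : χ (Pi.mulSingle s 0) = 0 := hχ 0
    obtain ⟨h1, h2⟩ := SE_triv (X.img _ hT.1) s s h0 h0 hk'
    intro x
    refine L1_ker h2 (((X.img _ hT.1).op 1).asAlgebraHom _) ?_ x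
    intro g m
    apply alpha_L hq2 _ h2 s hχ
    have := hk m
    rw [eS_one, map_sub, LinearMap.sub_apply, asAlg_of, map_one] at this
    exact (sub_eq_zero.1 this).symm

/-- SE2, diagonal case -/
theorem SE2_diag (s : ι)
    {χ : (ι → F) →* F}
    (hχ' : ∀ l t, l ≠ s → χ (Pi.mulSingle l t) = 1) :
    DegBound k (scal V χ) 2 := by
  intro M _ _ X d hd b w hw
  rcases Nat.eq_zero_or_pos b with rfl | hb
  · exact hd.op_zero w (by omega)
  set w0 := Function.update w s 0 with hw0
  have hwt := wt_update w s 0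
  rw [← hw0] at hwt
  have hT : Through X b (eW k F w0) := by
    apply through_eW
    intro l t hl
    apply scal_one
    apply hχ'
    rintro rfl
    simp [hw0] at hl
  rw [eW_split w s, ← hw0]
  have hs := (w s).2
  simp only [Fin.val_zero] at hwt
  exact (hT.kills (hd w0 (by omega))).mul_left _

/-- SE2, off-diagonal case -/
theorem SE2 (hq2 : Fintype.card F ≠ 2) (s l : ι) (hsl : s ≠ l)
    {χ : (ι → F) →* F} (hχ : ∀ t, χ (Pi.mulSingle s t) = t) (hχl : ∀ t, χ (Pi.mulSingle l t) = t)
    (hχ' : ∀ r t, r ≠ s → r ≠ l → χ (Pi.mulSingle r t) = 1) :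
    DegBound k (scal V χ) 2 := by
  intro M _ _ X d hd b w hw
  rcases Nat.eq_zero_or_pos b with rfl | hb
  · exact hd.op_zero w (by omega)
  set w1 := Function.update w s 0 with hw1
  set w0 := Function.update w1 l 0 with hw0
  have hT : Through X b (eW k F w0) := by
    apply through_eW
    intro r t hr
    apply scal_one
    apply hχ'
    · rintro rfl
      apply hr
      simp [hw0, hw1, Function.update_of_ne hsl]
    · rintro rfl
      simp [hw0] at hr
  have hl1 : w1 l = w l := by rw [hw1, Function.update_of_ne hsl.symm]
  have hwt := wt_update w s 0
  rw [← hw1] at hwt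
  have hwt1 := wt_update w1 l 0
  rw [← hw0, hl1] at hwt1
  have key : ∀ a c : Fin 3, d ≤ wt w0 + a + c → Kills X.τ (eS k F s a * (eS k F l c * eW k F w0)) := by
    intro a c hac
    let w2 := Function.update w1 l c
    let w3 := Function.update w2 s a
    have e2 := wt_update w1 l c
    have e3 := wt_update w2 s a
    have e4 : w2 s = 0 := by simp [w2, hw1, Function.update_of_ne hsl]
    rw [e4] at e3
    have e5 : d ≤ wt w3 := by
      simp only [w3, w2, Fin.val_zero] at e3 e2 ⊢
      rw [hl1] at e2
      simp only [Fin.val_zero] at hwt1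
      omega
    have h6 : Function.update w3 s 0 = w2 := by
      simp only [w3, Function.update_idem]
      rw [← e4, Function.update_eq_self]
    have h7 : Function.update w2 l 0 = w0 := by
      simp only [w2, Function.update_idem, hw0]
    have := hd w3 e5
    rw [eW_split w3 s, h6, eW_split w2 l, h7] at this
    simpa [w3, w2] using this
  rw [eW_split w s, ← hw1, eW_split w1 l, ← hw0, hl1]
  simp only [Fin.val_zero] at hwt hwt1
  have hs := (w s).2
  have hl := (w l).2
  by_cases hc : d ≤ wt w0
  · exact ((hT.kills (hd w0 hc)).mul_left _).mul_left _
  · have hb1 : b = 1 := by omega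
    subst hb1
    rw [← mul_assoc]
    apply hT.kills_mul
    have hk : Kills (X.img _ hT.1).τ (eS k F s 1 * eS k F l 1) := by
      apply Kills.img
      rw [mul_assoc]
      exact key 1 1 (by simp only [Fin.val_one]; omega)
    have h0 : χ (Pi.mulSingle s 0) = 0 := hχ 0
    have h0l : χ (Pi.mulSingle l 0) = 0 := hχl 0
    obtain ⟨h1, h2⟩ := SE_triv (X.img _ hT.1) s l h0 h0l hk
    have fix : ∀ r, Kills (X.img _ hT.1).τ (eS k F r 1) →
        ∀ m, (X.img _ hT.1).τ (Pi.mulSingle r 0) m = m := by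
      intro r hr m
      have := hr m
      rw [eS_one, map_sub, LinearMap.sub_apply, asAlg_of, map_one] at this
      exact (sub_eq_zero.1 this).symm
    intro x
    refine L1_ker h2 (((X.img _ hT.1).op 1).asAlgebraHom _) ?_ x
    intro g m
    have hcase : ((w s : ℕ) = 2 ∧ (w l : ℕ) = 1) ∨ ((w s : ℕ) = 1 ∧ (w l : ℕ) = 2) ∨
      ((w s : ℕ) = 2 ∧ (w l : ℕ) = 2) := by omega
    rcases hcase with ⟨h3, h4⟩ | ⟨h3, h4⟩ | ⟨h3, h4⟩
    · rw [h3, h4, mul_comm, map_mul, Module.End.mul_apply, alpha_L hq2 _ h2 s hχ, map_zero]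
      apply fix
      apply Kills.img
      have := key 1 0 (by simp only [Fin.val_one, Fin.val_zero]; omega)
      rwa [show eS k F l ((0 : Fin 3) : ℕ) = 1 from rfl, one_mul] at this
    · rw [h3, h4, map_mul, Module.End.mul_apply, alpha_L hq2 _ h2 l hχl, map_zero]
      apply fix
      apply Kills.img
      have := key 0 1 (by simp only [Fin.val_one, Fin.val_zero]; omega)
      rwa [show eS k F s ((0 : Fin 3) : ℕ) = 1 from rfl, one_mul] at this
    · rw [h3, h4]
      have A : ∀ u, (X.img _ hT.1).τ (Pi.mulSingle s 0) u = u → ((X.img _ hT.1).op 1).asAlgebraHom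
          (eS k F s 2 * eS k F l 2) (L1 h2 g u) = 0 := by
        intro u hu
        rw [mul_comm, map_mul, Module.End.mul_apply, alpha_L hq2 _ h2 s hχ _ _ hu, map_zero]
      have B : ∀ u, (X.img _ hT.1).τ (Pi.mulSingle l 0) u = u → ((X.img _ hT.1).op 1).asAlgebraHom
          (eS k F s 2 * eS k F l 2) (L1 h2 g u) = 0 := by
        intro u hu
        rw [map_mul, Module.End.mul_apply, alpha_L hq2 _ h2 l hχl _ _ hu, map_zero]
      have C : ∀ r u, (X.img _ hT.1).τ (Pi.mulSingle r 0) ((X.img _ hT.1).τ (Pi.mulSingle r 0) u)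
          = (X.img _ hT.1).τ (Pi.mulSingle r 0) u := by
        intro r u
        rw [← Module.End.mul_apply, ← map_mul, ← Pi.mulSingle_mul, mul_zero]
      rw [h1 m, map_sub, map_add, map_sub, map_add, A _ (C _ _), B _ (C _ _), A _ (C _ _)]
      simp

end SE

end SpH


namespace SpH

set_option linter.unusedSectionVars false
set_option linter.unusedSimpArgs false

open Finsupp

section DB

variable {k : Type} [Field k] {F : Type} [Field F] [Fintype F]
variable {ι : Type} [Fintype ι] [DecidableEq ι]

theorem DegBound.split {G N₁ N₂ : Type} [Group G] [Group N₁] [Group N₂] [Fintype G] [Fintype N₁]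
    [Fintype N₂] {θ : Act (ι → F) G} {θ₁ : Act (ι → F) N₁} {θ₂ : Act (ι → F) N₂}
    (S : Split θ θ₁ θ₂) (hq : (Fintype.card F : k) = 0) {c : ℕ}
    (h₁ : DegBound k θ₁ c) (h₂ : DegBound k θ₂ c) : DegBound k θ c := by
  intro M _ _ X d hd j w hw
  apply S.kills (eW_idem hq w)
  intro a b hab
  refine h₂ _ (S.HN X b) (d + c * b) (h₁ _ (S.res X) d hd b) a w ?_
  rw [← hab, mul_add] at hw
  omega

theorem DegBound.subsingleton {G : Type} [Group G] [Fintype G] [Subsingleton G]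
    {θ : Act (ι → F) G} (c : ℕ) : DegBound k θ c := by
  intro M _ _ X d hd j
  rcases j with _ | j
  · exact hd.op_zero
  · intro w _ x
    refine (Higman.of_card X.ρ ?_).acyclic j _
    have : Fintype.card G = 1 := Fintype.card_eq_one_iff.2 ⟨1, fun y => Subsingleton.elim _ _⟩
    rw [this]; simp

/-- product splitting of additive groups -/
def addSplit {A B C : Type} [AddCommGroup A] [AddCommGroup B] [AddCommGroup C]
    {𝓜 : Type} [Monoid 𝓜]
    {θ : Act 𝓜 (Multiplicative C)} {θ₁ : Act 𝓜 (Multiplicative A)}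
    {θ₂ : Act 𝓜 (Multiplicative B)} (e : A × B ≃+ C)
    (h₁ : ∀ q a, θ q (Multiplicative.ofAdd (e (a, 0)))
      = Multiplicative.ofAdd (e ((θ₁ q (Multiplicative.ofAdd a)).toAdd, 0)))
    (h₂ : ∀ q a, θ q (Multiplicative.ofAdd (e (0, a)))
      = Multiplicative.ofAdd (e (0, (θ₂ q (Multiplicative.ofAdd a)).toAdd))) :
    Split θ θ₁ θ₂ where
  i₁ := AddMonoidHom.toMultiplicative (e.toAddMonoidHom.comp (AddMonoidHom.inl A B))
  i₂ := AddMonoidHom.toMultiplicative (e.toAddMonoidHom.comp (AddMonoidHom.inr A B))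
  α := Act.triv _ _
  conj a b := mul_comm _ _
  bij := by
    have : (fun x : Multiplicative A × Multiplicative B =>
        AddMonoidHom.toMultiplicative (e.toAddMonoidHom.comp (AddMonoidHom.inl A B)) x.1 *
        AddMonoidHom.toMultiplicative (e.toAddMonoidHom.comp (AddMonoidHom.inr A B)) x.2) =
        fun x => Multiplicative.ofAdd (e (x.1.toAdd, x.2.toAdd)) := by
      funext x
      show Multiplicative.ofAdd (e (x.1.toAdd, 0) + e (0, x.2.toAdd)) = _
      rw [← map_add]; simp
    rw [this]
    exact e.bijective
  h₁ q a := h₁ q a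
  h₂ q a := h₂ q a

/-- coordinatewise scalar action -/
def piAct (V : Type) [AddCommGroup V] [Module F V] {I : Type} (χ : I → (ι → F) →* F) :
    Act (ι → F) (Multiplicative (I → V)) where
  hom t := AddMonoidHom.toMultiplicative
    { toFun := fun u i => χ i t • u i
      map_zero' := by ext; simp
      map_add' := fun a b => by ext; simp }
  one := by
    refine MonoidHom.ext fun x => congrArg Multiplicative.ofAdd (funext fun i => ?_)
    exact (congrArg (· • x.toAdd i) (map_one (χ i))).trans (one_smul _ _)
  mul a b := by
    refine MonoidHom.ext fun x => congrArg Multiplicative.ofAdd (funext fun i => ?_)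
    exact (congrArg (· • x.toAdd i) (map_mul (χ i) a b)).trans (mul_smul _ _ _)

lemma piAct_apply {V : Type} [AddCommGroup V] [Module F V] {I : Type} (χ : I → (ι → F) →* F)
    (t) (u : I → V) : piAct V χ t (Multiplicative.ofAdd u)
      = Multiplicative.ofAdd (fun i => χ i t • u i) := rfl

theorem DegBound.pi (hq : (Fintype.card F : k) = 0) (c : ℕ) (V : Type) [AddCommGroup V]
    [Module F V] [Fintype V] {I : Type} [Fintype I] [DecidableEq I] (χ : I → (ι → F) →* F)
    (h : ∀ i, DegBound k (scal V (χ i)) c) : DegBound k (piAct V χ) c := by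
  classical
  have key : ∀ (I : Type) [Fintype I], ∀ (χ : I → (ι → F) →* F)
      (h : ∀ i, DegBound k (scal V (χ i)) c), DegBound k (piAct V χ) c := by
    refine Fintype.induction_empty_option ?_ ?_ ?_
    · intro α β _ e ih χ h
      haveI : Fintype α := Fintype.ofEquiv β e.symm
      have ih' := ih (fun a => χ (e a)) (fun a => h _)
      let E : (α → V) × PUnit.{1} ≃+ (β → V) :=
        { toFun := fun x b => x.1 (e.symm b)
          invFun := fun y => (fun a => y (e a), 0)
          left_inv := fun x => by ext <;> simp
          right_inv := fun x => by ext; simp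
          map_add' := fun x y => by ext; simp }
      refine DegBound.split (θ₂ := Act.triv _ (Multiplicative PUnit.{1})) (addSplit E ?_ ?_) hq ih'
        (DegBound.subsingleton c)
      · intro q a
        rw [piAct_apply, piAct_apply]
        refine congrArg Multiplicative.ofAdd ?_
        funext b
        simp [E]
      · intro q a
        refine congrArg Multiplicative.ofAdd ?_
        funext b
        simp [E]
    · intro χ h
      exact DegBound.subsingleton c
    · intro α _ ih χ h
      have ih' := ih (fun a => χ (some a)) (fun a => h _)
      let E : V × (α → V) ≃+ (Option α → V) :=
        { toFun := fun x b => b.elim x.1 x.2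
          invFun := fun y => (y none, fun a => y (some a))
          left_inv := fun x => by ext <;> simp
          right_inv := fun x => by ext b; cases b <;> simp
          map_add' := fun x y => by ext b; cases b <;> simp }
      refine DegBound.split (addSplit E ?_ ?_) hq (h none) ih'
      · intro q a
        refine congrArg Multiplicative.ofAdd ?_
        funext b
        cases b
        · rfl
        · exact smul_zero _
      · intro q a
        refine congrArg Multiplicative.ofAdd ?_
        funext b
        cases b
        · exact smul_zero _
        · rfl
  exact key I χ h

/-- evaluation characters -/
theorem DegBound.std (hq : (Fintype.card F : k) = 0) (hq2 : Fintype.card F ≠ 2)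
    (V : Type) [AddCommGroup V]
    [Module F V] [Fintype V] : DegBound k (piAct V (fun i : ι => Pi.evalMonoidHom (fun _ => F) i)) 1 :=
  DegBound.pi hq 1 V _ fun i => SE hq2 i (fun t => by simp) (fun l t h => by
    simp [Pi.mulSingle_eq_of_ne h.symm])

/-- products of two coordinates -/
def symChar (x : Sym2 ι) : (ι → F) →* F where
  toFun t := Sym2.lift ⟨fun i j => t i * t j, fun i j => mul_comm _ _⟩ x
  map_one' := by induction x with | h i j => simp
  map_mul' a b := by induction x with | h i j => simp; ring

lemma symChar_mk (i j : ι) (t : ι → F) : symChar s(i, j) t = t i * t j := rfl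

theorem DegBound.sym (hq : (Fintype.card F : k) = 0) (hq2 : Fintype.card F ≠ 2) :
    DegBound k (piAct F (fun x : Sym2 ι => symChar (F := F) x)) 2 :=
  DegBound.pi hq 2 F _ fun x => by
    induction x with
    | h i j =>
      by_cases hij : i = j
      · subst hij
        refine SE2_diag i fun l t h => ?_
        simp [symChar_mk, Pi.mulSingle_eq_of_ne h.symm]
      · refine SE2 hq2 i j hij ?_ ?_ ?_
        · intro t; simp [symChar_mk, Pi.mulSingle_eq_of_ne (Ne.symm hij)]
        · intro t; simp [symChar_mk, Pi.mulSingle_eq_of_ne hij]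
        · intro r t h1 h2
          simp [symChar_mk, Pi.mulSingle_eq_of_ne h1.symm, Pi.mulSingle_eq_of_ne h2.symm]

end DB

end SpH


namespace SpH

set_option linter.unusedSectionVars false
set_option linter.unusedSimpArgs false

open Finsupp

section Semi

variable {G N : Type} [Group G] [Group N]

/-- action of a group by automorphisms -/
def Act.toMulAut (α : Act G N) : G →* MulAut N where
  toFun g :=
    { toFun := α g
      invFun := α g⁻¹
      left_inv := fun a => by
        have := congrArg (fun f => f a) (α.mul g⁻¹ g)
        simp [α.one] at this
        exact this.symm
      right_inv := fun a => by
        have := congrArg (fun f => f a) (α.mul g g⁻¹)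
        simp [α.one] at this
        exact this.symm
      map_mul' := fun a b => map_mul _ a b }
  map_one' := by ext a; exact congrArg (fun f => f a) α.one
  map_mul' a b := by ext x; exact congrArg (fun f => f x) (α.mul a b)

/-- semidirect product -/
abbrev Semi (α : Act G N) : Type := N ⋊[α.toMulAut] G

noncomputable instance (α : Act G N) [Fintype G] [Fintype N] : Fintype (Semi α) :=
  Fintype.ofEquiv _ SemidirectProduct.equivProd.symm

variable {𝓜 : Type} [Monoid 𝓜]

/-- operators on a semidirect product -/
def Act.semi (α : Act G N) (θ₁ : Act 𝓜 N) (θ₂ : Act 𝓜 G)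
    (h : ∀ q a b, θ₁ q (α b a) = α (θ₂ q b) (θ₁ q a)) : Act 𝓜 (Semi α) where
  hom q := SemidirectProduct.map (θ₁ q) (θ₂ q) (fun g => MonoidHom.ext fun a => h q a g)
  one := by
    ext x
    · exact congrArg (fun f => f x.left) θ₁.one
    · exact congrArg (fun f => f x.right) θ₂.one
  mul a b := by
    ext x
    · exact congrArg (fun f => f x.left) (θ₁.mul a b)
    · exact congrArg (fun f => f x.right) (θ₂.mul a b)

/-- the split extension of a semidirect product -/
def Split.semi (α : Act G N) (θ₁ : Act 𝓜 N) (θ₂ : Act 𝓜 G)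
    (h : ∀ q a b, θ₁ q (α b a) = α (θ₂ q b) (θ₁ q a)) :
    Split (Act.semi α θ₁ θ₂ h) θ₁ θ₂ where
  i₁ := SemidirectProduct.inl
  i₂ := SemidirectProduct.inr
  α := α
  conj a b := by
    have := SemidirectProduct.inl_aut (φ := α.toMulAut) b a
    rw [map_inv] at this
    exact (eq_mul_inv_iff_mul_eq.1 this).symm
  bij := by
    constructor
    · rintro ⟨a, b⟩ ⟨a', b'⟩ hab
      have h1 := congrArg SemidirectProduct.left hab
      have h2 := congrArg SemidirectProduct.right hab
      simp at h1 h2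
      rw [h1, h2]
    · intro x
      exact ⟨(x.left, x.right), SemidirectProduct.inl_left_mul_inr_right x⟩
  h₁ q a := SemidirectProduct.map_inl (φ₁ := α.toMulAut) (φ₂ := α.toMulAut) (θ₁ q) (θ₂ q) (fun g => MonoidHom.ext fun a => h q a g) a
  h₂ q a := SemidirectProduct.map_inr (φ₁ := α.toMulAut) (φ₂ := α.toMulAut) (θ₁ q) (θ₂ q) (fun g => MonoidHom.ext fun a => h q a g) a

/-- homomorphisms out of semidirect products -/
def semiLift {H : Type} [Group H] (α : Act G N) (f₁ : N →* H) (f₂ : G →* H)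
    (h : ∀ a b, f₂ b * f₁ a = f₁ (α b a) * f₂ b) : Semi α →* H :=
  SemidirectProduct.lift f₁ f₂ (fun g => MonoidHom.ext fun a => by
    show f₁ (α g a) = f₂ g * f₁ a * (f₂ g)⁻¹
    rw [h, mul_inv_cancel_right])

lemma semiLift_mk {H : Type} [Group H] (α : Act G N) (f₁ : N →* H) (f₂ : G →* H) (h) (x) :
    semiLift α f₁ f₂ h x = f₁ x.left * f₂ x.right := rfl

end Semi

section Tools

variable {k : Type} [Field k]
variable {G : Type} [Group G] {M : Type} [AddCommGroup M] [Module k M]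
variable {G' : Type} [Group G'] {M' : Type} [AddCommGroup M'] [Module k M']

lemma Hm_congr {ρ ρ' : Representation k G M} (h : ρ = ρ') {n : ℕ} (H : ∀ x : Hm ρ' n, x = 0)
    (x : Hm ρ n) : x = 0 := by
  subst h; exact H x

lemma Hmap_one {ρ : Representation k G M} {ρ' : Representation k G' M'} {f : G →* G'}
    {φ : M →ₗ[k] M'} (h : Compat ρ ρ' f φ) (hf : f = 1) (n : ℕ) (x : Hm ρ (n + 1)) :
    Hmap f φ h (n + 1) x = 0 := by
  subst hf
  have h1 : Compat ρ (1 : Representation k Unit M') (1 : G →* Unit) φ := by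
    intro g m
    have := h g m
    rw [MonoidHom.one_apply, map_one] at this
    exact this
  have h2 : Compat (1 : Representation k Unit M') ρ' (1 : Unit →* G') LinearMap.id := by
    intro g m
    show m = ρ' 1 m
    rw [map_one]; rfl
  have h3 : Hmap (1 : Unit →* G') LinearMap.id h2 (n + 1)
      (Hmap (1 : G →* Unit) φ h1 (n + 1) x) = Hmap 1 φ h (n + 1) x := by
    rw [Hmap_comp]
    exact Hmap_congr _ _ rfl rfl _ _
  have h4 : Higman (1 : Representation k Unit M') := Higman.of_card _ (by simp)
  rw [← h3, h4.acyclic n (Hmap (1 : G →* Unit) φ h1 (n + 1) x), map_zero]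

lemma Hmap_bij {ρ : Representation k G M} {ρ' : Representation k G' M'} (f : G ≃* G')
    (φ : M ≃ₗ[k] M') (h : Compat ρ ρ' f.toMonoidHom φ.toLinearMap) (n : ℕ) :
    Function.Bijective (Hmap f.toMonoidHom φ.toLinearMap h n) := by
  have h' : Compat ρ' ρ f.symm.toMonoidHom φ.symm.toLinearMap := by
    intro g m
    apply φ.injective
    have := h (f.symm g) (φ.symm m)
    simp at this ⊢
    rw [this]
  rw [Function.bijective_iff_has_inverse]
  refine ⟨Hmap f.symm.toMonoidHom φ.symm.toLinearMap h' n, fun x => ?_, fun x => ?_⟩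
  · rw [Hmap_comp]
    refine (Hmap_congr _ (Compat.id ρ) ?_ ?_ _ _).trans (Hmap_id _ _ _)
    · ext; simp
    · ext; simp
  · rw [Hmap_comp]
    refine (Hmap_congr _ (Compat.id ρ') ?_ ?_ _ _).trans (Hmap_id _ _ _)
    · ext; simp
    · ext; simp

/-- homology with trivial coefficients is detected on the field -/
lemma triv_vanish {n : ℕ} (h : ∀ x : Hm (1 : Representation k G k) n, x = 0)
    (ρ : Representation k G M) (hρ : ∀ g m, ρ g m = m) (x : Hm ρ n) : x = 0 := by
  classical
  let b := Module.Basis.ofVectorSpace k M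
  obtain ⟨z, hz, rfl⟩ := cls_surj x
  let φ := fun j => (LinearMap.toSpanSingleton k M (b j)) ∘ₗ (b.coord j)
  have h1 : ∀ j, Compat ρ (1 : Representation k G k) (MonoidHom.id G) (b.coord j) := by
    intro j g m; rw [hρ]; rfl
  have h2 : ∀ j, Compat (1 : Representation k G k) ρ (MonoidHom.id G)
      (LinearMap.toSpanSingleton k M (b j)) := by
    intro j g m; rw [hρ]; rfl
  have h3 : ∀ j, Compat ρ ρ (MonoidHom.id G) (φ j) := by
    intro j g m; rw [hρ, hρ]
  have h4 : ∀ j y, Hmap (MonoidHom.id G) (φ j) (h3 j) n y = 0 := by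
    intro j y
    have := Hmap_comp (h2 j) (h1 j) n y
    rw [h (Hmap (MonoidHom.id G) (b.coord j) (h1 j) n y), map_zero] at this
    exact this.symm
  let s : Finset _ := z.support.biUnion fun g => (b.repr (z g)).support
  have h5 : Compat ρ ρ (MonoidHom.id G) (∑ j ∈ s, φ j) := by
    intro g m; rw [hρ, hρ]
  have h6 := Hmap_sum_φ s h3 h5 rfl n (cls ρ n ⟨z, hz⟩)
  rw [Finset.sum_eq_zero (fun j _ => h4 j _), Hmap_cls] at h6
  rw [← h6]
  refine congrArg (cls ρ n) (Subtype.ext ?_)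
  show z = cmap (MonoidHom.id G) (∑ j ∈ s, φ j) n z
  conv_lhs => rw [← Finsupp.sum_single z]
  conv_rhs => rw [← Finsupp.sum_single z]
  rw [Finsupp.sum, map_sum]
  refine Finset.sum_congr rfl fun g hg => ?_
  rw [cmap_single]
  have h7 : (∑ j ∈ s, φ j) (z g) = z g := by
    rw [LinearMap.sum_apply]
    conv_rhs => rw [← b.linearCombination_repr (z g)]
    rw [Finsupp.linearCombination_apply, Finsupp.sum]
    symm
    apply Finset.sum_subset
    · intro j hj
      exact Finset.mem_biUnion.2 ⟨g, hg, hj⟩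
    · intro j _ hj
      rw [Finsupp.notMem_support_iff.1 hj, zero_smul]
  rw [h7]
  rfl

lemma toH0_avg [Fintype G] (ρ : Representation k G M) (hc : (Fintype.card G : k) ≠ 0) (m : M)
    (h : toH0 ρ (∑ g, ρ g m) = 0) : toH0 ρ m = 0 := by
  rw [map_sum] at h
  simp only [toH0_act, Finset.sum_const, Finset.card_univ] at h
  rw [← Nat.cast_smul_eq_nsmul k] at h
  exact (smul_eq_zero.1 h).resolve_left hc

variable {𝓜 : Type} [Monoid 𝓜]

/-- T2 when the quotient group has order prime to p -/
lemma Split.kills_acyc {N₁ N₂ : Type} [Group N₁] [Group N₂] [Fintype G] [Fintype N₁] [Fintype N₂]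
    {θ : Act 𝓜 G} {θ₁ : Act 𝓜 N₁} {θ₂ : Act 𝓜 N₂}
    (S : Split θ θ₁ θ₂) {ε : MonoidAlgebra k 𝓜} (hε : ε * ε = ε) (n : ℕ) (X : EqRep k θ M)
    (hc : (Fintype.card N₂ : k) ≠ 0)
    (h : ∀ x, toH0 (S.HN X n).ρ (((S.res X).op n).asAlgebraHom ε x) = 0) :
    Kills (X.op n) ε := by
  apply S.kills hε
  intro a b hab
  rcases a with _ | a
  · rw [zero_add] at hab
    subst hab
    intro x
    obtain ⟨y, rfl⟩ := toH0_surj _ x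
    have := asAlg_comm (τ := (S.HN X b).τ) (τ' := (S.HN X b).op 0) (toH0 (S.HN X b).ρ)
      (fun q v => (Hmap_toH0 _ _ ((S.HN X b).compat q) v).symm) ε y
    rw [← this]
    exact h y
  · intro x
    exact (Higman.of_card (S.HN X b).ρ hc).acyclic a _

lemma Split.vanish_acyc {N₁ N₂ : Type} [Group N₁] [Group N₂] [Fintype G] [Fintype N₁] [Fintype N₂]
    {θ : Act 𝓜 G} {θ₁ : Act 𝓜 N₁} {θ₂ : Act 𝓜 N₂}
    (S : Split θ θ₁ θ₂) (n : ℕ) (X : EqRep k θ M)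
    (hc : (Fintype.card N₂ : k) ≠ 0)
    (h : ∀ x, toH0 (S.HN X n).ρ x = 0) (x : Hm X.ρ n) : x = 0 := by
  have := S.kills_acyc (ε := 1) (one_mul 1) n X hc (fun x => h _) x
  simpa using this

/-- restriction of operators -/
def EqRep.restr {𝓜' : Type} [Monoid 𝓜'] {θ : Act 𝓜 G} (X : EqRep k θ M) (f : 𝓜' →* 𝓜)
    (θ' : Act 𝓜' G) (h : ∀ q, θ' q = θ (f q)) : EqRep k θ' M where
  ρ := X.ρ
  τ := X.τ.comp f
  comm q g v := by rw [h]; exact X.comm (f q) g v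

lemma EqRep.restr_op {𝓜' : Type} [Monoid 𝓜'] {θ : Act 𝓜 G} (X : EqRep k θ M) (f : 𝓜' →* 𝓜)
    (θ' : Act 𝓜' G) (h : ∀ q, θ' q = θ (f q)) (n : ℕ) :
    (X.restr f θ' h).op n = (X.op n).comp f := by
  ext q x
  exact Hmap_congr ((X.restr f θ' h).compat q) (X.compat (f q)) (h q) rfl _ _

/-- the action of {0,1} with 0 acting trivially -/
def Act.zt (A : Type) [Group A] : Act (ZMod 2) A where
  hom q := if q = 0 then 1 else MonoidHom.id A
  one := by simp
  mul a b := by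
    by_cases ha : a = 0 <;> by_cases hb : b = 0 <;> ext x <;> simp [ha, hb]

lemma Act.zt_zero (A : Type) [Group A] : Act.zt A 0 = 1 := rfl

/-- additivity of induced maps -/
theorem additivity [Fintype G] (i : ℕ)
    (hG : ∀ b, 0 < b → b < i + 1 → ∀ x : Hm (1 : Representation k G k) b, x = 0)
    (f f' g : G →* G') (hc : ∀ a b, f a * f' b = f' b * f a) (hg : ∀ a, g a = f a * f' a)
    (hf hf' hg')
    (x : Hm (1 : Representation k G k) (i + 1)) :
    Hmap (ρ' := (1 : Representation k G' k)) g LinearMap.id hg' (i + 1) x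
      = Hmap (ρ' := (1 : Representation k G' k)) f LinearMap.id hf (i + 1) x
        + Hmap (ρ' := (1 : Representation k G' k)) f' LinearMap.id hf' (i + 1) x := by
  let Z := ZMod 2 × ZMod 2
  let θ₁ : Act Z G := ⟨fun q => Act.zt G q.1, rfl, fun a b => (Act.zt G).mul a.1 b.1⟩
  let θ₂ : Act Z G := ⟨fun q => Act.zt G q.2, rfl, fun a b => (Act.zt G).mul a.2 b.2⟩
  let α : Act G G := Act.triv G G
  have hα : ∀ q a b, θ₁ q (α b a) = α (θ₂ q b) (θ₁ q a) := fun _ _ _ => rfl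
  let S := Split.semi α θ₁ θ₂ hα
  let X : EqRep k (Act.semi α θ₁ θ₂ hα) k := ⟨1, 1, fun _ _ _ => rfl⟩
  let z : MonoidAlgebra k Z := MonoidAlgebra.of k Z (0, 1)
  let z' : MonoidAlgebra k Z := MonoidAlgebra.of k Z (1, 0)
  have hz : z * z = z := by
    simp only [z, ← map_mul]; rfl
  have hz' : z' * z' = z' := by
    simp only [z', ← map_mul]; rfl
  have hzz : z' * z = z * z' := by
    simp only [z, z', ← map_mul]; rfl
  have hε : ((1 - z) * (1 - z')) * ((1 - z) * (1 - z')) = (1 - z) * (1 - z') := by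
    have e1 : (1 - z) * (1 - z) = 1 - z := by
      simp only [mul_sub, sub_mul, mul_one, one_mul, hz]; abel
    have e2 : (1 - z') * (1 - z') = 1 - z' := by
      simp only [mul_sub, sub_mul, mul_one, one_mul, hz']; abel
    have e3 : (1 - z') * (1 - z) = (1 - z) * (1 - z') := by
      simp only [mul_sub, sub_mul, mul_one, one_mul, hzz]; abel
    calc _ = (1 - z) * ((1 - z') * (1 - z)) * (1 - z') := by simp only [mul_assoc]
      _ = _ := by rw [e3, ← mul_assoc, e1, mul_assoc, e2]
  have e3 : (1 - z) * (1 - z') = (1 - z') * (1 - z) := by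
    simp only [mul_sub, sub_mul, mul_one, one_mul, hzz]; abel
  have key := S.kills hε (i + 1) X (by
    intro a b hab
    rcases Nat.eq_zero_or_pos b with rfl | hb
    · rw [e3]
      apply Kills.mul_left
      intro v
      rw [map_sub, LinearMap.sub_apply, map_one, asAlg_of, Module.End.one_apply, sub_eq_zero]
      symm
      rw [EqRep.op_apply]
      refine (Hmap_congr _ (Compat.id _) ?_ ?_ _ _).trans (Hmap_id _ _ _)
      · rfl
      · ext y
        obtain ⟨m, rfl⟩ := toH0_surj _ y
        exact Hmap_toH0 _ _ ((S.res X).compat (0, 1)) m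
    · by_cases hbi : b < i + 1
      · intro v
        have h0 : ∀ y : Hm (X.ρ.comp S.i₁) b, y = 0 := fun y => hG b hb hbi y
        have h1 : ∀ w : Hm (S.HN X b).ρ a, w = 0 := by
          intro w
          have hh : Compat (S.HN X b).ρ (S.HN X b).ρ (MonoidHom.id _) LinearMap.id := Compat.id _
          rw [← Hmap_id hh a w]
          exact Hmap_zero_φ _ (LinearMap.ext fun y => h0 _) _ _
        exact h1 _
      · have ha : a = 0 := by omega
        subst ha
        apply Kills.mul_left
        intro v
        obtain ⟨y, rfl⟩ := toH0_surj _ v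
        rw [map_sub, LinearMap.sub_apply, map_one, asAlg_of, Module.End.one_apply, sub_eq_zero]
        symm
        rw [EqRep.op_apply]
        refine (Hmap_toH0 _ _ ((S.HN X b).compat (1, 0)) y).trans ?_
        congr 1
        rw [S.HN_τ, EqRep.op_apply]
        refine (Hmap_congr _ (Compat.id _) ?_ ?_ _ _).trans (Hmap_id _ _ _)
        · rfl
        · rfl)
  let Δ : G →* Semi α := ⟨⟨fun a => ⟨a, a⟩, rfl⟩, fun a b => rfl⟩
  let L : Semi α →* G' := semiLift α f f' (fun a b => (hc a b).symm)
  have hΔ : Compat (1 : Representation k G k) X.ρ Δ LinearMap.id := fun _ _ => rfl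
  have hL : Compat X.ρ (1 : Representation k G' k) L LinearMap.id := fun _ _ => rfl
  have k1 := key (Hmap Δ LinearMap.id hΔ (i + 1) x)
  have e4 : (1 - z) * (1 - z') = 1 - z - z' + MonoidAlgebra.of k Z (0, 0) := by
    have : MonoidAlgebra.of k Z (0, 0) = z * z' := by
      simp only [z, z', ← map_mul]; rfl
    rw [this]
    simp only [mul_sub, sub_mul, mul_one, one_mul]; abel
  rw [e4, map_add, map_sub, map_sub, map_one] at k1
  simp only [LinearMap.add_apply, LinearMap.sub_apply, Module.End.one_apply, z, z', asAlg_of,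
    EqRep.op_apply] at k1
  have k0 : (Act.semi α θ₁ θ₂ hα) (0, 0) = 1 := by
    ext <;> rfl
  rw [Hmap_one (X.compat (0, 0)) k0, add_zero, sub_sub, sub_eq_zero] at k1
  have k2 := congrArg (Hmap L LinearMap.id hL (i + 1)) k1
  rw [map_add, Hmap_comp, Hmap_comp, Hmap_comp, Hmap_comp, Hmap_comp] at k2
  refine Eq.trans ?_ ((k2.trans ?_).trans (add_comm _ _))
  · refine Hmap_congr _ _ ?_ rfl _ _
    ext a; exact hg a
  · congr 1
    · refine Hmap_congr _ _ ?_ rfl _ _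
      ext a
      show f 1 * f' a = f' a
      rw [map_one, one_mul]
    · refine Hmap_congr _ _ ?_ rfl _ _
      ext a
      show f a * f' 1 = f a
      rw [map_one, mul_one]

end Tools

end SpH


namespace SpH

set_option linter.unusedSectionVars false
set_option linter.unusedSimpArgs false

open Finsupp

section Red

variable {k : Type} [Field k] {F : Type} [Field F] [Fintype F]
variable {ι : Type} [Fintype ι] [DecidableEq ι]
variable {T : Type} [AddCommGroup T] [Module k T] {Q : Type} [AddCommGroup Q] [Module k Q]

/-- expansion with respect to the idempotents -/
lemma expand (τ : Representation k (ι → F) T) (q : T →ₗ[k] Q) (h0 : ∀ x, q (τ 0 x) = 0)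
    (h : ∀ s x, q (x - τ (Pi.mulSingle s 0) x) = 0) (x : T) : q x = 0 := by
  have key : ∀ S : Finset ι, q x = q (τ (fun i => if i ∈ S then 0 else 1) x) := by
    intro S
    induction S using Finset.induction_on with
    | empty =>
      have : (fun i : ι => if i ∈ (∅ : Finset ι) then (0 : F) else 1) = 1 := by ext; simp
      rw [this, map_one]; rfl
    | insert a S ha ih =>
      have : (fun i : ι => if i ∈ insert a S then (0 : F) else 1)
          = Pi.mulSingle a 0 * (fun i => if i ∈ S then 0 else 1) := by
        ext i
        by_cases hi : i = a
        · subst hi; simp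
        · simp [hi]
      rw [this, map_mul, Module.End.mul_apply, ih]
      have := h a (τ (fun i => if i ∈ S then 0 else 1) x)
      rw [map_sub, sub_eq_zero] at this
      exact this
  rw [key Finset.univ]
  have : (fun i : ι => if i ∈ (Finset.univ : Finset ι) then (0 : F) else 1) = 0 := by ext; simp
  rw [this, h0]

/-- diagonal matrices -/
abbrev diagH (F : Type) [Field F] (ι : Type) [Fintype ι] [DecidableEq ι] :
    (ι → F) →* Matrix ι ι F := (Matrix.diagonalRingHom ι F).toMonoidHom

/-- restriction to diagonal matrices -/
abbrev Drep (τ : Representation k (Matrix ι ι F) T) : Representation k (ι → F) T :=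
  τ.comp (diagH F ι)

/-- restriction to invertible matrices -/
abbrev GLrep (τ : Representation k (Matrix ι ι F) T) : Representation k (Matrix ι ι F)ˣ T :=
  τ.comp (Units.coeHom _)

/-- elementary matrix -/
abbrev EE (i j : ι) : Matrix ι ι F := Matrix.single i j 1

lemma EE_same (i j l : ι) : (EE i j : Matrix ι ι F) * EE j l = EE i l := by
  simp [EE]

lemma EE_ne (i j l m : ι) (h : j ≠ l) : (EE i j : Matrix ι ι F) * EE l m = 0 := by
  simp [EE, h]

lemma diagH_mulSingle (s : ι) (t : F) :
    diagH F ι (Pi.mulSingle s t) = 1 - EE s s + t • EE s s := by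
  ext i j
  show Matrix.diagonal _ i j = _
  by_cases hij : i = j
  · subst hij
    by_cases his : i = s
    · subst his; simp [EE]
    · simp [EE, his, Matrix.single_apply, Ne.symm his]
  · have : ¬ (s = i ∧ s = j) := fun h => hij (h.1.symm.trans h.2)
    simp [EE, hij, Matrix.single_apply, this]

lemma diagH_zero (s : ι) : diagH F ι (Pi.mulSingle s 0) = 1 - EE s s := by
  rw [diagH_mulSingle]; simp

/-- swap matrix -/
abbrev SW (s c : ι) : Matrix ι ι F := 1 - EE s s - EE c c + EE s c + EE c s

lemma SW_sq {s c : ι} (h : s ≠ c) : (SW s c : Matrix ι ι F) * SW s c = 1 := by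
  simp only [SW, mul_add, add_mul, mul_sub, sub_mul, mul_one, one_mul, EE_same,
    EE_ne _ _ _ _ h, EE_ne _ _ _ _ h.symm]
  abel

lemma TV_inv {s c : ι} (h : s ≠ c) : (1 + EE c s : Matrix ι ι F) * (1 - EE c s) = 1 := by
  simp only [SW, mul_add, add_mul, mul_sub, sub_mul, mul_one, one_mul, EE_same,
    EE_ne _ _ _ _ h, EE_ne _ _ _ _ h.symm]
  abel

lemma DegLt.full (hq : (Fintype.card F : k) = 0) {τ : Representation k (ι → F) T} {D : ℕ}
    (hD : DegLt τ D) (hn : D ≤ 2 * Fintype.card ι) (q : T →ₗ[k] Q)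
    (y : T) (hy : ∀ r, τ (Pi.mulSingle r 0) y = 0)
    (hinv : ∀ s (t : F) x, t ≠ 0 → q (τ (Pi.mulSingle s t) x) = q x) : q y = 0 := by
  classical
  have key : ∀ S : Finset ι, q y = q (τ.asAlgebraHom (∏ s ∈ S, eS k F s 2) y) := by
    intro S
    induction S using Finset.induction_on with
    | empty => simp
    | insert a S ha ih =>
      rw [Finset.prod_insert ha, map_mul, Module.End.mul_apply, ih]
      set y' := τ.asAlgebraHom (∏ s ∈ S, eS k F s 2) y with hy'
      have h0 : τ (Pi.mulSingle a 0) y' = 0 := by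
        rw [hy', ← asAlg_of τ, ← Module.End.mul_apply, ← map_mul, mul_comm, map_mul,
          Module.End.mul_apply, asAlg_of, hy, map_zero]
      rw [eS_two, map_neg, map_sum, LinearMap.neg_apply, LinearMap.sum_apply, map_neg, map_sum]
      simp only [asAlg_of]
      rw [← Finset.add_sum_erase _ _ (Finset.mem_univ (0 : F)), h0, map_zero, zero_add,
        Finset.sum_congr rfl (fun t ht => hinv a t y' (Finset.ne_of_mem_erase ht)),
        Finset.sum_const, Finset.card_erase_of_mem (Finset.mem_univ _), Finset.card_univ,
        ← Nat.cast_smul_eq_nsmul k, Nat.cast_sub Fintype.card_pos, hq]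
      simp
  rw [key Finset.univ]
  have := hD (fun _ => 2) (by simpa [wt, mul_comm] using hn) y
  have e : eW k F (fun _ : ι => (2 : Fin 3)) = ∏ s, eS k F s 2 := rfl
  rw [e] at this
  rw [this, map_zero]

/-- coinvariants of a reduced module of small degree vanish -/
theorem coinv_red (hq : (Fintype.card F : k) = 0) (τ : Representation k (Matrix ι ι F) T) {D : ℕ}
    (hD : DegLt (Drep τ) D) (hn : D ≤ 2 * Fintype.card ι) (hred : ∀ x, τ 0 x = 0)
    (q : T →ₗ[k] Q) (hinv : ∀ A B : Matrix ι ι F, A * B = 1 → ∀ x, q (τ A x) = q x) (x : T) :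
    q x = 0 := by
  have hu : ∀ A B x, τ (A * B) x = τ A (τ B x) := fun A B x => by
    rw [map_mul, Module.End.mul_apply]
  have hs : ∀ A B x, A = B → τ A x = τ B x := fun A B x h => by rw [h]
  let Z : ι → Matrix ι ι F := fun r => 1 - EE r r
  have hZ : ∀ r x, Drep τ (Pi.mulSingle r 0) x = τ (Z r) x := fun r x => by
    show τ (diagH F ι _) x = _
    rw [diagH_zero]
  have key : ∀ n, ∀ S : Finset ι, Sᶜ.card = n → S.Nonempty → ∀ y, (∀ r ∈ S, τ (Z r) y = 0) →
      q y = 0 := by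
    intro n
    induction n with
    | zero =>
      intro S hS _ y hy
      have : S = Finset.univ := by
        rw [Finset.card_eq_zero, Finset.compl_eq_empty_iff] at hS; exact hS
      subst this
      refine hD.full hq hn q y (fun r => (hZ r y).trans (hy r (Finset.mem_univ _))) ?_
      intro s t x ht
      refine hinv _ (diagH F ι (Pi.mulSingle s t⁻¹)) ?_ x
      rw [← map_mul, ← Pi.mulSingle_mul, mul_inv_cancel₀ ht, Pi.mulSingle_one, map_one]
    | succ n ih =>
      rintro S hS ⟨s, hsS⟩ y hy
      obtain ⟨c, hc⟩ : Sᶜ.Nonempty := by rw [← Finset.card_pos]; omega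
      have hcS := Finset.mem_compl.1 hc
      have hsc : s ≠ c := fun h => hcS (h ▸ hsS)
      have ih' := ih (insert c S) (by
        rw [Finset.compl_insert, Finset.card_erase_of_mem hc, hS]; rfl) (Finset.insert_nonempty _ _)
      have hZZ : ∀ r r', Z r * Z r' = Z r' * Z r := by
        intro r r'
        by_cases hr : r = r'
        · rw [hr]
        · simp only [Z, mul_sub, sub_mul, mul_one, one_mul, EE_ne _ _ _ _ hr,
            EE_ne _ _ _ _ (Ne.symm hr)]
          abel
      have hZi : ∀ r, Z r * Z r = Z r := by
        intro r
        simp only [Z, mul_sub, sub_mul, mul_one, one_mul, EE_same]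
        abel
      set y' := τ (Z c) y with hy'
      have hy'r : ∀ r ∈ S, τ (Z r) y' = 0 := by
        intro r hr
        rw [hy', ← hu, hZZ, hu, hy r hr, map_zero]
      have hy'c : τ (Z c) y' = y' := by rw [hy', ← hu, hZi]
      have h1 : q (y - y') = 0 := by
        apply ih'
        intro r hr
        rw [map_sub]
        rcases Finset.mem_insert.1 hr with rfl | hr
        · rw [hy'c, sub_self]
        · rw [hy'r r hr, hy r hr, sub_self]
      let u : Matrix ι ι F := 1 + EE c s
      let σ : Matrix ι ι F := SW s c
      have h2 : q (τ u y' - y' - τ σ y') = 0 := by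
        apply ih'
        intro r hr
        rw [map_sub, map_sub]
        by_cases hrc : r = c
        · subst hrc
          have e1 : Z r * u * Z r = Z r := by
            simp only [Z, u, mul_add, add_mul, mul_sub, sub_mul, mul_one, one_mul, EE_same,
              EE_ne _ _ _ _ hsc, EE_ne _ _ _ _ hsc.symm]
            abel
          have e2 : Z r * σ = σ * Z s := by
            simp only [Z, σ, SW, mul_add, add_mul, mul_sub, sub_mul, mul_one, one_mul, EE_same,
              EE_ne _ _ _ _ hsc, EE_ne _ _ _ _ hsc.symm]
            abel
          have f1 : τ (Z r) (τ u y') = y' := by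
            rw [hy', ← hu, ← hu, e1]
          have f2 : τ (Z r) (τ σ y') = 0 := by
            rw [← hu, e2, hu, hy'r s hsS, map_zero]
          rw [f1, hy'c, f2, sub_self, sub_zero]
        · have hrS : r ∈ S := (Finset.mem_insert.1 hr).resolve_left hrc
          by_cases hrs : r = s
          · subst hrs
            have e1 : Z r * u * Z c = Z r * σ * Z c := by
              simp only [Z, u, σ, SW, mul_add, add_mul, mul_sub, sub_mul, mul_one, one_mul,
                EE_same, EE_ne _ _ _ _ hsc, EE_ne _ _ _ _ hsc.symm, zero_mul, mul_zero]
              abel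
            have f1 : τ (Z r) (τ u y') = τ (Z r) (τ σ y') := by
              rw [hy', ← hu, ← hu, ← hu, ← hu, e1]
            rw [f1, hy'r r hrS, sub_zero, sub_self]
          · have e1 : Z r * u = u * Z r := by
              simp only [Z, u, mul_add, add_mul, mul_sub, sub_mul, mul_one, one_mul, EE_same,
                EE_ne _ _ _ _ hrc, EE_ne _ _ _ _ (Ne.symm hrs)]
              abel
            have e2 : Z r * σ = σ * Z r := by
              simp only [Z, σ, SW, mul_add, add_mul, mul_sub, sub_mul, mul_one, one_mul, EE_same,
                EE_ne _ _ _ _ hrc, EE_ne _ _ _ _ (Ne.symm hrs), EE_ne _ _ _ _ hrs,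
                EE_ne _ _ _ _ (Ne.symm hrc)]
              abel
            have f1 : τ (Z r) (τ u y') = 0 := by
              rw [← hu, e1, hu, hy'r r hrS, map_zero]
            have f2 : τ (Z r) (τ σ y') = 0 := by
              rw [← hu, e2, hu, hy'r r hrS, map_zero]
            rw [f1, f2, hy'r r hrS]; simp
      rw [map_sub, map_sub, hinv u (1 - EE c s) (TV_inv hsc), hinv σ σ (SW_sq hsc), sub_self,
        zero_sub, neg_eq_zero] at h2
      rw [map_sub, h2, sub_zero] at h1
      exact h1
  refine expand (Drep τ) q (fun x => ?_) (fun s x => ?_) x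
  · have : Drep τ 0 x = τ 0 x := by
      show τ (diagH F ι 0) x = _
      congr 2
      exact map_zero (Matrix.diagonalRingHom ι F)
    rw [this, hred, map_zero]
  · rw [hZ]
    refine key _ {s} rfl (Finset.singleton_nonempty _) _ ?_
    intro r hr
    rw [Finset.mem_singleton.1 hr, map_sub, ← hu]
    have : Z s * Z s = Z s := by
      simp only [Z, mul_sub, sub_mul, mul_one, one_mul, EE_same]
      abel
    rw [this, sub_self]

theorem H0_red (hq : (Fintype.card F : k) = 0) (τ : Representation k (Matrix ι ι F) T) {D : ℕ}
    (hD : DegLt (Drep τ) D) (hn : D ≤ 2 * Fintype.card ι) (hred : ∀ x, τ 0 x = 0)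
    (x : Hm (GLrep τ) 0) : x = 0 := by
  obtain ⟨m, rfl⟩ := toH0_surj _ x
  refine coinv_red hq τ hD hn hred _ ?_ m
  intro A B h x
  exact toH0_act (GLrep τ) ⟨A, B, h, mul_eq_one_comm.1 h⟩ x

end Red

end SpH


namespace SpH

set_option linter.unusedSectionVars false
set_option linter.unusedSimpArgs false

open Finsupp
open scoped Matrix

/-- two independent families are conjugate -/
lemma li_conj {K V J : Type} [Field K] [AddCommGroup V] [Module K V] [Finite J]
    {v v' : J → V} (h : LinearIndependent K v) (h' : LinearIndependent K v') :
    ∃ g : V ≃ₗ[K] V, ∀ j, g (v j) = v' j := by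
  let f := h.linearCombinationEquiv.symm ≪≫ₗ h'.linearCombinationEquiv
  have : FiniteDimensional K (Submodule.span K (Set.range v)) :=
    FiniteDimensional.span_of_finite K (Set.finite_range _)
  obtain ⟨g, hg⟩ := Submodule.exists_linearEquiv_restrict_eq f
  refine ⟨g, fun j => ?_⟩
  have e1 : v j = h.linearCombinationEquiv (Finsupp.single j 1) := by simp
  have e2 : v' j = h'.linearCombinationEquiv (Finsupp.single j 1) := by simp
  rw [e1, ← hg, e2]
  simp [f]

section X

variable {F : Type} [Field F]
variable {L : Type} [Fintype L] [DecidableEq L] {J : Type} [Fintype J] [DecidableEq J]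

noncomputable instance [Fintype F] : Fintype (Matrix L L F)ˣ := Fintype.ofFinite _

/-- independent families of row vectors -/
def XX (F L J : Type) [Field F] : Type := {ξ : J → (L → F) // LinearIndependent F ξ}

noncomputable instance [Fintype F] : Fintype (XX F L J) := by
  classical
  haveI : Finite (XX F L J) := by unfold XX; infer_instance
  exact Fintype.ofFinite _

lemma XX_li (g : (Matrix L L F)ˣ) {ξ : J → (L → F)} (h : LinearIndependent F ξ) :
    LinearIndependent F (fun j => ξ j ᵥ* (g⁻¹).val) := by
  refine LinearIndependent.map_injOn (R := F) h (Matrix.vecMulLinear (g⁻¹).val) ?_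
  apply Function.Injective.injOn
  intro a b hab
  have := congrArg (fun x => x ᵥ* g.val) hab
  simpa [Matrix.vecMul_vecMul] using this

noncomputable instance : MulAction (Matrix L L F)ˣ (XX F L J) where
  smul g ξ := ⟨fun j => ξ.1 j ᵥ* (g⁻¹).val, XX_li g ξ.2⟩
  one_smul ξ := by
    apply Subtype.ext
    funext j
    show ξ.1 j ᵥ* _ = _
    simp
  mul_smul a b ξ := by
    apply Subtype.ext
    funext j
    show ξ.1 j ᵥ* ((a * b)⁻¹).val = (ξ.1 j ᵥ* (b⁻¹).val) ᵥ* (a⁻¹).val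
    rw [Matrix.vecMul_vecMul, mul_inv_rev]
    rfl

lemma XX_smul (g : (Matrix L L F)ˣ) (ξ : XX F L J) (j) : (g • ξ).1 j = ξ.1 j ᵥ* (g⁻¹).val := rfl

instance : MulAction.IsPretransitive (Matrix L L F)ˣ (XX F L J) where
  exists_smul_eq ξ ξ' := by
    obtain ⟨g, hg⟩ := li_conj ξ.2 ξ'.2
    let A : Matrix L L F := (LinearMap.toMatrix' g.toLinearMap)ᵀ
    let B : Matrix L L F := (LinearMap.toMatrix' g.symm.toLinearMap)ᵀ
    have h1 : A * B = 1 := by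
      simp only [A, B, ← Matrix.transpose_mul, ← LinearMap.toMatrix'_comp]
      simp
    have h2 : B * A = 1 := mul_eq_one_comm.1 h1
    refine ⟨⟨B, A, h2, h1⟩, ?_⟩
    apply Subtype.ext
    funext j
    rw [XX_smul]
    show ξ.1 j ᵥ* A = _
    rw [Matrix.vecMul_transpose, LinearMap.toMatrix'_mulVec]
    exact hg j

end X

section Aff

variable {F : Type} [Field F]
variable {κ : Type} [Fintype κ] [DecidableEq κ] {J : Type} [Fintype J] [DecidableEq J]
variable {L : Type} [Fintype L] [DecidableEq L]

/-- block embedding -/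
def blk (F κ J : Type) [Field F] [Fintype κ] [DecidableEq κ] [Fintype J] [DecidableEq J] :
    Matrix κ κ F →* Matrix (κ ⊕ J) (κ ⊕ J) F where
  toFun A := Matrix.fromBlocks A 0 0 1
  map_one' := by simp
  map_mul' A B := by simp [Matrix.fromBlocks_multiply]

/-- unipotent elements -/
def uM (F κ J : Type) [Field F] [Fintype κ] [DecidableEq κ] [Fintype J] [DecidableEq J] :
    Multiplicative (Matrix κ J F) →* Matrix (κ ⊕ J) (κ ⊕ J) F where
  toFun B := Matrix.fromBlocks 1 B.toAdd 0 1
  map_one' := by simp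
  map_mul' A B := by simp [Matrix.fromBlocks_multiply, add_comm]

/-- scalars -/
def tM (F κ J : Type) [Field F] [Fintype κ] [DecidableEq κ] [Fintype J] [DecidableEq J] :
    F →* Matrix (κ ⊕ J) (κ ⊕ J) F where
  toFun t := Matrix.fromBlocks 1 0 0 (t • 1)
  map_one' := by simp
  map_mul' A B := by simp [Matrix.fromBlocks_multiply, smul_smul, mul_comm]

lemma blk_apply (A : Matrix κ κ F) : blk F κ J A = Matrix.fromBlocks A 0 0 1 := rfl
lemma uM_apply (B) : uM F κ J B = Matrix.fromBlocks 1 B.toAdd 0 1 := rfl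
lemma tM_apply (t : F) : tM F κ J t = Matrix.fromBlocks 1 0 0 (t • 1) := rfl

/-- action of matrices on unipotents -/
def mAct (F κ J : Type) [Field F] [Fintype κ] [DecidableEq κ] [Fintype J] [DecidableEq J] :
    Act (Matrix κ κ F) (Multiplicative (Matrix κ J F)) where
  hom A := AddMonoidHom.toMultiplicative
    { toFun := fun B => A * B
      map_zero' := by simp
      map_add' := fun a b => Matrix.mul_add _ _ _ }
  one := MonoidHom.ext fun x => congrArg Multiplicative.ofAdd (Matrix.one_mul _)
  mul a b := MonoidHom.ext fun x => congrArg Multiplicative.ofAdd (Matrix.mul_assoc _ _ _)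

lemma mAct_apply (A : Matrix κ κ F) (B : Multiplicative (Matrix κ J F)) :
    mAct F κ J A B = Multiplicative.ofAdd (A * B.toAdd) := rfl

/-- action of scalars on unipotents -/
def uAct (F κ J : Type) [Field F] [Fintype κ] [DecidableEq κ] [Fintype J] [DecidableEq J] :
    Act Fˣ (Multiplicative (Matrix κ J F)) where
  hom t := AddMonoidHom.toMultiplicative
    { toFun := fun B => ((t⁻¹ : Fˣ) : F) • B
      map_zero' := by simp
      map_add' := fun a b => by simp [smul_add] }
  one := MonoidHom.ext fun x => congrArg Multiplicative.ofAdd (by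
    show (((1 : Fˣ)⁻¹ : Fˣ) : F) • x.toAdd = x.toAdd
    simp)
  mul a b := MonoidHom.ext fun x => congrArg Multiplicative.ofAdd (by
    show (((a * b)⁻¹ : Fˣ) : F) • x.toAdd = ((a⁻¹ : Fˣ) : F) • ((b⁻¹ : Fˣ) : F) • x.toAdd
    rw [smul_smul]; simp [mul_comm])

lemma uAct_apply (t : Fˣ) (B : Multiplicative (Matrix κ J F)) :
    uAct F κ J t B = Multiplicative.ofAdd (((t⁻¹ : Fˣ) : F) • B.toAdd) := rfl

/-- restriction of actions -/
def Act.restr {𝓜 𝓜' G : Type} [Monoid 𝓜] [Monoid 𝓜'] [Group G] (θ : Act 𝓜 G) (f : 𝓜' →* 𝓜) :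
    Act 𝓜' G where
  hom q := θ (f q)
  one := by rw [map_one, θ.one]
  mul a b := by rw [map_mul, θ.mul]

/-- GL acting on unipotents -/
abbrev gAct (F κ J : Type) [Field F] [Fintype κ] [DecidableEq κ] [Fintype J] [DecidableEq J] :
    Act (Matrix κ κ F)ˣ (Multiplicative (Matrix κ J F)) :=
  (mAct F κ J).restr (Units.coeHom _)

/-- block embedding of GL -/
def glH (F κ J : Type) [Field F] [Fintype κ] [DecidableEq κ] [Fintype J] [DecidableEq J] :
    (Matrix κ κ F)ˣ →* (Matrix (κ ⊕ J) (κ ⊕ J) F)ˣ := Units.map (blk F κ J)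

/-- unipotents -/
def uH (F κ J : Type) [Field F] [Fintype κ] [DecidableEq κ] [Fintype J] [DecidableEq J] :
    Multiplicative (Matrix κ J F) →* (Matrix (κ ⊕ J) (κ ⊕ J) F)ˣ := (uM F κ J).toHomUnits

/-- scalars -/
def tH (F κ J : Type) [Field F] [Fintype κ] [DecidableEq κ] [Fintype J] [DecidableEq J] :
    Fˣ →* (Matrix (κ ⊕ J) (κ ⊕ J) F)ˣ := Units.map (tM F κ J)

lemma glH_val (A : (Matrix κ κ F)ˣ) : (glH F κ J A).val = Matrix.fromBlocks A.val 0 0 1 := rfl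
lemma uH_val (B) : (uH F κ J B).val = Matrix.fromBlocks 1 B.toAdd 0 1 := rfl
lemma tH_val (t : Fˣ) : (tH F κ J t).val = Matrix.fromBlocks 1 0 0 ((t : F) • 1) := rfl

lemma gl_u (B) (A : (Matrix κ κ F)ˣ) :
    glH F κ J A * uH F κ J B = uH F κ J (gAct F κ J A B) * glH F κ J A := by
  apply Units.ext
  rw [Units.val_mul, Units.val_mul, glH_val, uH_val, uH_val, Matrix.fromBlocks_multiply,
    Matrix.fromBlocks_multiply]
  simp
  rfl

/-- affine group -/
def affH (F κ J : Type) [Field F] [Fintype κ] [DecidableEq κ] [Fintype J] [DecidableEq J] :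
    Semi (gAct F κ J) →* (Matrix (κ ⊕ J) (κ ⊕ J) F)ˣ :=
  semiLift (gAct F κ J) (uH F κ J) (glH F κ J) gl_u

lemma affH_val (x) : (affH F κ J x).val = Matrix.fromBlocks x.right.val x.left.toAdd 0 1 := by
  rw [affH, semiLift_mk, Units.val_mul, uH_val, glH_val, Matrix.fromBlocks_multiply]
  simp

lemma affH_inj : Function.Injective (affH F κ J) := by
  intro x y h
  have h1 := congrArg Units.val h
  rw [affH_val, affH_val, Matrix.fromBlocks_inj] at h1
  exact SemidirectProduct.ext h1.2.1 (Units.ext h1.1)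

/-- reindexing -/
def reH (F : Type) [Field F] (e : κ ⊕ J ≃ L) :
    (Matrix (κ ⊕ J) (κ ⊕ J) F)ˣ ≃* (Matrix L L F)ˣ :=
  Units.mapEquiv (Matrix.reindexAlgEquiv F F e).toMulEquiv

lemma reH_val (e : κ ⊕ J ≃ L) (g) : (reH F e g).val = g.val.submatrix e.symm e.symm := rfl

/-- standard base point -/
def y0 (F : Type) [Field F] (e : κ ⊕ J ≃ L) : XX F L J :=
  ⟨fun j => Pi.single (e (Sum.inr j)) 1, by
    have := (Pi.basisFun F L).linearIndependent.comp (fun j => e (Sum.inr j))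
      (e.injective.comp Sum.inr_injective)
    convert this using 1
    funext j
    simp⟩

lemma y0_iff (e : κ ⊕ J ≃ L) (g : (Matrix L L F)ˣ) :
    g • y0 F e = y0 F e ↔ ∀ j i, g.val (e (Sum.inr j)) (e i) = if i = Sum.inr j then 1 else 0 := by
  rw [eq_comm, ← inv_smul_eq_iff]
  constructor
  · intro h j i
    have := congrFun (congrFun (congrArg Subtype.val h) j) (e i)
    rw [XX_smul] at this
    simp only [y0, inv_inv, Matrix.single_one_vecMul] at this
    rw [Matrix.row_apply] at this
    rw [this, Pi.single_apply]
    simp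
  · intro h
    apply Subtype.ext
    funext j l
    rw [XX_smul]
    simp only [y0, inv_inv, Matrix.single_one_vecMul]
    obtain ⟨i, rfl⟩ := e.surjective l
    rw [Matrix.row_apply, h, Pi.single_apply]
    simp

lemma aff_stab (e : κ ⊕ J ≃ L) (s) : ((reH F e).toMonoidHom.comp (affH F κ J)) s • y0 F e = y0 F e := by
  rw [y0_iff]
  intro j i
  show (reH F e (affH F κ J s)).val _ _ = _
  rw [reH_val, affH_val]
  rcases i with i | i <;> simp [Matrix.one_apply, eq_comm]

lemma aff_stab' (e : κ ⊕ J ≃ L) (g : (Matrix L L F)ˣ) (h : g • y0 F e = y0 F e) :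
    ∃ s, ((reH F e).toMonoidHom.comp (affH F κ J)) s = g := by
  have key : ∀ g : (Matrix L L F)ˣ, g • y0 F e = y0 F e →
      ((reH F e).symm g).val = Matrix.fromBlocks (((reH F e).symm g).val.toBlocks₁₁)
        (((reH F e).symm g).val.toBlocks₁₂) 0 1 := by
    intro g h
    rw [y0_iff] at h
    have h2 : ((reH F e).symm g).val = g.val.submatrix e e := rfl
    conv_lhs => rw [← Matrix.fromBlocks_toBlocks ((reH F e).symm g).val]
    congr 1
    · ext j i
      rw [h2]
      show g.val (e (Sum.inr j)) (e (Sum.inl i)) = _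
      rw [h]; simp
    · ext j i
      rw [h2]
      show g.val (e (Sum.inr j)) (e (Sum.inr i)) = _
      rw [h]; simp [Matrix.one_apply, eq_comm]
  have h1 := key g h
  have h2 := key g⁻¹ (by rw [inv_smul_eq_iff, h])
  have h3 : ((reH F e).symm g).val * ((reH F e).symm g⁻¹).val = 1 := by
    rw [← Units.val_mul, ← map_mul]; simp
  rw [h1, h2, Matrix.fromBlocks_multiply, ← Matrix.fromBlocks_one, Matrix.fromBlocks_inj] at h3
  have h4 := h3.1
  rw [Matrix.mul_zero, add_zero] at h4
  refine ⟨⟨Multiplicative.ofAdd (((reH F e).symm g).val.toBlocks₁₂), ⟨_, _, h4, mul_eq_one_comm.1 h4⟩⟩, ?_⟩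
  rw [← (reH F e).symm.injective.eq_iff]
  apply Units.ext
  refine Eq.trans ?_ h1.symm
  show ((reH F e).symm (reH F e (affH F κ J _))).val = _
  rw [MulEquiv.symm_apply_apply, affH_val]
  rfl

/-- unipotent times scalars -/
abbrev NU (F κ J : Type) [Field F] [Fintype κ] [DecidableEq κ] [Fintype J] [DecidableEq J] : Type :=
  Semi (uAct F κ J)

/-- matrices acting on NU -/
abbrev nAct (F κ J : Type) [Field F] [Fintype κ] [DecidableEq κ] [Fintype J] [DecidableEq J] :
    Act (Matrix κ κ F) (NU F κ J) :=
  Act.semi (uAct F κ J) (mAct F κ J) (Act.triv _ Fˣ) (fun q a b => by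
    refine congrArg Multiplicative.ofAdd ?_
    exact Matrix.mul_smul (R := F) _ _ _)

lemma t_u (B) (t : Fˣ) :
    tH F κ J t * uH F κ J B = uH F κ J (uAct F κ J t B) * tH F κ J t := by
  apply Units.ext
  rw [Units.val_mul, Units.val_mul, tH_val, uH_val, uH_val, Matrix.fromBlocks_multiply,
    Matrix.fromBlocks_multiply, uAct_apply]
  simp [smul_smul]

/-- NU in GL -/
def nuH (F κ J : Type) [Field F] [Fintype κ] [DecidableEq κ] [Fintype J] [DecidableEq J] :
    NU F κ J →* (Matrix (κ ⊕ J) (κ ⊕ J) F)ˣ :=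
  semiLift (uAct F κ J) (uH F κ J) (tH F κ J) t_u

lemma nuH_val (x) : (nuH F κ J x).val = Matrix.fromBlocks 1 ((x.right : F) • x.left.toAdd) 0 ((x.right : F) • 1) := by
  rw [nuH, semiLift_mk, Units.val_mul, uH_val, tH_val, Matrix.fromBlocks_multiply]
  simp

lemma gl_nu (x) (A : Matrix κ κ F) :
    blk F κ J A * (nuH F κ J x).val = (nuH F κ J (nAct F κ J A x)).val * blk F κ J A := by
  rw [nuH_val, nuH_val, blk_apply, Matrix.fromBlocks_multiply, Matrix.fromBlocks_multiply]
  have h1 : (nAct F κ J A x).right = x.right := rfl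
  have h2 : (nAct F κ J A x).left = Multiplicative.ofAdd (A * x.left.toAdd) := rfl
  rw [h1, h2]
  simp

/-- parabolic -/
abbrev PP (F κ J : Type) [Field F] [Fintype κ] [DecidableEq κ] [Fintype J] [DecidableEq J] : Type :=
  Semi ((nAct F κ J).restr (Units.coeHom _))

/-- parabolic in GL -/
def ppH (F κ J : Type) [Field F] [Fintype κ] [DecidableEq κ] [Fintype J] [DecidableEq J] :
    PP F κ J →* (Matrix (κ ⊕ J) (κ ⊕ J) F)ˣ :=
  semiLift _ (nuH F κ J) (glH F κ J) (fun x A => Units.ext (gl_nu x A.val))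

lemma ppH_inl (x) : ppH F κ J (SemidirectProduct.inl x) = nuH F κ J x := by
  rw [ppH, semiLift_mk]; simp

lemma ppH_inr (x) : ppH F κ J (SemidirectProduct.inr x) = glH F κ J x := by
  rw [ppH, semiLift_mk]; simp

lemma ppH_inj [Nonempty J] : Function.Injective (ppH F κ J) := by
  rw [injective_iff_map_eq_one]
  intro x h
  have h1 := congrArg Units.val h
  rw [ppH, semiLift_mk, Units.val_mul, nuH_val, glH_val, Matrix.fromBlocks_multiply, Units.val_one,
    ← Matrix.fromBlocks_one, Matrix.fromBlocks_inj] at h1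
  obtain ⟨h1, h2, h3, h4⟩ := h1
  simp at h1 h2 h4
  have j : J := Classical.arbitrary J
  have h5 : x.left.right = 1 := by
    have := congrFun (congrFun h4 j) j
    simp at this
    exact this
  refine SemidirectProduct.ext (SemidirectProduct.ext ?_ h5) h1
  exact h2

lemma ppH_index [Fintype F] {k : Type} [Field k] (hq : (Fintype.card F : k) = 0) :
    ((ppH F κ Unit).range.index : k) ≠ 0 := by
  have h1 : MulAction.stabilizer (Matrix (κ ⊕ Unit) (κ ⊕ Unit) F)ˣ (y0 F (Equiv.refl (κ ⊕ Unit)))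
      ≤ (ppH F κ Unit).range := by
    intro g hg
    obtain ⟨s, rfl⟩ := aff_stab' _ g hg
    have : ((reH F (Equiv.refl (κ ⊕ Unit))).toMonoidHom.comp (affH F κ Unit)) s
        = uH F κ Unit s.left * glH F κ Unit s.right := rfl
    rw [this]
    refine mul_mem ?_ ?_
    · refine ⟨SemidirectProduct.inl (SemidirectProduct.inl s.left), ?_⟩
      rw [ppH_inl, nuH, semiLift_mk]; simp
    · exact ⟨SemidirectProduct.inr s.right, ppH_inr _⟩
  have h2 := Subgroup.index_dvd_of_le h1
  rw [MulAction.index_stabilizer_of_transitive] at h2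
  have h3 : Nat.card (XX F (κ ⊕ Unit) Unit) + 1 = Fintype.card F ^ Fintype.card (κ ⊕ Unit) := by
    have e : XX F (κ ⊕ Unit) Unit ≃ {x : (κ ⊕ Unit) → F // x ≠ 0} :=
      (Equiv.funUnique Unit ((κ ⊕ Unit) → F)).subtypeEquiv (fun ξ => by
        rw [linearIndependent_unique_iff]; rfl)
    rw [Nat.card_congr e]
    classical
    rw [Nat.card_eq_fintype_card, Fintype.card_subtype_compl, Fintype.card_subtype_eq,
      Fintype.card_fun]
    have : 0 < Fintype.card F ^ Fintype.card (κ ⊕ Unit) := pow_pos Fintype.card_pos _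
    omega
  intro h0
  obtain ⟨c, hc⟩ := h2
  have h4 := congrArg (Nat.cast (R := k)) h3
  rw [hc] at h4
  push_cast at h4
  rw [h0, hq, zero_mul, zero_add, zero_pow (Fintype.card_ne_zero)] at h4
  exact one_ne_zero h4

end Aff

end SpH


namespace SpH

set_option linter.unusedSectionVars false
set_option linter.unusedSimpArgs false
set_option linter.style.haveILetI false

open Finsupp
open scoped Matrix

/-- standard index types -/
def Idx : ℕ → Type
  | 0 => Empty
  | n + 1 => Idx n ⊕ Unit

instance Idx.fintype : (n : ℕ) → Fintype (Idx n)
  | 0 => inferInstanceAs (Fintype Empty)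
  | n + 1 => letI := Idx.fintype n; inferInstanceAs (Fintype (Idx n ⊕ Unit))

instance Idx.deceq : (n : ℕ) → DecidableEq (Idx n)
  | 0 => inferInstanceAs (DecidableEq Empty)
  | n + 1 => letI := Idx.deceq n; inferInstanceAs (DecidableEq (Idx n ⊕ Unit))

lemma Idx.card : (n : ℕ) → Fintype.card (Idx n) = n
  | 0 => Fintype.card_empty
  | n + 1 => by
    show Fintype.card (Idx n ⊕ Unit) = n + 1
    rw [Fintype.card_sum, Idx.card n]; rfl

section b

variable {k : Type} [Field k]

/-- GL-homology vanishing in a degree -/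
def GV (k F L : Type) [Field k] [Field F] [Fintype L] [DecidableEq L] (n : ℕ) : Prop :=
  ∀ x : Hm (1 : Representation k (Matrix L L F)ˣ k) n, x = 0

lemma GV.congr {F L L' : Type} [Field F] [Fintype L] [DecidableEq L] [Fintype L'] [DecidableEq L']
    (e : L ≃ L') {n : ℕ} (h : GV k F L n) : GV k F L' n := by
  intro x
  let f : (Matrix L L F)ˣ ≃* (Matrix L' L' F)ˣ :=
    Units.mapEquiv (Matrix.reindexAlgEquiv F F e).toMulEquiv
  obtain ⟨y, rfl⟩ := (Hmap_bij (ρ := (1 : Representation k (Matrix L L F)ˣ k))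
    (ρ' := (1 : Representation k (Matrix L' L' F)ˣ k)) f (LinearEquiv.refl k k)
    (fun _ _ => rfl) n).2 x
  rw [h y, map_zero]

/-- multiplication by a scalar -/
def smulH {K : Type} [Field K] (W : Type) [AddCommGroup W] [Module K W] (t : K) :
    Multiplicative W →* Multiplicative W :=
  AddMonoidHom.toMultiplicative (DistribSMul.toAddMonoidHom W t)

lemma triv_compat {G G' : Type} [Group G] [Group G'] (f : G →* G') :
    Compat (1 : Representation k G k) (1 : Representation k G' k) f LinearMap.id := fun _ _ => rfl

lemma eW_two (k F : Type) [Field k] [Field F] [Fintype F] {ι : Type} [Fintype ι] [DecidableEq ι] :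
    eW k F (fun _ : ι => 2) = (-1) ^ (Fintype.card ι) * ∑ c : ι → F, MonoidAlgebra.of k _ c := by
  have h1 : ∀ s : ι, eS k F s ((2 : Fin 3) : ℕ) = -1 * ∑ t : F, MonoidAlgebra.of k _ (Pi.mulSingle s t) := by
    intro s
    rw [neg_one_mul]; exact eS_two k F s
  unfold eW
  rw [Finset.prod_congr rfl (fun s _ => h1 s), Finset.prod_mul_distrib, Finset.prod_const,
    Finset.prod_univ_sum]
  congr 1
  rw [Fintype.piFinset_univ]
  refine Finset.sum_congr rfl fun c _ => ?_
  rw [← map_prod, Finset.univ_prod_mulSingle]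

lemma sumK {F K : Type} [Field F] [Fintype F] [Field K] [Fintype K] [Algebra F K]
    (hq : (Fintype.card F : k) = 0) (hq2 : Fintype.card F ≠ 2) {m : ℕ} (e : Module.Basis (Fin m) F K)
    (W : Type) [AddCommGroup W] [Module K W] [Fintype W] (b : ℕ) (hb : b + 1 ≤ 2 * m)
    (x : Hm (1 : Representation k (Multiplicative W) k) b) :
    ∑ t : K, Hmap (ρ' := (1 : Representation k (Multiplicative W) k)) (smulH W t) LinearMap.id
      (triv_compat _) b x = 0 := by
  classical
  letI : Module F W := Module.compHom W (algebraMap F K)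
  haveI : IsScalarTower F K W := ⟨fun a b c => by
    rw [Algebra.smul_def, mul_smul]; rfl⟩
  let θ := piAct W (fun i : Fin m => Pi.evalMonoidHom (fun _ => F) i)
  let X : EqRep k θ k := ⟨1, 1, fun _ _ _ => rfl⟩
  have h1 : DegLt X.τ 1 := DegLt.triv hq _ (fun _ _ => rfl)
  have h2 := DegBound.std (k := k) (ι := Fin m) hq hq2 W _ X 1 h1 b (fun _ => 2) (by
    simp [wt]; omega)
  let Δ : Multiplicative W →* Multiplicative (Fin m → W) :=
    AddMonoidHom.toMultiplicative
      { toFun := fun u i => e i • u, map_zero' := by ext; simp, map_add' := fun a b => by ext; simp }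
  let N : Multiplicative (Fin m → W) →* Multiplicative W :=
    AddMonoidHom.toMultiplicative
      { toFun := fun u => ∑ i, u i, map_zero' := by simp,
        map_add' := fun a b => by simp [Finset.sum_add_distrib] }
  have h3 := h2 (Hmap Δ LinearMap.id (triv_compat Δ) b x)
  rw [eW_two, map_mul, map_pow, map_neg, map_one, map_sum, Module.End.mul_apply,
    LinearMap.sum_apply] at h3
  simp only [asAlg_of] at h3
  have h4 : ∀ z : Hm X.ρ b, ((-1 : Module.End k (Hm X.ρ b)) ^ Fintype.card (Fin m)) z = 0 → z = 0 := by
    intro z hz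
    rcases neg_one_pow_eq_or (Module.End k (Hm X.ρ b)) (Fintype.card (Fin m)) with h | h
    · rw [h] at hz; exact hz
    · rw [h] at hz; exact neg_eq_zero.1 hz
  have h5 := congrArg (Hmap (ρ' := (1 : Representation k (Multiplicative W) k)) N LinearMap.id
    (triv_compat N) b) (h4 _ h3)
  rw [map_sum, map_zero] at h5
  rw [← h5, ← e.equivFun.symm.toEquiv.sum_comp]
  refine Finset.sum_congr rfl fun c _ => ?_
  rw [EqRep.op_apply]
  have h6 := Hmap_comp (triv_compat (k := k) (θ c)) (triv_compat (k := k) Δ) b x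
  have h7 := Hmap_comp (triv_compat (k := k) N) (triv_compat (k := k) ((θ c).comp Δ)) b x
  refine Eq.trans ?_ (h7.symm.trans (congrArg _ h6.symm))
  refine Hmap_congr _ _ ?_ rfl _ _
  refine MonoidHom.ext fun u => congrArg Multiplicative.ofAdd ?_
  show (e.equivFun.symm c) • u.toAdd = ∑ i, c i • (e i • u.toAdd)
  rw [Module.Basis.equivFun_symm_apply, Finset.sum_smul]
  simp only [smul_assoc]

lemma card_units_ne {K : Type} [Field K] [Fintype K] (hK : (Fintype.card K : k) = 0)
    [Fintype Kˣ] : (Fintype.card Kˣ : k) ≠ 0 := by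
  classical
  intro h
  have h1 := Fintype.card_eq_card_units_add_one (α := K)
  have h2 := congrArg (Nat.cast (R := k)) h1
  push_cast at h2
  rw [hK] at h2
  have h3 : 0 = (Fintype.card Kˣ : k) + 1 := by convert h2
  rw [h] at h3
  simp at h3

/-- vanishing for the mirabolic normal subgroup -/
lemma NU_vanish {F K : Type} [Field F] [Fintype F] [Field K] [Fintype K] [Algebra F K]
    (hq : (Fintype.card F : k) = 0) (hq2 : Fintype.card F ≠ 2) {m : ℕ} (e : Module.Basis (Fin m) F K)
    (hK : (Fintype.card K : k) = 0)
    {κ : Type} [Fintype κ] [DecidableEq κ] (b : ℕ) (hb : b + 2 ≤ 2 * m)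
    (x : Hm (1 : Representation k (NU K κ Unit) k) (b + 1)) : x = 0 := by
  classical
  let X : EqRep k (Act.semi (uAct K κ Unit) (Act.triv Unit _) (Act.triv Unit _) (fun _ _ _ => rfl)) k :=
    ⟨1, 1, fun _ _ _ => rfl⟩
  let S := Split.semi (uAct K κ Unit) (Act.triv Unit _) (Act.triv Unit _) (fun _ _ _ => rfl)
  refine S.vanish_acyc (b + 1) X (card_units_ne hK) ?_ x
  intro z
  apply toH0_avg _ (card_units_ne hK)
  convert map_zero (toH0 (S.HN X (b+1)).ρ)
  have h1 := sumK (k := k) hq hq2 e (Matrix κ Unit K) (b + 1) hb z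
  have h0 : Hmap (ρ' := (1 : Representation k (Multiplicative (Matrix κ Unit K)) k))
      (smulH (Matrix κ Unit K) (0 : K)) LinearMap.id
      (triv_compat _) (b + 1) z = 0 := by
    refine Hmap_one _ ?_ _ _
    refine MonoidHom.ext fun u => congrArg Multiplicative.ofAdd ?_
    exact zero_smul K u.toAdd
  rw [← Finset.sum_erase Finset.univ (f := fun t : K => Hmap (ρ' := (1 : Representation k
    (Multiplicative (Matrix κ Unit K)) k)) (smulH (Matrix κ Unit K) t) LinearMap.id
      (triv_compat _) (b + 1) z) h0] at h1
  rw [← h1]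
  symm
  refine Finset.sum_bij' (fun t ht => (Units.mk0 t (Finset.ne_of_mem_erase ht))⁻¹)
    (fun t _ => ((t⁻¹ : Kˣ) : K)) ?_ ?_ ?_ ?_ ?_
  · intros; simp
  · intros; simp
  · intros; simp
  · intro t _; ext; simp
  · intro t ht
    refine Hmap_congr _ (triv_compat _) ?_ rfl _ _
    refine MonoidHom.ext fun u => congrArg Multiplicative.ofAdd ?_
    show t • u.toAdd = _ 
    simp

theorem ext_vanish {F K : Type} [Field F] [Fintype F] [Field K] [Fintype K] [Algebra F K]
    (hq : (Fintype.card F : k) = 0) (hq2 : Fintype.card F ≠ 2) {m : ℕ} (e : Module.Basis (Fin m) F K)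
    (hK : (Fintype.card K : k) = 0) (n i : ℕ) (hi : i + 2 ≤ 2 * m) : GV k K (Idx n) (i + 1) := by
  classical
  induction n with
  | zero =>
    intro x
    refine Higman.acyclic (Higman.of_card _ ?_) i x
    have : Subsingleton (Matrix (Idx 0) (Idx 0) K) := by
      haveI : IsEmpty (Idx 0) := inferInstanceAs (IsEmpty Empty)
      infer_instance
    have : Fintype.card (Matrix (Idx 0) (Idx 0) K)ˣ = 1 :=
      Fintype.card_eq_one_iff.2 ⟨1, fun y => Units.ext (Subsingleton.elim _ _)⟩
    rw [this]; simp
  | succ n ih =>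
    show GV k K (Idx n ⊕ Unit) (i + 1)
    intro x
    refine transfer (ppH K (Idx n) Unit) ppH_inj (i + 1) _ (ppH_index hK) ?_ x
    let X : EqRep k (Act.semi ((nAct K (Idx n) Unit).restr (Units.coeHom _))
      (Act.triv Unit _) (Act.triv Unit _) (fun _ _ _ => rfl)) k :=
      ⟨1, 1, fun _ _ _ => rfl⟩
    let S := Split.semi ((nAct K (Idx n) Unit).restr (Units.coeHom _))
      (Act.triv Unit _) (Act.triv Unit _) (fun _ _ _ => rfl)
    refine S.vanish (i + 1) X ?_
    intro a b hab
    rcases b with _ | b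
    · rw [add_zero] at hab
      subst hab
      refine triv_vanish ih _ ?_
      intro g y
      obtain ⟨m, rfl⟩ := toH0_surj _ y
      exact S.HN_ρ_toH0 X g m
    · have h0 : ∀ y : Hm (X.ρ.comp S.i₁) (b + 1), y = 0 := fun y =>
        NU_vanish hq hq2 e hK b (by omega) y
      intro w
      have hh : Compat (S.HN X (b+1)).ρ (S.HN X (b+1)).ρ (MonoidHom.id _) LinearMap.id := Compat.id _
      rw [← Hmap_id hh a w]
      exact Hmap_zero_φ _ (LinearMap.ext fun y => h0 _) _ _

end b

end SpH


namespace SpH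

set_option linter.unusedSectionVars false
set_option linter.unusedSimpArgs false
set_option linter.style.haveILetI false

open Finsupp
open scoped Matrix

section TH

variable {k : Type} [Field k] {G G' G'' : Type} [Group G] [Group G'] [Group G'']

/-- induced map with trivial coefficients -/
noncomputable def TH (k : Type) [Field k] {G G' : Type} [Group G] [Group G'] (f : G →* G') (n : ℕ) :
    Hm (1 : Representation k G k) n →ₗ[k] Hm (1 : Representation k G' k) n :=
  Hmap f LinearMap.id (triv_compat f) n

lemma TH_comp (f' : G' →* G'') (f : G →* G') (n : ℕ) (x) :
    TH k f' n (TH k f n x) = TH k (f'.comp f) n x := Hmap_comp _ _ n x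

lemma TH_id (n : ℕ) (x) : TH k (MonoidHom.id G) n x = x := Hmap_id _ n x

lemma TH_conj [Fintype G'] (f f' : G →* G') (w : G') (h : ∀ a, f' a = w * f a * w⁻¹) (n : ℕ) (x) :
    TH k f' n x = TH k f n x := by
  have h1 : f' = (MulAut.conj w).toMonoidHom.comp f := by
    ext a; rw [h]; rfl
  rw [h1, ← TH_comp]
  refine Eq.trans ?_ (inner_triv n (1 : Representation k G' k) w (TH k f n x))
  exact Hmap_congr _ _ rfl rfl _ _

lemma TH_equiv_inj (f : G ≃* G') (n : ℕ) (x) (h : TH k f.toMonoidHom n x = 0) : x = 0 := by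
  have := congrArg (TH k f.symm.toMonoidHom n) h
  rw [TH_comp, map_zero] at this
  have h1 : f.symm.toMonoidHom.comp f.toMonoidHom = MonoidHom.id G := by ext; simp
  rwa [h1, TH_id] at this

end TH

section c

variable {k : Type} [Field k] {F : Type} [Field F]
variable {L : Type} [Fintype L] [DecidableEq L] {J : Type} [Fintype J] [DecidableEq J]

/-- permutation matrices -/
def permU (F : Type) [Field F] (e : L ≃ L) : (Matrix L L F)ˣ where
  val := (1 : Matrix L L F).submatrix e id
  inv := (1 : Matrix L L F).submatrix id e
  val_inv := by
    rw [← Matrix.submatrix_mul _ _ e id e Function.bijective_id]; simp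
  inv_val := by
    rw [← Matrix.submatrix_mul _ _ id e id e.bijective]; simp

lemma permU_conj (e : L ≃ L) (g : (Matrix L L F)ˣ) :
    (permU F e * g * (permU F e)⁻¹).val = g.val.submatrix e e := by
  show (1 : Matrix L L F).submatrix e id * g.val * (1 : Matrix L L F).submatrix id e = _
  have : g.val = g.val.submatrix id id := rfl
  conv_lhs => rw [this]
  rw [← Matrix.submatrix_mul _ _ e id id Function.bijective_id,
    ← Matrix.submatrix_mul _ _ e id e Function.bijective_id]
  simp

/-- diagonal blocks indexed by s -/
def dB (F L J : Type) [Field F] [Fintype L] [DecidableEq L] [Fintype J] [DecidableEq J] (s : Finset J) :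
    (Matrix L L F)ˣ →* (Matrix (L × J) (L × J) F)ˣ :=
  Units.map (((Matrix.blockDiagonalRingHom L J F : (J → Matrix L L F) →+* _) : _ →* _).comp
    { toFun := fun A j => if j ∈ s then A else 1
      map_one' := by ext; simp
      map_mul' := fun A B => by
        funext j
        by_cases h : j ∈ s <;> simp [h] })

lemma dB_val (s : Finset J) (A : (Matrix L L F)ˣ) :
    (dB F L J s A).val = Matrix.blockDiagonal (fun j => if j ∈ s then A.val else 1) := rfl

lemma dB_conj [Fintype F] (j j' : J) (n : ℕ) (x) :
    TH k (dB F L J {j'}) n x = TH k (dB F L J {j}) n x := by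
  refine TH_conj _ _ (permU F ((Equiv.refl L).prodCongr (Equiv.swap j j'))) ?_ n x
  intro A
  apply Units.ext
  rw [permU_conj, dB_val, dB_val]
  ext ⟨a, b⟩ ⟨a', b'⟩
  simp only [Matrix.submatrix_apply, Matrix.blockDiagonal_apply, Equiv.prodCongr_apply, Prod.map,
    Equiv.refl_apply, EmbeddingLike.apply_eq_iff_eq, Finset.mem_singleton]
  have : b = j' ↔ Equiv.swap j j' b = j := by
    rw [Equiv.swap_apply_eq_iff]; simp
  simp only [this]

lemma dB_sum [Fintype F] (i : ℕ) (hlow : ∀ b, 0 < b → b < i + 1 → GV k F L b) (j0 : J)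
    (s : Finset J) (x : Hm (1 : Representation k (Matrix L L F)ˣ k) (i + 1)) :
    TH k (dB F L J s) (i + 1) x = (s.card : k) • TH k (dB F L J {j0}) (i + 1) x := by
  induction s using Finset.induction_on with
  | empty =>
    have : dB F L J ∅ = 1 := by
      ext A : 2
      rw [dB_val]
      simp only [Finset.notMem_empty, if_false]
      exact Matrix.blockDiagonal_one
    rw [this]
    simp
    exact Hmap_one _ rfl _ _
  | insert j s hj ih =>
    have h1 := additivity (k := k) i hlow (dB F L J {j}) (dB F L J s) (dB F L J (insert j s))
      (by
        intro A B
        apply Units.ext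
        rw [Units.val_mul, Units.val_mul, dB_val, dB_val, ← Matrix.blockDiagonal_mul,
          ← Matrix.blockDiagonal_mul]
        congr 1
        funext l
        by_cases h3 : l = j
        · subst h3; simp [hj]
        · by_cases h2 : l ∈ s <;> simp [h2, h3])
      (by
        intro A
        apply Units.ext
        rw [Units.val_mul, dB_val, dB_val, dB_val, ← Matrix.blockDiagonal_mul]
        congr 1
        funext l
        by_cases h3 : l = j
        · subst h3; simp [hj]
        · by_cases h2 : l ∈ s <;> simp [h2, h3])
      (triv_compat _) (triv_compat _) (triv_compat _) x
    refine h1.trans ?_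
    refine (congrArg₂ (· + ·) (dB_conj j0 j (i + 1) x) ih).trans ?_
    rw [Finset.card_insert_of_notMem hj, Nat.cast_add, Nat.cast_one, add_smul, one_smul]
    exact add_comm _ _

/-- c: the block embedding is zero on homology -/
lemma emb_zero [Fintype F] {K : Type} [Field K] [Fintype K] [Algebra F K] {m : ℕ}
    (e : Module.Basis (Fin m) F K) (hm : (m : k) ≠ 0) (i : ℕ)
    (hlow : ∀ b, 0 < b → b < i + 1 → GV k F L b) (hK : GV k K L (i + 1)) (j0 : Fin m)
    (x : Hm (1 : Representation k (Matrix L L F)ˣ k) (i + 1)) :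
    TH k (dB F L (Fin m) {j0}) (i + 1) x = 0 := by
  have h1 := dB_sum i hlow j0 Finset.univ x
  let f : (Matrix L L F)ˣ →* (Matrix L L K)ˣ := 
    Units.map (((algebraMap F K).mapMatrix : Matrix L L F →+* Matrix L L K) : _ →* _)
  let g : (Matrix L L K)ˣ →* (Matrix (L × Fin m) (L × Fin m) F)ˣ :=
    Units.map (((Matrix.compRingEquiv L (Fin m) F).toRingHom.comp
      (((Algebra.leftMulMatrix e).toRingHom).mapMatrix) : Matrix L L K →+* _) : Matrix L L K →* _)
  have h2 : dB F L (Fin m) Finset.univ = g.comp f := by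
    ext A : 2
    ext ⟨a, b⟩ ⟨a', b'⟩
    rw [dB_val]
    show _ = Algebra.leftMulMatrix e (algebraMap F K (A.val a a')) b b'
    rw [AlgHom.commutes, Matrix.algebraMap_matrix_apply, Matrix.blockDiagonal_apply]
    simp
  rw [h2, ← TH_comp, hK (TH k f (i + 1) x), map_zero] at h1
  have := (smul_eq_zero.1 h1.symm).resolve_left (by simpa using hm)
  exact this

/-- injectivity of stabilization -/
def StabInj (k F κ : Type) [Field k] [Field F] [Fintype κ] [DecidableEq κ] (i : ℕ) : Prop :=
  ∀ x : Hm (1 : Representation k (Matrix κ κ F)ˣ k) i, TH k (glH F κ Unit) i x = 0 → x = 0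

/-- reindexing -/
def rI (F : Type) [Field F] {L L' : Type} [Fintype L] [DecidableEq L] [Fintype L'] [DecidableEq L']
    (e : L ≃ L') : (Matrix L L F)ˣ ≃* (Matrix L' L' F)ˣ :=
  Units.mapEquiv (Matrix.reindexAlgEquiv F F e).toMulEquiv

lemma rI_val {L' : Type} [Fintype L'] [DecidableEq L'] (e : L ≃ L') (g) :
    (rI F e g).val = g.val.submatrix e.symm e.symm := rfl

lemma StabInj.congr {L' : Type} [Fintype L'] [DecidableEq L'] (e : L ≃ L') {i : ℕ}
    (h : StabInj k F L' i) : StabInj k F L i := by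
  intro x hx
  have h1 : (glH F L' Unit).comp (rI F e).toMonoidHom
      = (rI F (e.sumCongr (Equiv.refl Unit))).toMonoidHom.comp (glH F L Unit) := by
    ext A : 2
    show (glH F L' Unit (rI F e A)).val = (rI F (e.sumCongr (Equiv.refl Unit)) (glH F L Unit A)).val
    rw [rI_val, glH_val, glH_val, rI_val]
    ext (a | a) (b | b) <;> simp [Matrix.one_apply]
  apply TH_equiv_inj (rI F e)
  apply h
  rw [TH_comp, h1, ← TH_comp, hx, map_zero]

lemma glH_assoc (A : (Matrix L L F)ˣ) :
    (rI F (Equiv.sumAssoc L J Unit) (glH F (L ⊕ J) Unit (glH F L J A))).val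
      = (glH F L (J ⊕ Unit) A).val := by
  rw [rI_val, glH_val, glH_val, glH_val]
  ext (a | a | a) (b | b | b) <;> simp [Matrix.one_apply]

lemma stab_iter {i n : ℕ} (h : ∀ (κ : Type) [Fintype κ] [DecidableEq κ], n ≤ Fintype.card κ →
    StabInj k F κ i) (hn : n ≤ Fintype.card L) (r : ℕ) (x) (hx : TH k (glH F L (Idx r)) i x = 0) : x = 0 := by
  induction r with
  | zero =>
    let f : (Matrix (L ⊕ Idx 0) (L ⊕ Idx 0) F)ˣ ≃* (Matrix L L F)ˣ :=
      rI F (Equiv.sumEmpty L Empty)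
    have := congrArg (TH k f.toMonoidHom i) hx
    rw [TH_comp, map_zero] at this
    have h1 : f.toMonoidHom.comp (glH F L (Idx 0)) = MonoidHom.id _ := by
      ext A : 2
      rfl
    rwa [h1, TH_id] at this
  | succ r ih =>
    apply ih
    apply h
    · rw [Fintype.card_sum]; omega
    let f : (Matrix ((L ⊕ Idx r) ⊕ Unit) ((L ⊕ Idx r) ⊕ Unit) F)ˣ ≃*
      (Matrix (L ⊕ Idx (r + 1)) (L ⊕ Idx (r + 1)) F)ˣ := rI F (Equiv.sumAssoc L (Idx r) Unit)
    apply TH_equiv_inj f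
    rw [TH_comp, TH_comp]
    have h1 : (f.toMonoidHom.comp (glH F (L ⊕ Idx r) Unit)).comp (glH F L (Idx r))
        = glH F L (Idx (r + 1)) := by
      ext A : 2
      exact glH_assoc (J := Idx r) A
    rw [h1, hx]

theorem II_step [Fintype F] {K : Type} [Field K] [Fintype K] [Algebra F K] {m : ℕ}
    (e : Module.Basis (Fin (m + 1)) F K) (hm : ((m + 1 : ℕ) : k) ≠ 0) (i : ℕ)
    (hlow : ∀ b, 0 < b → b < i + 1 → GV k F L b) (hK : GV k K L (i + 1))
    (h : ∀ (κ : Type) [Fintype κ] [DecidableEq κ], Fintype.card L ≤ Fintype.card κ →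
      StabInj k F κ (i + 1)) : GV k F L (i + 1) := by
  intro x
  have h1 := emb_zero e hm i hlow hK 0 x
  apply stab_iter h le_rfl (Fintype.card (L × Fin m))
  let E0 : Idx (Fintype.card (L × Fin m)) ≃ L × Fin m := Fintype.equivOfCardEq (Idx.card _)
  let E : L ⊕ Idx (Fintype.card (L × Fin m)) ≃ L × Fin (m + 1) :=
    { toFun := Sum.elim (fun a => (a, 0)) (fun b => ((E0 b).1, (E0 b).2.succ))
      invFun := fun x => Fin.cases (Sum.inl x.1) (fun j => Sum.inr (E0.symm (x.1, j))) x.2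
      left_inv := by
        rintro (a | a) <;> simp
      right_inv := by
        rintro ⟨a, b⟩
        refine Fin.cases ?_ (fun j => ?_) b <;> simp }
  have h2 : (rI F E).toMonoidHom.comp (glH F L _) = dB F L (Fin (m + 1)) {0} := by
    ext A : 2
    show (rI F E (glH F L _ A)).val = _
    rw [rI_val, glH_val, dB_val]
    ext a b
    obtain ⟨a, rfl⟩ := E.surjective a
    obtain ⟨b, rfl⟩ := E.surjective b
    rw [Matrix.submatrix_apply, Equiv.symm_apply_apply, Equiv.symm_apply_apply]
    rcases a with a | a <;> rcases b with b | b <;>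
      simp [E, Matrix.blockDiagonal_apply, Matrix.one_apply, Fin.succ_ne_zero]
    · intro hh
      exact absurd hh.symm (Fin.succ_ne_zero _)
    · by_cases hab : a = b
      · subst hab; simp
      · rw [if_neg hab]
        have : ¬ ((E0 a).1 = (E0 b).1 ∧ (E0 a).2 = (E0 b).2) := fun hh =>
          hab (E0.injective (Prod.ext hh.1 hh.2))
        by_cases h3 : (E0 a).1 = (E0 b).1 <;> by_cases h4 : (E0 a).2 = (E0 b).2 <;>
          simp [h3, h4]
        exact this ⟨h3, h4⟩
  apply TH_equiv_inj (rI F E)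
  rw [TH_comp, h2, h1]

end c

end SpH


namespace SpH

set_option linter.unusedSectionVars false
set_option linter.unusedSimpArgs false
set_option linter.style.haveILetI false

open Finsupp
open scoped Matrix

section abs

variable {k : Type} [Field k] {G : Type} [Group G] [Fintype G]
variable {X : Type} [Fintype X] [MulAction G X] {Y : Type} [Fintype Y] [MulAction G Y]
variable {H : Type} [Group H]

lemma pt_compat (g : H →* G) (x : X) (h : ∀ s, g s • x = x) :
    Compat (1 : Representation k H k) (yRep X (1 : Representation k G k)) g (Finsupp.lsingle x) :=
  sh_compat g x h (1 : Representation k G k)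

lemma pt_conj (g : H →* G) (x x' : X) (h : ∀ s, g s • x = x) (h' : ∀ s, g s • x' = x') (w : G)
    (hw : ∀ s, w * g s = g s * w) (hx : w • x = x') (n : ℕ) (z) :
    Hmap g (Finsupp.lsingle x') (pt_compat (k := k) g x' h') n z
      = Hmap g (Finsupp.lsingle x) (pt_compat g x h) n z := by
  have := inner_triv n (yRep X (1 : Representation k G k)) w
    (Hmap g (Finsupp.lsingle x) (pt_compat g x h) n z)
  rw [Hmap_comp] at this
  refine Eq.trans ?_ this
  refine Hmap_congr _ _ ?_ ?_ _ _
  · ext s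
    simp [hw]
  · ext
    simp [hx]

lemma map_compat (f : Y → X) (hf : ∀ (g : G) y, f (g • y) = g • f y) :
    Compat (yRep Y (1 : Representation k G k)) (yRep X (1 : Representation k G k)) (MonoidHom.id G)
      (Finsupp.lmapDomain k k f) := by
  intro g v
  induction v using Finsupp.induction_linear with
  | zero => simp
  | add x y hx hy => simp only [map_add, hx, hy]
  | single x a => simp [hf, Finsupp.mapDomain_single]

lemma map_pt (f : Y → X) (hf : ∀ (g : G) y, f (g • y) = g • f y) (g : H →* G) (y : Y)
    (h : ∀ s, g s • y = y) (h' : ∀ s, g s • f y = f y) (n : ℕ) (z) :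
    Hmap (MonoidHom.id G) _ (map_compat (k := k) f hf) n
      (Hmap g (Finsupp.lsingle y) (pt_compat g y h) n z)
      = Hmap g (Finsupp.lsingle (f y)) (pt_compat g (f y) h') n z := by
  rw [Hmap_comp]
  refine Hmap_congr _ _ ?_ ?_ _ _
  · ext s; rfl
  · ext; simp [Finsupp.mapDomain_single]

/-- sum over fibers -/
noncomputable def fibMap (k : Type) [Field k] [DecidableEq X] (f : Y → X) : (X →₀ k) →ₗ[k] (Y →₀ k) :=
  Finsupp.lsum k fun x => ∑ y with f y = x, Finsupp.lsingle y

lemma fibMap_single [DecidableEq X] (f : Y → X) (x a) :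
    fibMap k f (single x a) = ∑ y with f y = x, single y a := by
  simp [fibMap]

lemma fib_compat [DecidableEq X] (f : Y → X) (hf : ∀ (g : G) y, f (g • y) = g • f y) :
    Compat (yRep X (1 : Representation k G k)) (yRep Y (1 : Representation k G k)) (MonoidHom.id G)
      (fibMap k f) := by
  intro g v
  induction v using Finsupp.induction_linear with
  | zero => simp
  | add x y hx hy => simp only [map_add, hx, hy]
  | single x a =>
    rw [yRep_single, fibMap_single, fibMap_single, map_sum]
    simp only [yRep_single, MonoidHom.id_apply]
    refine Finset.sum_bij' (fun y _ => g⁻¹ • y) (fun y _ => g • y) ?_ ?_ ?_ ?_ ?_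
    · intro y hy; simp [hf] at hy ⊢; rw [hy]; simp
    · intro y hy; simp [hf] at hy ⊢; rw [hy]
    · intro y hy; simp
    · intro y hy; simp
    · intro y hy; simp

theorem abs_stab [DecidableEq X] {H₁ H₂ T : Type} [Group H₁] [Group H₂] [Fintype T]
    (hT : (Fintype.card T : k) = -1)
    (f₁ f₂ : Y → X) (hf₁ : ∀ (g : G) y, f₁ (g • y) = g • f₁ y)
    (hf₂ : ∀ (g : G) y, f₂ (g • y) = g • f₂ y)
    (sc : T → X → X) (hsc : ∀ t (g : G) x, sc t (g • x) = g • sc t x)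
    (h1 : ∀ x, ((Finset.univ.filter fun y => f₁ y = x).card : k) = 0)
    (h2 : ∀ x, ∑ y with f₁ y = x, (single (f₂ y) 1 : X →₀ k)
      = ∑ x', single x' 1 - ∑ t, single (sc t x) 1)
    (i : ℕ) (g₂ : H₂ →* G) (y₀ : Y) (hg₂ : ∀ s, g₂ s • y₀ = y₀)
    (hsurj : ∀ v, ∃ z, v = Hmap g₂ (Finsupp.lsingle y₀) (pt_compat (k := k) g₂ y₀ hg₂) i z)
    (w₂ : G) (hw₂ : ∀ s, w₂ * g₂ s = g₂ s * w₂) (hw₂' : w₂ • f₁ y₀ = f₂ y₀)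
    (g₁ : H₁ →* G) (x₀ : X) (hg₁ : ∀ s, g₁ s • x₀ = x₀)
    (hw₁ : ∀ t, ∃ w : G, (∀ s, w * g₁ s = g₁ s * w) ∧ w • x₀ = sc t x₀)
    (z : Hm (1 : Representation k H₁ k) i) (hz : TH k g₁ i z = 0) :
    Hmap g₁ (Finsupp.lsingle x₀) (pt_compat (k := k) g₁ x₀ hg₁) i z = 0 := by
  obtain ⟨x', hx'⟩ : ∃ x', x' = Hmap g₁ (Finsupp.lsingle x₀) (pt_compat (k := k) g₁ x₀ hg₁) i z :=
    ⟨_, rfl⟩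
  rw [← hx']
  have e0 : ∀ v : Hm (yRep Y (1 : Representation k G k)) i,
      Hmap (MonoidHom.id G) _ (map_compat (k := k) f₁ hf₁) i v
      = Hmap (MonoidHom.id G) _ (map_compat (k := k) f₂ hf₂) i v := by
    intro v
    obtain ⟨z, rfl⟩ := hsurj v
    have hh1 : ∀ s, g₂ s • f₁ y₀ = f₁ y₀ := fun s => by rw [← hf₁, hg₂]
    have hh2 : ∀ s, g₂ s • f₂ y₀ = f₂ y₀ := fun s => by rw [← hf₂, hg₂]
    rw [map_pt f₁ hf₁ g₂ y₀ hg₂ hh1, map_pt f₂ hf₂ g₂ y₀ hg₂ hh2]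
    exact (pt_conj g₂ _ _ hh1 hh2 w₂ hw₂ hw₂' i z).symm
  have e1 := e0 (Hmap (MonoidHom.id G) _ (fib_compat f₁ hf₁) i x')
  rw [Hmap_comp, Hmap_comp] at e1
  have e2 : (Finsupp.lmapDomain k k f₁) ∘ₗ fibMap k f₁ = 0 := by
    ext x : 2
    simp only [LinearMap.comp_apply, lsingle_apply, fibMap_single, map_sum, lmapDomain_apply,
      mapDomain_single]
    rw [Finset.sum_congr rfl (g := fun _ => single x (1 : k)) (fun y hy => by
      rw [(Finset.mem_filter.1 hy).2]), Finset.sum_const, ← Nat.cast_smul_eq_nsmul k, h1, zero_smul]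
    rfl
  rw [Hmap_zero_φ _ e2] at e1
  let S := ∑ t : T, Finsupp.lmapDomain k k (sc t)
  have c1 : ∀ t, Compat (yRep X (1 : Representation k G k)) (yRep X (1 : Representation k G k))
      (MonoidHom.id G) (Finsupp.lmapDomain k k (sc t)) := fun t => map_compat (sc t) (hsc t)
  have c2 : Compat (yRep X (1 : Representation k G k)) (yRep X (1 : Representation k G k))
      (MonoidHom.id G) S := by
    intro g v
    simp only [S, LinearMap.sum_apply, map_sum]
    exact Finset.sum_congr rfl fun t _ => c1 t g v
  have c3 : Compat (yRep X (1 : Representation k G k)) (yRep X (1 : Representation k G k))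
      ((MonoidHom.id G).comp (MonoidHom.id G)) (yNorm k X ∘ₗ yAug k X) :=
    Compat.comp (yNorm_compat _) (yAug_compat _)
  have e3 : yNorm k X ∘ₗ yAug k X = Finsupp.lmapDomain k k f₂ ∘ₗ fibMap k f₁ + S := by
    ext x : 2
    simp only [LinearMap.comp_apply, lsingle_apply, fibMap_single, map_sum, lmapDomain_apply,
      mapDomain_single, LinearMap.add_apply, S, LinearMap.sum_apply, yAug_single, yNorm]
    rw [h2]
    simp
  have e4 := Hmap_add_φ (Compat.comp (map_compat f₂ hf₂) (fib_compat f₁ hf₁)) c2 c3 e3 i x'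
  rw [← e1, zero_add, ← Hmap_comp (yNorm_compat _) (yAug_compat _)] at e4
  have e5 : Hmap (MonoidHom.id G) _ (yAug_compat (1 : Representation k G k)) i x' = 0 := by
    rw [hx', Hmap_comp, ← hz]
    refine Hmap_congr _ _ rfl ?_ _ _
    ext; simp
  rw [e5, map_zero] at e4
  have e6 := Hmap_sum_φ Finset.univ c1 c2 rfl i x'
  have e7 : ∀ t, Hmap (MonoidHom.id G) _ (c1 t) i x' = x' := by
    intro t
    obtain ⟨w, hw, hw'⟩ := hw₁ t
    have hh : ∀ s, g₁ s • sc t x₀ = sc t x₀ := fun s => by rw [← hsc, hg₁]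
    rw [hx']
    refine (map_pt (sc t) (hsc t) g₁ x₀ hg₁ hh i z).trans ?_
    exact pt_conj g₁ _ _ hg₁ hh w hw hw' i z
  rw [Finset.sum_congr rfl (fun t _ => e7 t), Finset.sum_const, Finset.card_univ,
    ← Nat.cast_smul_eq_nsmul k, hT, neg_one_smul] at e6
  have e8 := e4.trans e6
  exact neg_eq_zero.1 e8.symm

end abs

end SpH


namespace SpH

set_option linter.unusedSectionVars false
set_option linter.unusedSimpArgs false
set_option linter.style.haveILetI false

open Finsupp
open scoped Matrix

/-- trivial equivariant representation -/
def trivER (k : Type) [Field k] {𝓜 G : Type} [Monoid 𝓜] [Group G] (θ : Act 𝓜 G) : EqRep k θ k :=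
  ⟨1, 1, fun _ _ _ => rfl⟩

section surj

variable {k : Type} [Field k] {G N : Type} [Group G] [Group N] [Fintype G] [Fintype N]

theorem semi_surj (α : Act G N) (i : ℕ)
    (h : ∀ a b, a + (b + 1) = i → ∀ w : Hm ((trivER k α).op (b + 1)) a, w = 0)
    (v : Hm (1 : Representation k (Semi α) k) i) :
    TH k (SemidirectProduct.inr.comp SemidirectProduct.rightHom) i v = v := by
  let θ₁ : Act (ZMod 2) N := Act.zt N
  let θ₂ : Act (ZMod 2) G := Act.triv (ZMod 2) G
  have hα : ∀ q a b, θ₁ q (α b a) = α (θ₂ q b) (θ₁ q a) := by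
    intro q a b
    by_cases hq : q = 0
    · subst hq
      show (1 : N) = α b 1
      rw [map_one]
    · have : θ₁ q = MonoidHom.id N := if_neg hq
      rw [this]; rfl
  let S := Split.semi α θ₁ θ₂ hα
  let X : EqRep k (Act.semi α θ₁ θ₂ hα) k := ⟨1, 1, fun _ _ _ => rfl⟩
  let z : MonoidAlgebra k (ZMod 2) := MonoidAlgebra.of k (ZMod 2) 0
  have hz : z * z = z := by
    simp only [z, ← map_mul]; rfl
  have hε : (1 - z) * (1 - z) = 1 - z := by
    simp only [mul_sub, sub_mul, mul_one, one_mul, hz]; abel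
  have key := S.kills hε i X (by
    intro a b hab
    rcases b with _ | b
    · intro v
      rw [map_sub, LinearMap.sub_apply, map_one, asAlg_of, Module.End.one_apply, sub_eq_zero]
      symm
      rw [EqRep.op_apply]
      refine (Hmap_congr _ (Compat.id _) ?_ ?_ _ _).trans (Hmap_id _ _ _)
      · rfl
      · ext y
        obtain ⟨m, rfl⟩ := toH0_surj _ y
        exact Hmap_toH0 _ _ ((S.res X).compat 0) m
    · intro v
      have h1 : ∀ w : Hm (S.HN X (b + 1)).ρ a, w = 0 := h a b hab
      exact h1 _)
  have k1 := key v
  rw [map_sub, LinearMap.sub_apply, map_one, asAlg_of, Module.End.one_apply, sub_eq_zero,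
    EqRep.op_apply] at k1
  refine Eq.trans ?_ k1.symm
  refine Hmap_congr _ _ ?_ rfl _ _
  ext x <;> rfl

end surj

section U

variable {k : Type} [Field k] {F κ J : Type} [Field F] [Fintype F] [Fintype κ] [DecidableEq κ]
  [Fintype J] [DecidableEq J] {M : Type} [AddCommGroup M] [Module k M]

theorem U_deg (hq : (Fintype.card F : k) = 0) (hq2 : Fintype.card F ≠ 2)
    (X : EqRep k (mAct F κ J) M) (d : ℕ) (hd : DegLt (Drep X.τ) d) (b : ℕ) :
    DegLt (Drep (X.op b)) (d + b) := by
  let θ' : Act (κ → F) (Multiplicative (Matrix κ J F)) :=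
    piAct (J → F) (fun i : κ => Pi.evalMonoidHom (fun _ => F) i)
  have h : ∀ q, θ' q = mAct F κ J (diagH F κ q) := by
    intro q
    refine MonoidHom.ext fun B => congrArg Multiplicative.ofAdd ?_
    ext i j
    show q i • Multiplicative.toAdd B i j = (Matrix.diagonal q * Multiplicative.toAdd B) i j
    rw [Matrix.diagonal_mul]; rfl
  have h1 := DegBound.std (k := k) (ι := κ) hq hq2 (J → F) _ (X.restr (diagH F κ) θ' h) d hd b
  have h2 := X.restr_op (diagH F κ) θ' h b
  rw [one_mul] at h1
  have h3 : DegLt ((X.op b).comp (diagH F κ)) (d + b) := by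
    rw [← h2]; exact h1
  exact h3

lemma mAct_zero : mAct F κ J 0 = 1 :=
  MonoidHom.ext fun _ => congrArg Multiplicative.ofAdd (Matrix.zero_mul _)

theorem U_red (X : EqRep k (mAct F κ J) M) (b : ℕ) (x) : X.op (b + 1) 0 x = 0 := by
  rw [EqRep.op_apply]
  exact Hmap_one _ mAct_zero _ _

theorem aff_surj (hq : (Fintype.card F : k) = 0) (hq2 : Fintype.card F ≠ 2) (i : ℕ)
    (hV : ∀ a b, a + (b + 1) = i → ∀ (T : Type) [AddCommGroup T] [Module k T]
      (τ : Representation k (Matrix κ κ F) T), DegLt (Drep τ) (b + 2) → (∀ x, τ 0 x = 0) →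
      ∀ x : Hm (GLrep τ) a, x = 0)
    (v : Hm (1 : Representation k (Semi (gAct F κ J)) k) i) :
    TH k (SemidirectProduct.inr.comp SemidirectProduct.rightHom) i v = v := by
  apply semi_surj
  intro a b hab
  have h1 : (trivER k (gAct F κ J)).op (b + 1) = GLrep ((trivER k (mAct F κ J)).op (b + 1)) :=
    (trivER k (mAct F κ J)).restr_op (Units.coeHom _) (gAct F κ J) (fun _ => rfl) (b + 1)
  have h2 : DegLt (Drep ((trivER k (mAct F κ J)).op (b + 1))) (b + 2) :=
    (U_deg (J := J) hq hq2 (trivER k (mAct F κ J)) 1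
      (DegLt.triv hq _ (fun q m => rfl)) (b + 1)).mono (by omega)
  have h3 := hV a b hab _ ((trivER k (mAct F κ J)).op (b + 1)) h2 (U_red _ b)
  exact Hm_congr h1 h3

end U

end SpH


namespace SpH

set_option linter.unusedSectionVars false
set_option linter.unusedSimpArgs false
set_option linter.style.haveILetI false

open Finsupp
open scoped Matrix

section vec

variable {k : Type} [Field k] {F L : Type} [Field F] [Fintype F] [Fintype L] [DecidableEq L]

/-- vectors -/
def mkX (v : L → F) (h : v ≠ 0) : XX F L Unit := ⟨fun _ => v, linearIndependent_unique_iff.2 h⟩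

lemma XX_ne (x : XX F L Unit) : x.1 () ≠ 0 := linearIndependent_unique_iff.1 x.2

lemma XX_ext {J : Type} {x y : XX F L J} (h : ∀ j, x.1 j = y.1 j) : x = y := Subtype.ext (funext h)

lemma XX_card [Nonempty L] (hq : (Fintype.card F : k) = 0) :
    (Fintype.card (XX F L Unit) : k) = -1 := by
  classical
  let e : XX F L Unit ≃ {v : L → F // v ≠ 0} :=
    { toFun := fun x => ⟨x.1 (), XX_ne x⟩
      invFun := fun v => mkX v.1 v.2
      left_inv := fun x => XX_ext fun _ => rfl
      right_inv := fun v => rfl }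
  have h1 : Fintype.card (XX F L Unit) + 1 = Fintype.card F ^ Fintype.card L := by
    rw [Fintype.card_congr e, Fintype.card_subtype_compl, Fintype.card_subtype_eq, Fintype.card_fun]
    exact Nat.sub_add_cancel (Nat.pos_of_ne_zero (pow_ne_zero _ Fintype.card_ne_zero))
  have h2 := congrArg (Nat.cast (R := k)) h1
  push_cast at h2
  rw [hq, zero_pow Fintype.card_ne_zero] at h2
  exact eq_neg_of_add_eq_zero_left h2

lemma units_card (hq : (Fintype.card F : k) = 0) [Fintype Fˣ] : (Fintype.card Fˣ : k) = -1 := by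
  classical
  have h1 : Fintype.card Fˣ + 1 = Fintype.card F := by
    rw [Fintype.card_eq_card_units_add_one (α := F)]
    congr!
  have h2 := congrArg (Nat.cast (R := k)) h1
  push_cast at h2
  rw [hq] at h2
  exact eq_neg_of_add_eq_zero_left h2

/-- projections -/
def pr₁ (y : XX F L (Unit ⊕ Unit)) : XX F L Unit :=
  mkX (y.1 (Sum.inr ())) (y.2.ne_zero _)

/-- projections -/
def pr₂ (y : XX F L (Unit ⊕ Unit)) : XX F L Unit :=
  mkX (y.1 (Sum.inl ())) (y.2.ne_zero _)

/-- scaling -/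
def scX (t : Fˣ) (x : XX F L Unit) : XX F L Unit :=
  mkX (t.val • x.1 ()) (smul_ne_zero t.ne_zero (XX_ne x))

lemma pr₁_smul (g : (Matrix L L F)ˣ) (y : XX F L (Unit ⊕ Unit)) : pr₁ (g • y) = g • pr₁ y := rfl
lemma pr₂_smul (g : (Matrix L L F)ˣ) (y : XX F L (Unit ⊕ Unit)) : pr₂ (g • y) = g • pr₂ y := rfl
lemma scX_smul (t : Fˣ) (g : (Matrix L L F)ˣ) (y : XX F L Unit) : scX t (g • y) = g • scX t y := by
  refine XX_ext fun j => ?_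
  exact (Matrix.smul_vecMul _ _ _).symm

lemma pair_ex (x x' : XX F L Unit) :
    (∃ y, pr₁ y = x ∧ pr₂ y = x') ↔ ¬ ∃ t, scX t x = x' := by
  constructor
  · rintro ⟨y, rfl, rfl⟩ ⟨t, ht⟩
    have h := congrFun (congrArg Subtype.val ht) ()
    have h : t.val • y.1 (Sum.inr ()) = y.1 (Sum.inl ()) := h
    have := Fintype.linearIndependent_iff.1 y.2 (Sum.elim (fun _ => -1) (fun _ => t.val)) (by
      simp [Fintype.sum_sum_type, h]) (Sum.inl ())
    simp at this
  · intro h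
    refine ⟨⟨Sum.elim (fun _ => x'.1 ()) (fun _ => x.1 ()), ?_⟩, XX_ext fun _ => rfl, XX_ext fun _ => rfl⟩
    rw [Fintype.linearIndependent_iff]
    intro g hg
    simp only [Fintype.sum_sum_type, Finset.univ_unique, Finset.sum_singleton, Sum.elim_inl,
      Sum.elim_inr] at hg
    have h0 : g (Sum.inl ()) = 0 := by
      by_contra hne
      apply h
      have hx : x'.1 () = (-(g (Sum.inl ()))⁻¹ * g (Sum.inr ())) • x.1 () := by
        have h1 := congrArg (fun v => (g (Sum.inl ()))⁻¹ • v) hg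
        simp only [smul_add, smul_smul, smul_zero] at h1
        have h2 : (g (Sum.inl ()))⁻¹ * g (Sum.inl default) = 1 := inv_mul_cancel₀ hne
        rw [h2, one_smul] at h1
        rw [neg_mul, neg_smul]
        exact eq_neg_of_add_eq_zero_left h1
      have hne' : (-(g (Sum.inl ()))⁻¹ * g (Sum.inr ())) ≠ 0 := by
        intro h0
        rw [h0, zero_smul] at hx
        exact XX_ne x' hx
      exact ⟨Units.mk0 _ hne', XX_ext fun _ => hx.symm⟩
    have h1 : g (Sum.inr ()) = 0 := by
      have h2 : g (Sum.inl default) = 0 := h0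
      rw [h2, zero_smul, zero_add] at hg
      exact (smul_eq_zero.1 hg).resolve_right (XX_ne x)
    rintro (⟨⟩ | ⟨⟩)
    · exact h0
    · exact h1

lemma fib_sum [DecidableEq (XX F L Unit)] [Fintype Fˣ] {A : Type} [AddCommGroup A]
    (c : XX F L Unit → A) (x : XX F L Unit) :
    ∑ y with pr₁ y = x, c (pr₂ y) = ∑ x', c x' - ∑ t, c (scX t x) := by
  classical
  rw [eq_sub_iff_add_eq, ← Finset.sum_filter_add_sum_filter_not Finset.univ
    (fun x' => ∃ y, pr₁ y = x ∧ pr₂ y = x')]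
  congr 1
  · refine Finset.sum_bij (fun y _ => pr₂ y) ?_ ?_ ?_ ?_
    · intro y hy
      simp only [Finset.mem_filter, Finset.mem_univ, true_and] at hy ⊢
      exact ⟨y, hy, rfl⟩
    · intro y hy y' hy' h
      simp only [Finset.mem_filter, Finset.mem_univ, true_and] at hy hy'
      have h1 := congrFun (congrArg Subtype.val (hy.trans hy'.symm)) ()
      have h2 := congrFun (congrArg Subtype.val h) ()
      refine XX_ext ?_
      rintro (⟨⟩ | ⟨⟩)
      · exact h2
      · exact h1
    · intro x' hx'
      simp only [Finset.mem_filter, Finset.mem_univ, true_and] at hx'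
      obtain ⟨y, hy, hy'⟩ := hx'
      exact ⟨y, by simpa using hy, hy'⟩
    · intro y hy; rfl
  · refine Finset.sum_bij (fun t _ => scX t x) ?_ ?_ ?_ ?_
    · intro t _
      simp only [Finset.mem_filter, Finset.mem_univ, true_and, pair_ex, not_not]
      exact ⟨t, rfl⟩
    · intro t _ t' _ h
      have h2 := congrFun (congrArg Subtype.val h) ()
      exact Units.ext (smul_left_injective F (XX_ne x) h2)
    · intro x' hx'
      simp only [Finset.mem_filter, Finset.mem_univ, true_and, pair_ex, not_not] at hx'
      obtain ⟨t, ht⟩ := hx'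
      exact ⟨t, Finset.mem_univ _, ht⟩
    · intro t _; rfl

end vec

section stab

variable {k : Type} [Field k] {F κ : Type} [Field F] [Fintype F] [Fintype κ] [DecidableEq κ]

/-- block swap -/
def swM (F κ : Type) [Field F] [Fintype κ] [DecidableEq κ] :
    (Matrix (κ ⊕ (Unit ⊕ Unit)) (κ ⊕ (Unit ⊕ Unit)) F)ˣ :=
  ⟨Matrix.fromBlocks 1 0 0 (Matrix.fromBlocks 0 1 1 0),
    Matrix.fromBlocks 1 0 0 (Matrix.fromBlocks 0 1 1 0),
    by simp [Matrix.fromBlocks_multiply], by simp [Matrix.fromBlocks_multiply]⟩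

lemma sw_comm (A : (Matrix κ κ F)ˣ) :
    swM F κ * glH F κ (Unit ⊕ Unit) A = glH F κ (Unit ⊕ Unit) A * swM F κ := by
  apply Units.ext
  simp [glH_val, swM, Matrix.fromBlocks_multiply]

lemma sw_pt {L : Type} [Fintype L] [DecidableEq L] (e : κ ⊕ (Unit ⊕ Unit) ≃ L) :
    reH F e (swM F κ) • pr₁ (y0 F e) = pr₂ (y0 F e) := by
  rw [← eq_inv_smul_iff]
  refine XX_ext fun j => ?_
  rw [XX_smul, inv_inv]
  show Pi.single (e (Sum.inr (Sum.inr ()))) 1 = Pi.single (e (Sum.inr (Sum.inl ()))) 1 ᵥ* _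
  rw [Matrix.single_one_vecMul, reH_val]
  ext i
  obtain ⟨i, rfl⟩ := e.surjective i
  simp only [Matrix.row, Matrix.submatrix_apply, Equiv.symm_apply_apply, swM]
  rcases i with i | i | i <;> simp [Pi.single_apply]

theorem stab_inj (hq : (Fintype.card F : k) = 0) (hq2 : Fintype.card F ≠ 2) (i : ℕ)
    (hV : ∀ a b, a + (b + 1) = i → ∀ (T : Type) [AddCommGroup T] [Module k T]
      (τ : Representation k (Matrix κ κ F) T), DegLt (Drep τ) (b + 2) → (∀ x, τ 0 x = 0) →
      ∀ x : Hm (GLrep τ) a, x = 0) : StabInj k F (κ ⊕ Unit) i := by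
  classical
  intro z hz
  let e : κ ⊕ (Unit ⊕ Unit) ≃ (κ ⊕ Unit) ⊕ Unit := (Equiv.sumAssoc κ Unit Unit).symm
  let a₂ := (reH F e).toMonoidHom.comp (affH F κ (Unit ⊕ Unit))
  let g₂ := a₂.comp SemidirectProduct.inr
  have hg₂ : ∀ s, g₂ s • y0 F e = y0 F e := fun s => aff_stab e _
  have ha₂ : Function.Injective a₂ := (reH F e).injective.comp affH_inj
  have ha₁ : Function.Injective ((reH F (Equiv.refl ((κ ⊕ Unit) ⊕ Unit))).toMonoidHom.comp
    (affH F (κ ⊕ Unit) Unit)) := (reH F _).injective.comp affH_inj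
  have hg₁ : ∀ s, glH F (κ ⊕ Unit) Unit s • y0 F (Equiv.refl ((κ ⊕ Unit) ⊕ Unit))
      = y0 F (Equiv.refl _) := by
    intro s
    have := aff_stab (F := F) (Equiv.refl ((κ ⊕ Unit) ⊕ Unit)) (SemidirectProduct.inr s)
    have h2 : ((reH F (Equiv.refl ((κ ⊕ Unit) ⊕ Unit))).toMonoidHom.comp
      (affH F (κ ⊕ Unit) Unit)) (SemidirectProduct.inr s) = glH F (κ ⊕ Unit) Unit s := by
      apply Units.ext
      show (affH F (κ ⊕ Unit) Unit _).val = _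
      rw [affH_val]; rfl
    rw [h2] at this
    exact this
  have key := abs_stab (k := k) (T := Fˣ) (units_card hq) pr₁ pr₂ pr₁_smul pr₂_smul scX scX_smul
    (by
      intro x
      have := fib_sum (fun _ => (1 : k)) x
      simp only [Finset.sum_const, nsmul_eq_mul, mul_one, Finset.card_univ] at this
      rw [this, XX_card hq, units_card hq, sub_self])
    (fun x => fib_sum (fun x' => single x' (1 : k)) x) i g₂ (y0 F e) hg₂
    (by
      intro v
      obtain ⟨u, rfl⟩ := (shapiro a₂ (y0 F e) ha₂ (aff_stab e) (aff_stab' e) i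
        (1 : Representation k _ k)).2 v
      refine ⟨TH k SemidirectProduct.rightHom i u, ?_⟩
      have h1 := aff_surj (κ := κ) (J := Unit ⊕ Unit) hq hq2 i hV u
      have h2 := congrArg (Hmap a₂ (Finsupp.lsingle (y0 F e)) (sh_compat a₂ (y0 F e) (aff_stab e) (1 : Representation k _ k)) i) h1
      refine h2.symm.trans ?_
      rw [TH, Hmap_comp, TH, Hmap_comp]
      exact Hmap_congr _ _ rfl rfl _ _)
    (reH F e (swM F κ))
    (by
      intro s
      have h1 : g₂ s = reH F e (glH F κ (Unit ⊕ Unit) s) := by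
        refine congrArg (reH F e) (Units.ext ?_)
        rw [affH_val]; rfl
      rw [h1, ← map_mul, ← map_mul, sw_comm])
    (sw_pt e) (glH F (κ ⊕ Unit) Unit) (y0 F (Equiv.refl _)) hg₁
    (by
      intro t
      refine ⟨(tH F (κ ⊕ Unit) Unit t)⁻¹, ?_, ?_⟩
      · intro s
        rw [inv_mul_eq_iff_eq_mul, ← mul_assoc, eq_mul_inv_iff_mul_eq]
        apply Units.ext
        simp [glH_val, tH_val, Matrix.fromBlocks_multiply]
      · refine XX_ext fun j => ?_
        rw [XX_smul, inv_inv]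
        show Pi.single (Sum.inr ()) 1 ᵥ* _ = t.val • Pi.single (Sum.inr ()) 1
        rw [Matrix.single_one_vecMul, tH_val]
        ext i
        rcases i with i | i <;> simp [Matrix.row, Pi.single_apply])
    z hz
  have h3 : Hmap ((reH F (Equiv.refl ((κ ⊕ Unit) ⊕ Unit))).toMonoidHom.comp
      (affH F (κ ⊕ Unit) Unit)) _ (sh_compat _ _ (aff_stab (Equiv.refl _)) (1 : Representation k _ k)) i
        (TH k SemidirectProduct.inr i z) = 0 := by
    refine Eq.trans ?_ key
    rw [TH, Hmap_comp]
    refine Hmap_congr _ _ ?_ rfl _ _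
    ext s : 1
    apply Units.ext
    show (affH F (κ ⊕ Unit) Unit _).val = _
    rw [affH_val]; rfl
  have h4 := (shapiro _ (y0 F (Equiv.refl _)) ha₁ (aff_stab _) (aff_stab' _) i
        (1 : Representation k _ k)).1 (h3.trans (map_zero _).symm)
  have h5 := congrArg (TH k SemidirectProduct.rightHom i) h4
  rw [map_zero, TH_comp] at h5
  rw [← h5]
  exact (TH_id i z).symm
  
end stab

end SpH


namespace SpH

set_option linter.unusedSectionVars false
set_option linter.unusedSimpArgs false
set_option linter.style.haveILetI false

open Finsupp
open scoped Matrix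

section w

variable {k : Type} [Field k] {F κ : Type} [Field F] [Fintype F] [Fintype κ] [DecidableEq κ]
  {T : Type} [AddCommGroup T] [Module k T]

/-- extension of weights -/
def exw (w : κ → Fin 3) (c : Fin 3) : κ ⊕ Unit → Fin 3 := Sum.elim w (fun _ => c)

lemma wt_exw (w : κ → Fin 3) (c : Fin 3) : wt (exw w c) = wt w + c := by
  simp [wt, exw]

/-- extension by one -/
def exH (F κ : Type) [Field F] : (κ → F) →* (κ ⊕ Unit → F) where
  toFun t := Sum.elim t 1
  map_one' := by ext (i | i) <;> rfl
  map_mul' a b := by ext (i | i) <;> simp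

lemma exH_single (s : κ) (t : F) : exH F κ (Pi.mulSingle s t) = Pi.mulSingle (Sum.inl s) t := by
  ext (i | i)
  · by_cases h : i = s
    · subst h; simp [exH]
    · simp [exH, h, Pi.mulSingle_apply]
  · simp [exH, Pi.mulSingle_apply]

lemma asAlg_restr {A B : Type} [Monoid A] [Monoid B] (τ : Representation k B T) (f : A →* B)
    (x : MonoidAlgebra k A) :
    Representation.asAlgebraHom (τ.comp f : Representation k A T) x = τ.asAlgebraHom (MonoidAlgebra.mapDomainAlgHom k k f x) := by
  have : Representation.asAlgebraHom (τ.comp f : Representation k A T)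
      = τ.asAlgebraHom.comp (MonoidAlgebra.mapDomainAlgHom k k f) := by
    apply MonoidAlgebra.algHom_ext'
    · ext a : 1
      simp [Representation.asAlgebraHom_single]
    · exact Subsingleton.elim _ _
  rw [this]; rfl

lemma map_of {A B : Type} [Monoid A] [Monoid B] (f : A →* B) (a : A) :
    MonoidAlgebra.mapDomainAlgHom k k f (MonoidAlgebra.of k A a) = MonoidAlgebra.of k B (f a) := by
  simp [MonoidAlgebra.of]

lemma eS_ex (s : κ) (c : Fin 3) :
    MonoidAlgebra.mapDomainAlgHom k k (exH F κ) (eS k F s c) = eS k F (Sum.inl s) c := by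
  fin_cases c
  · exact map_one _
  · show MonoidAlgebra.mapDomainAlgHom k k (exH F κ) (eS k F s 1) = eS k F (Sum.inl s) 1
    rw [eS_one, eS_one, map_sub, map_one, map_of, exH_single]
  · show MonoidAlgebra.mapDomainAlgHom k k (exH F κ) (eS k F s 2) = eS k F (Sum.inl s) 2
    rw [eS_two, eS_two, map_neg, map_sum]
    simp only [map_of, exH_single]

lemma eW_ex (w : κ → Fin 3) :
    MonoidAlgebra.mapDomainAlgHom k k (exH F κ) (eW k F w) = eW k F (exw w 0) := by
  rw [eW, eW, map_prod, Fintype.prod_sum_type]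
  simp only [eS_ex, Finset.univ_unique, Finset.prod_singleton]
  have : eS k F (Sum.inr (default : Unit) : κ ⊕ Unit) (exw w 0 (Sum.inr default) : ℕ) = 1 := rfl
  rw [this, mul_one]
  rfl

lemma diag_ex (t : κ → F) : blk F κ Unit (diagH F κ t) = diagH F (κ ⊕ Unit) (exH F κ t) := by
  show Matrix.fromBlocks (Matrix.diagonal t) 0 0 1 = Matrix.diagonal (Sum.elim t 1)
  rw [← Matrix.diagonal_one, Matrix.fromBlocks_diagonal]
  congr 1

lemma tM_diag (t : F) : tM F κ Unit t = diagH F (κ ⊕ Unit) (Pi.mulSingle (Sum.inr ()) t) := by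
  rw [diagH_mulSingle]
  show Matrix.fromBlocks 1 0 0 (t • 1) = _
  ext (i | i) (j | j) <;> simp [EE, Matrix.one_apply, Matrix.single_apply]

lemma Drep_blk (τ : Representation k (Matrix (κ ⊕ Unit) (κ ⊕ Unit) F) T) (x) :
    (Drep (τ.comp (blk F κ Unit))).asAlgebraHom x
     = (Drep τ).asAlgebraHom (MonoidAlgebra.mapDomainAlgHom k k (exH F κ) x) := by
  rw [← asAlg_restr]
  have : Drep (τ.comp (blk F κ Unit)) = (Drep τ).comp (exH F κ) := by
    refine MonoidHom.ext fun t => ?_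
    show τ (blk F κ Unit (diagH F κ t)) = τ (diagH F (κ ⊕ Unit) (exH F κ t))
    rw [diag_ex]
  rw [this]

lemma eW_exw (w : κ → Fin 3) (c : Fin 3) :
    eW k F (exw w c) = eS k F (Sum.inr () : κ ⊕ Unit) c * eW k F (exw w 0) := by
  rw [eW_split (exw w c) (Sum.inr ())]
  congr 2
  ext (i | i)
  · simp [exw]
  · simp [exw]

lemma deg_blk {τ : Representation k (Matrix (κ ⊕ Unit) (κ ⊕ Unit) F) T} {D : ℕ}
    (hD : DegLt (Drep τ) D) : DegLt (Drep (τ.comp (blk F κ Unit))) D := by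
  intro w hw x
  rw [Drep_blk, eW_ex]
  exact hD _ (by rw [wt_exw]; exact hw) x

lemma deg_c {τ : Representation k (Matrix (κ ⊕ Unit) (κ ⊕ Unit) F) T} {D : ℕ}
    (hD : DegLt (Drep τ) D) (w : κ → Fin 3) (c : Fin 3) (h : D ≤ wt w + c) (x : T) :
    (Drep τ).asAlgebraHom (eS k F (Sum.inr () : κ ⊕ Unit) c)
      ((Drep (τ.comp (blk F κ Unit))).asAlgebraHom (eW k F w) x) = 0 := by
  rw [Drep_blk, eW_ex, ← Module.End.mul_apply, ← map_mul, ← eW_exw]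
  exact hD _ (by rw [wt_exw]; exact h) x

lemma deg_c' {τ : Representation k (Matrix (κ ⊕ Unit) (κ ⊕ Unit) F) T} {D : ℕ}
    (hD : DegLt (Drep τ) D) (w : κ → Fin 3) (c : Fin 3) (h : D ≤ wt w + c) (x : T) :
    (Drep (τ.comp (blk F κ Unit))).asAlgebraHom (eW k F w) 
    ((Drep τ).asAlgebraHom (eS k F (Sum.inr () : κ ⊕ Unit) c) x) = 0 := by
  rw [Drep_blk, eW_ex, ← Module.End.mul_apply, ← map_mul, mul_comm, ← eW_exw]
  exact hD _ (by rw [wt_exw]; exact h) x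

lemma sum_units [Fintype Fˣ] {A : Type} [AddCommMonoid A] (f : F → A) :
    ∑ t : F, f t = f 0 + ∑ t : Fˣ, f t := by
  classical
  rw [← Finset.add_sum_erase _ _ (Finset.mem_univ (0 : F))]
  congr 1
  refine Finset.sum_bij' (fun t ht => (Units.mk0 t (Finset.ne_of_mem_erase ht)))
    (fun t _ => t.val) ?_ ?_ ?_ ?_ ?_
  · intros; simp
  · intros; simp
  · intros; simp
  · intro t _; ext; simp
  · intro t ht; rfl

/-- degree bound on coinvariants of the unipotent radical -/
theorem deg_coinv (hq : (Fintype.card F : k) = 0)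
    (τ : Representation k (Matrix (κ ⊕ Unit) (κ ⊕ Unit) F) T) {D : ℕ}
    (hD : DegLt (Drep τ) (D + 2)) (hred : ∀ x, τ 0 x = 0)
    {Q : Type} [AddCommGroup Q] [Module k Q] (q : T →ₗ[k] Q)
    (hu : ∀ B x, q (τ (uM F κ Unit B) x) = q x)
    (ht : ∀ t : F, t ≠ 0 → ∀ x, q (τ (tM F κ Unit t) x) = q x) 
    (w : κ → Fin 3) (hw : D ≤ wt w) (σ : Q → Q)
    (hσ : ∀ x, q ((Drep (τ.comp (blk F κ Unit))).asAlgebraHom (eW k F w) x) = σ (q x)) (x : T) :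
    q ((Drep (τ.comp (blk F κ Unit))).asAlgebraHom (eW k F w) x) = 0 := by
  classical
  have hτ : ∀ A B x, τ (A * B) x = τ A (τ B x) := fun A B x => by
    rw [map_mul, Module.End.mul_apply]
  let e := τ (tM F κ Unit 0)
  have hcomm : ∀ v, e ((Drep (τ.comp (blk F κ Unit))).asAlgebraHom (eW k F w) v)
      = (Drep (τ.comp (blk F κ Unit))).asAlgebraHom (eW k F w) (e v) := by
    intro v
    have he : e = (Drep τ).asAlgebraHom (MonoidAlgebra.of k _ (Pi.mulSingle (Sum.inr ()) 0)) := by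
      ext v
      rw [asAlg_of]
      show _ = τ (diagH F (κ ⊕ Unit) _) v
      rw [← tM_diag]
    rw [he, Drep_blk, ← Module.End.mul_apply, ← Module.End.mul_apply, ← map_mul, ← map_mul, mul_comm]
  -- first case
  have key1 : ∀ y, e y = 0 → q ((Drep (τ.comp (blk F κ Unit))).asAlgebraHom (eW k F w) y) = 0 := by
    intro y hy
    set v := (Drep (τ.comp (blk F κ Unit))).asAlgebraHom (eW k F w) y with hv
    have hev : e v = 0 := by rw [hv, hcomm, hy, map_zero]
    have h1 := deg_c hD w 2 (by simpa using hw) y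
    rw [← hv] at h1
    have h2 : (Drep τ).asAlgebraHom (eS k F (Sum.inr () : κ ⊕ Unit) ((2 : Fin 3) : ℕ)) v
        = - ∑ t : F, τ (tM F κ Unit t) v := by
      show (Drep τ).asAlgebraHom (eS k F (Sum.inr () : κ ⊕ Unit) 2) v = _
      rw [eS_two, map_neg, map_sum, LinearMap.neg_apply, LinearMap.sum_apply]
      congr 1
      refine Finset.sum_congr rfl fun t _ => ?_
      rw [asAlg_of, tM_diag]; rfl
    rw [h2] at h1
    have h3 := congrArg q h1
    rw [map_neg, map_sum, map_zero, neg_eq_zero, sum_units] at h3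
    have h4 : q (τ (tM F κ Unit 0) v) = 0 := by
      show q (e v) = 0
      rw [hev, map_zero]
    rw [h4, zero_add, Finset.sum_congr rfl (fun t _ => ht t.val t.ne_zero v), Finset.sum_const,
      Finset.card_univ, ← Nat.cast_smul_eq_nsmul k, units_card hq] at h3
    simpa using h3
  -- reduction
  let W : Submodule k T := LinearMap.ker e
  let p : T →ₗ[k] Q ⧸ (W.map q) := (W.map q).mkQ ∘ₗ q
  have hp : ∀ x, p x = 0 → ∃ y, e y = 0 ∧ q x = q y := by
    intro x hx
    have : q x ∈ W.map q := by
      simpa [p] using hx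
    obtain ⟨y, hy, hxy⟩ := this
    exact ⟨y, hy, hxy.symm⟩
  have hpW : ∀ y, e y = 0 → p y = 0 := by
    intro y hy
    have : q y ∈ W.map q := ⟨y, hy, rfl⟩
    simpa [p] using this
  have key2 : ∀ x, p x = 0 := by
    intro x
    have hee : ∀ v, e (e v) = e v := by
      intro v
      show τ _ (τ _ v) = _
      rw [← hτ, ← map_mul, mul_zero]
    have h1 : p x = p (e x) := by
      rw [← sub_eq_zero, ← map_sub]
      exact hpW _ (by rw [map_sub, hee, sub_self])
    rw [h1]
    refine expand (Drep (τ.comp (blk F κ Unit))) (p ∘ₗ e) ?_ ?_ x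
    · intro v
      have : e ((Drep (τ.comp (blk F κ Unit))) 0 v) = 0 := by
        show τ _ (τ (blk F κ Unit (Matrix.diagonal 0)) v) = 0
        rw [← hτ]
        have : tM F κ Unit 0 * blk F κ Unit (Matrix.diagonal 0) = 0 := by
          rw [tM_apply, blk_apply, Matrix.fromBlocks_multiply]
          simp
        rw [this, hred]
      rw [LinearMap.comp_apply, this, map_zero]
    · intro s v
      rw [LinearMap.comp_apply]
      let c : κ ⊕ Unit := Sum.inr ()
      let s' : κ ⊕ Unit := Sum.inl s
      have hsc : s' ≠ c := Sum.inl_ne_inr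
      have htM : tM F κ Unit 0 = 1 - EE c c := by
        rw [tM_diag, diagH_zero]
      have hZ : blk F κ Unit (diagH F κ (Pi.mulSingle s 0)) = 1 - EE s' s' := by
        rw [diag_ex, exH_single, diagH_zero]
      have hU : uM F κ Unit (Multiplicative.ofAdd (Matrix.single s () 1)) = 1 + EE s' c := by
        rw [uM_apply]
        ext (i | i) (j | j) <;> simp [EE, s', c, Matrix.one_apply, Matrix.single_apply]
      set x' := e (v - (Drep (τ.comp (blk F κ Unit))) (Pi.mulSingle s 0) v) with hx'
      let Z : Matrix (κ ⊕ Unit) (κ ⊕ Unit) F := 1 - EE s' s'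
      let C : Matrix (κ ⊕ Unit) (κ ⊕ Unit) F := 1 - EE c c
      have hx2 : x' = τ C v - τ C (τ Z v) := by
        rw [hx', map_sub]
        show τ _ v - τ _ (τ (blk F κ Unit (diagH F κ (Pi.mulSingle s 0))) v) = _
        rw [htM, hZ]
      have hCZ : Z * C = C * Z := by
        simp only [C, Z, mul_sub, sub_mul, mul_one, one_mul, EE_ne _ _ _ _ hsc,
          EE_ne _ _ _ _ hsc.symm]
        abel
      have hZZ : Z * Z = Z := by
        simp only [Z, mul_sub, sub_mul, mul_one, one_mul, EE_same]
        abel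
      have hCC : C * C = C := by
        simp only [C, mul_sub, sub_mul, mul_one, one_mul, EE_same]
        abel
      have hZx : τ Z x' = 0 := by
        rw [hx2, map_sub, ← hτ, ← hτ, ← hτ, hCZ, mul_assoc, hZZ, sub_self]
      have hCx : τ C x' = x' := by
        rw [hx2, map_sub, ← hτ, ← hτ, ← hτ, hCC, hτ]
      have hS : C * SW s' c = SW s' c * Z := by
        simp only [C, Z, SW, mul_add, add_mul, mul_sub, sub_mul, mul_one, one_mul, EE_same,
          EE_ne _ _ _ _ hsc, EE_ne _ _ _ _ hsc.symm]
        abel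
      have hS2 : C * ((1 + EE s' c) * (SW s' c * C)) = C := by
        simp only [C, SW, mul_add, add_mul, mul_sub, sub_mul, mul_one, one_mul, EE_same,
          EE_ne _ _ _ _ hsc, EE_ne _ _ _ _ hsc.symm, mul_zero]
        abel
      let z := τ (SW s' c) x'
      have hez : e z = 0 := by
        show τ (tM F κ Unit 0) (τ (SW s' c) x') = 0
        rw [htM]
        show τ C _ = 0
        rw [← hτ, hS, hτ, hZx, map_zero]
      let u := τ (1 + EE s' c) z
      have heu : e u = x' := by
        show τ (tM F κ Unit 0) (τ (1 + EE s' c) (τ (SW s' c) x')) = x'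
        rw [htM]
        show τ C _ = x'
        conv_lhs => rw [← hCx]
        rw [← hτ, ← hτ, ← hτ, mul_assoc, mul_assoc, hS2, hCx]
      have hqu : q u = q z := by
        have := hu (Multiplicative.ofAdd (Matrix.single s () 1)) z
        rw [hU] at this
        exact this
      have h5 : p u = p x' := by
        rw [← sub_eq_zero, ← map_sub]
        apply hpW
        rw [map_sub, ← heu, hee, sub_self]
      rw [← h5]
      show (W.map q).mkQ (q u) = 0
      rw [hqu]
      exact hpW z hez
  obtain ⟨y, hy, hxy⟩ := hp _ (key2 x)
  rw [hσ, hxy, ← hσ]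
  exact key1 y hy

end w

end SpH


namespace SpH

set_option linter.unusedSectionVars false
set_option linter.unusedSimpArgs false
set_option linter.style.haveILetI false

open Finsupp
open scoped Matrix

section quot

variable {k : Type} [Field k] {G : Type} [Group G] {M : Type} [AddCommGroup M] [Module k M]
  {𝓜 : Type} [Monoid 𝓜] {θ : Act 𝓜 G}

/-- quotient of an equivariant representation -/
def EqRep.quot (X : EqRep k θ M) (W : Submodule k M) (hρ : ∀ g, ∀ v ∈ W, X.ρ g v ∈ W)
    (hτ : ∀ q, ∀ v ∈ W, X.τ q v ∈ W) : EqRep k θ (M ⧸ W) where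
  ρ :=
    { toFun := fun g => W.mapQ W (X.ρ g) (hρ g)
      map_one' := by ext v; simp
      map_mul' := fun a b => by ext v; simp }
  τ :=
    { toFun := fun g => W.mapQ W (X.τ g) (hτ g)
      map_one' := by ext v; simp
      map_mul' := fun a b => by ext v; simp }
  comm q g v := by
    obtain ⟨v, rfl⟩ := W.mkQ_surjective v
    exact congrArg W.mkQ (X.comm q g v)

end quot

section w

variable {k : Type} [Field k] {F κ : Type} [Field F] [Fintype F] [Fintype κ] [DecidableEq κ]
  {T : Type} [AddCommGroup T] [Module k T]

lemma u_t0 (B) : uM F κ Unit B * tM F κ Unit 0 = tM F κ Unit 0 := by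
  rw [uM_apply, tM_apply, Matrix.fromBlocks_multiply]
  simp

lemma blk_t0 (A) : blk F κ Unit A * tM F κ Unit 0 = tM F κ Unit 0 * blk F κ Unit A := by
  rw [blk_apply, tM_apply, Matrix.fromBlocks_multiply, Matrix.fromBlocks_multiply]
  simp

theorem deg_one (hq : (Fintype.card F : k) = 0) (hq2 : Fintype.card F ≠ 2) [Fintype Fˣ]
    (τ : Representation k (Matrix (κ ⊕ Unit) (κ ⊕ Unit) F) T) {D : ℕ}
    (hD : DegLt (Drep τ) (D + 2)) (Y : EqRep k (mAct F κ Unit) T)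
    (hYρ : ∀ B v, Y.ρ B v = τ (uM F κ Unit B) v) (hYτ : Y.τ = τ.comp (blk F κ Unit))
    (hT : ∀ t : Fˣ, Compat Y.ρ Y.ρ (uAct F κ Unit t) (τ (tM F κ Unit t.val)))
    (w : κ → Fin 3) (hw : D + 2 ≤ wt w) (x : Hm Y.ρ 1) :
    ∑ t : Fˣ, Hmap (uAct F κ Unit t) (τ (tM F κ Unit t.val)) (hT t) 1
      ((Drep (Y.op 1)).asAlgebraHom (eW k F w) x) = 0 := by
  classical
  have hτ : ∀ A B x, τ (A * B) x = τ A (τ B x) := fun A B x => by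
    rw [map_mul, Module.End.mul_apply]
  obtain ⟨e, he⟩ : ∃ e, e = τ (tM F κ Unit 0) := ⟨_, rfl⟩
  let W : Submodule k T := LinearMap.range e
  have hWu : ∀ B, ∀ v ∈ W, Y.ρ B v = v := by
    rintro B _ ⟨v, rfl⟩
    rw [hYρ, he, ← hτ, u_t0]
  have hWt : ∀ t, ∀ v ∈ W, τ (tM F κ Unit t) v = v := by
    rintro t _ ⟨v, rfl⟩
    rw [he, ← hτ, ← map_mul, mul_zero]
  have hWb : ∀ A, ∀ v ∈ W, Y.τ A v ∈ W := by
    rintro A _ ⟨v, rfl⟩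
    refine ⟨Y.τ A v, ?_⟩
    rw [hYτ, he]
    show τ _ (τ _ v) = τ _ (τ _ v)
    rw [← hτ, ← hτ, blk_t0]
  have hWρ : ∀ B, ∀ v ∈ W, Y.ρ B v ∈ W := fun B v hv => by rw [hWu B v hv]; exact hv
  let Z := Y.quot W hWρ hWb
  have hZ : DegLt (Drep Z.τ) (D + 1) := by
    intro w hw z
    obtain ⟨x, rfl⟩ := W.mkQ_surjective z
    have h1 : W.mkQ x = W.mkQ ((Drep τ).asAlgebraHom (eS k F (Sum.inr () : κ ⊕ Unit) 1) x) := by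
      rw [← sub_eq_zero, ← map_sub]
      rw [Submodule.mkQ_apply, Submodule.Quotient.mk_eq_zero]
      refine ⟨x, ?_⟩
      rw [eS_one, map_sub, LinearMap.sub_apply, map_one, asAlg_of, Module.End.one_apply, sub_sub_cancel, he]
      show _ = τ (diagH F (κ ⊕ Unit) _) x
      rw [← tM_diag]
    rw [h1, ← asAlg_comm (τ := Drep Y.τ) (τ' := Drep Z.τ) W.mkQ (fun _ _ => rfl)]
    have h2 := deg_c' hD w 1 (by simpa using hw) x
    rw [hYτ]
    exact (congrArg W.mkQ h2).trans (map_zero _)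
  have hZ1 : DegLt (Drep (Z.op 1)) (D + 2) := U_deg hq hq2 Z (D + 1) hZ 1
  let S := Y.kerSES Z W.mkQ (fun _ _ => rfl) (fun _ _ => rfl) W.mkQ_surjective
  obtain ⟨z, hz⟩ : ∃ z, z = (Drep (Y.op 1)).asAlgebraHom (eW k F w) x := ⟨_, rfl⟩
  have h3 : S.Hp 1 z = 0 := by
    rw [hz]
    have h4 := asAlg_comm (τ := Drep (Y.op 1)) (τ' := Drep (Z.op 1)) (S.Hp 1)
      (fun q v => Y.op_map Z W.mkQ (fun _ _ => rfl) (fun _ _ => rfl) 1 _ v) (eW k F w) x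
    rw [h4]
    exact hZ1 w hw _
  obtain ⟨y, hy⟩ := S.exact₂ 1 z h3
  rw [← hz, ← hy]
  have hm : ∀ v : LinearMap.ker W.mkQ, (v : T) ∈ W := fun v => by
    exact (Submodule.Quotient.mk_eq_zero W).1 v.2
  have htr : ∀ g v, (Y.ker Z W.mkQ (fun _ _ => rfl) (fun _ _ => rfl)).ρ g v = v := by
    intro g v
    apply Subtype.ext
    exact hWu g v (hm v)
  have hC : ∀ t : Fˣ, Compat (Y.ker Z W.mkQ (fun _ _ => rfl) (fun _ _ => rfl)).ρ
      (Y.ker Z W.mkQ (fun _ _ => rfl) (fun _ _ => rfl)).ρ (uAct F κ Unit t) LinearMap.id := by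
    intro t g m
    rw [htr, htr]
  have h5 : ∀ t : Fˣ, Hmap (uAct F κ Unit t) (τ (tM F κ Unit t.val)) (hT t) 1 (S.Hi 1 y)
      = S.Hi 1 (Hmap (uAct F κ Unit t) LinearMap.id (hC t) 1 y) := by
    intro t
    erw [Hmap_comp, Hmap_comp]
    refine Hmap_congr _ _ rfl ?_ _ _
    ext v
    exact hWt _ _ (hm v)
  rw [Finset.sum_congr rfl (fun t _ => h5 t), ← map_sum]
  have h6 : (∑ t : Fˣ, Hmap (uAct F κ Unit t) LinearMap.id (hC t) 1) y = 0 := by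
    refine L1_ker htr _ ?_ y
    intro g m
    rw [LinearMap.sum_apply]
    have h7 : ∀ t : Fˣ, Hmap (uAct F κ Unit t) LinearMap.id (hC t) 1 (L1 htr g m)
        = L1 htr (Multiplicative.ofAdd (((t⁻¹ : Fˣ) : F) • g.toAdd)) m := fun t =>
      L1_map htr htr (hC t) g m
    rw [Finset.sum_congr rfl (fun t _ => h7 t)]
    rw [L1_sum htr (fun v => Multiplicative.ofAdd v) (fun _ _ => rfl) Finset.univ
      (fun t : Fˣ => ((t⁻¹ : Fˣ) : F) • g.toAdd) m, ← Finset.sum_smul]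
    have h8 : ∑ t : Fˣ, ((t⁻¹ : Fˣ) : F) = 0 := by
      refine (Equiv.sum_comp (Equiv.inv Fˣ) (fun t => (t : F))).trans ?_
      have := sum_F_zero hq2
      rw [sum_units, zero_add] at this
      exact this
    rw [h8, zero_smul]
    exact L1_one htr m
  rw [LinearMap.sum_apply] at h6
  rw [h6, map_zero]

/-- the equivariant representation of NU -/
def nER (τ : Representation k (Matrix (κ ⊕ Unit) (κ ⊕ Unit) F) T) : EqRep k (nAct F κ Unit) T where
  ρ := (GLrep τ).comp (nuH F κ Unit)
  τ := τ.comp (blk F κ Unit)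
  comm q g v := by
    show τ (blk F κ Unit q) (τ (nuH F κ Unit g).val v) = τ (nuH F κ Unit _).val (τ (blk F κ Unit q) v)
    rw [← Module.End.mul_apply, ← Module.End.mul_apply, ← map_mul, ← map_mul, gl_nu]

/-- the splitting of NU -/
abbrev nS (F κ : Type) [Field F] [Fintype κ] [DecidableEq κ] :
    Split (nAct F κ Unit) (mAct F κ Unit) (Act.triv (Matrix κ κ F) Fˣ) := Split.semi _ _ _ _

theorem nER_red (hq : (Fintype.card F : k) = 0)
    (τ : Representation k (Matrix (κ ⊕ Unit) (κ ⊕ Unit) F) T) (j : ℕ) (x) :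
    (nER τ).op (j + 1) 0 x = 0 := by
  classical
  have hz : MonoidAlgebra.of k (Matrix κ κ F) 0 * MonoidAlgebra.of k (Matrix κ κ F) 0
      = MonoidAlgebra.of k (Matrix κ κ F) 0 := by
    rw [← map_mul, mul_zero]
  have := (nS F κ).kills_acyc hz (j + 1) (nER τ) (card_units_ne hq) (by
    intro x
    rw [asAlg_of]
    have := U_red ((nS F κ).res (nER τ)) j x
    rw [this, map_zero]) x
  rw [asAlg_of] at this
  exact this

lemma nu_inl (B) : (nuH F κ Unit (SemidirectProduct.inl B)).val = uM F κ Unit B := by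
  rw [nuH_val, uM_apply]; simp

lemma nu_inr (t) : (nuH F κ Unit (SemidirectProduct.inr t)).val = tM F κ Unit t.val := by
  rw [nuH_val, tM_apply]; simp

theorem nER_deg (hq : (Fintype.card F : k) = 0) (hq2 : Fintype.card F ≠ 2)
    (τ : Representation k (Matrix (κ ⊕ Unit) (κ ⊕ Unit) F) T) {D : ℕ}
    (hD : DegLt (Drep τ) (D + 2)) (hred : ∀ x, τ 0 x = 0) (j : ℕ) :
    DegLt (Drep ((nER τ).op j)) (D + 2 * j) := by
  classical
  intro w hw v
  obtain ⟨ε, hε⟩ : ∃ ε, ε = MonoidAlgebra.mapDomainAlgHom k k (diagH F κ) (eW k F w) := ⟨_, rfl⟩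
  have hi : ε * ε = ε := by rw [hε, ← map_mul, eW_idem hq]
  rw [asAlg_restr, ← hε]
  refine (nS F κ).kills_acyc hi j (nER τ) (card_units_ne hq) ?_ v
  intro x
  have hx : (((nS F κ).res (nER τ)).op j).asAlgebraHom ε x
      = (Drep (((nS F κ).res (nER τ)).op j)).asAlgebraHom (eW k F w) x := by
    rw [hε, ← asAlg_restr]
  rw [hx]
  have hYτ : ((nS F κ).res (nER τ)).τ = τ.comp (blk F κ Unit) := rfl
  have hYρ : ∀ B v, ((nS F κ).res (nER τ)).ρ B v = τ (uM F κ Unit B) v := fun B v => by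
    show τ (nuH F κ Unit (SemidirectProduct.inl B)).val v = _
    rw [nu_inl]
  rcases j with _ | _ | j
  · obtain ⟨m, rfl⟩ := toH0_surj _ x
    let p1 := toH0 ((nS F κ).res (nER τ)).ρ
    let p2 := toH0 ((nS F κ).HN (nER τ) 0).ρ
    have c1 : ∀ m, p1 ((Drep (τ.comp (blk F κ Unit))).asAlgebraHom (eW k F w) m)
        = (Drep (((nS F κ).res (nER τ)).op 0)).asAlgebraHom (eW k F w) (p1 m) := fun m =>
      asAlg_comm (τ := Drep (τ.comp (blk F κ Unit))) (τ' := Drep (((nS F κ).res (nER τ)).op 0)) p1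
        (fun q v => (Hmap_toH0 _ _ (((nS F κ).res (nER τ)).compat (diagH F κ q)) v).symm) _ m
    have c2 : ∀ y, p2 ((Drep (((nS F κ).res (nER τ)).op 0)).asAlgebraHom (eW k F w) y)
        = (Drep (((nS F κ).HN (nER τ) 0).op 0)).asAlgebraHom (eW k F w) (p2 y) := fun m =>
      asAlg_comm (τ := Drep (((nS F κ).res (nER τ)).op 0))
        (τ' := Drep (((nS F κ).HN (nER τ) 0).op 0)) p2
        (fun q v => (Hmap_toH0 _ _ (((nS F κ).HN (nER τ) 0).compat (diagH F κ q)) v).symm) _ m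
    have := deg_coinv hq τ hD hred (p2 ∘ₗ p1) (fun B x => by
        rw [LinearMap.comp_apply, ← hYρ]
        exact congrArg p2 (toH0_act ((nS F κ).res (nER τ)).ρ B x)) (fun t ht x => by
        have h3 : ∀ m, ((nS F κ).resN (nER τ)).τ (Units.mk0 t ht) m = τ (tM F κ Unit t) m := fun m => by
          show τ (nuH F κ Unit (SemidirectProduct.inr (Units.mk0 t ht))).val m = _
          rw [nu_inr]; rfl
        rw [LinearMap.comp_apply, ← h3]
        refine Eq.trans ?_ (toH0_act ((nS F κ).HN (nER τ) 0).ρ (Units.mk0 t ht) (p1 x))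
        exact congrArg p2 ((nS F κ).HN_ρ_toH0 (nER τ) (Units.mk0 t ht) x).symm) w (by omega)
        (fun y => (Drep (((nS F κ).HN (nER τ) 0).op 0)).asAlgebraHom (eW k F w) y)
        (fun x => by
          rw [LinearMap.comp_apply, c1]
          exact c2 (p1 x)) m
    rw [LinearMap.comp_apply, c1] at this
    exact this
  · apply toH0_avg _ (card_units_ne hq)
    convert map_zero (toH0 ((nS F κ).HN (nER τ) 1).ρ)
    have hT : ∀ t : Fˣ, Compat ((nS F κ).res (nER τ)).ρ ((nS F κ).res (nER τ)).ρ
      (uAct F κ Unit t) (τ (tM F κ Unit t.val)) := fun t => by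
        have := ((nS F κ).resN (nER τ)).compat t
        intro g m
        have h2 := this g m
        have h3 : ∀ m, ((nS F κ).resN (nER τ)).τ t m = τ (tM F κ Unit t.val) m := fun m => by
          show τ (nuH F κ Unit (SemidirectProduct.inr t)).val m = _
          rw [nu_inr]
        rw [h3, h3] at h2
        exact h2
    have := deg_one hq hq2 τ hD ((nS F κ).res (nER τ)) hYρ hYτ hT w (by omega) x
    rw [← this]
    refine Finset.sum_congr rfl fun t _ => ?_
    refine Hmap_congr (((nS F κ).resN (nER τ)).compat t) (hT t) rfl ?_ _ _
    show τ (nuH F κ Unit (SemidirectProduct.inr t)).val = _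
    rw [nu_inr]
  · have := U_deg hq hq2 ((nS F κ).res (nER τ)) (D + 2) (deg_blk hD) (j + 2) w (by omega) x
    exact (congrArg _ this).trans (map_zero _)

end w

end SpH


namespace SpH

set_option linter.unusedSectionVars false
set_option linter.unusedSimpArgs false
set_option linter.style.haveILetI false

open Finsupp
open scoped Matrix

section main

variable {k : Type} [Field k] {F : Type} [Field F] [Fintype F]

/-- vanishing for reduced coefficient systems -/
def VV (k F : Type) [Field k] [Field F] [Fintype F] (i : ℕ) (L : Type) [Fintype L] [DecidableEq L] : Prop :=
  ∀ (D : ℕ) (T : Type) [AddCommGroup T] [Module k T] (τ : Representation k (Matrix L L F) T),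
    DegLt (Drep τ) D → 2 * i + D ≤ 2 * Fintype.card L → (∀ x, τ 0 x = 0) →
    ∀ x : Hm (GLrep τ) i, x = 0

lemma EqRep.ext' {G M 𝓜 : Type} [Group G] [AddCommGroup M] [Module k M] [Monoid 𝓜] {θ : Act 𝓜 G}
    {X Y : EqRep k θ M} (h : X.ρ = Y.ρ) (h' : X.τ = Y.τ) : X = Y := by
  cases X; cases Y; cases h; cases h'; rfl

lemma op_congr {G M N : Type} [Group G] [AddCommGroup M] [Module k M] [Group N] {θ : Act N G}
    {X Y : EqRep k θ M} (h : X = Y) {a b : ℕ} (H : ∀ x : Hm (Y.op b) a, x = 0)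
    (x : Hm (X.op b) a) : x = 0 := by
  subst h; exact H x

lemma exists_ext (k F : Type) [Field k] [Field F] [Fintype F] (hq : (Fintype.card F : k) = 0) (i : ℕ) :
    ∃ (K : Type) (_ : Field K) (_ : Fintype K) (_ : Algebra F K) (m : ℕ)
      (_ : Module.Basis (Fin (m + 1)) F K),
      ((m + 1 : ℕ) : k) ≠ 0 ∧ i + 2 ≤ 2 * (m + 1) ∧ (Fintype.card K : k) = 0 := by
  classical
  obtain ⟨p, hp⟩ := CharP.exists F
  haveI := hp
  haveI : Fact p.Prime := ⟨CharP.char_is_prime F p⟩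
  let m := Fintype.card F * (i + 1)
  let K := FiniteField.Extension F p (m + 1)
  letI : Fintype K := Fintype.ofFinite K
  have h1 : Module.finrank F K = m + 1 := FiniteField.finrank_extension F p (m + 1)
  refine ⟨K, inferInstance, inferInstance, inferInstance, m, Module.finBasisOfFinrankEq F K h1, ?_, ?_, ?_⟩
  · push_cast [m]
    rw [hq]; simp
  · have : 0 < Fintype.card F := Fintype.card_pos
    have : i + 1 ≤ m := Nat.le_mul_of_pos_left _ this
    omega
  · have := FiniteField.natCard_extension F p (m + 1)
    rw [Nat.card_eq_fintype_card, Nat.card_eq_fintype_card] at this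
    have h2 : Fintype.card K = Fintype.card F ^ (m + 1) := this
    rw [h2]; push_cast; rw [hq]; simp

theorem II_of (hq : (Fintype.card F : k) = 0) (hq2 : Fintype.card F ≠ 2) (i : ℕ)
    (hV : ∀ a, a < i → ∀ n, VV k F a (Idx n)) :
    ∀ b, 0 < b → b ≤ i → ∀ n, b + 1 ≤ n → GV k F (Idx n) b := by
  intro b
  induction b using Nat.strong_induction_on with
  | _ b ih =>
  intro hb hbi n hn
  obtain ⟨b, rfl⟩ : ∃ c, b = c + 1 := ⟨b - 1, by omega⟩
  obtain ⟨K, _, _, _, m, e, h1, h2, h3⟩ := exists_ext k F hq b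
  refine II_step e h1 b (fun c hc hcb => ih c hcb hc (by omega) n (by omega))
    (ext_vanish hq hq2 e h3 n b h2) ?_
  intro κ _ _ hκ
  rw [Idx.card] at hκ
  have hc : Fintype.card κ = Fintype.card (Idx (Fintype.card κ - 1) ⊕ Unit) := by
    rw [Fintype.card_sum, Idx.card]; simp; omega
  refine StabInj.congr (Fintype.equivOfCardEq hc) ?_
  refine stab_inj hq hq2 (b + 1) ?_
  intro a c hac T _ _ τ hD hred x
  refine hV a (by omega) _ (c + 2) T τ hD ?_ hred x
  rw [Idx.card]; omega

section red

variable {L : Type} [Fintype L] [DecidableEq L] {T : Type} [AddCommGroup T] [Module k T]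

/-- reduced part -/
def redRep (τ : Representation k (Matrix L L F) T) :
    Representation k (Matrix L L F) (LinearMap.ker (τ 0)) where
  toFun A := (τ A).restrict (fun v hv => by
    rw [LinearMap.mem_ker] at hv ⊢
    rw [← Module.End.mul_apply, ← map_mul, zero_mul]; exact hv)
  map_one' := by ext v; simp
  map_mul' a b := by ext v; simp

theorem gen_vanish {i D : ℕ} (hV : VV k F i L)
    (hG : i + 1 ≤ Fintype.card L → GV k F L i) (τ : Representation k (Matrix L L F) T)
    (hD : DegLt (Drep τ) D) (h : 2 * i + D ≤ 2 * Fintype.card L) (x : Hm (GLrep τ) i) : x = 0 := by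
  have hτ : ∀ A B x, τ (A * B) x = τ A (τ B x) := fun A B x => by
    rw [map_mul, Module.End.mul_apply]
  rcases Nat.eq_zero_or_pos D with h0 | h0
  · subst h0
    have h1 : ∀ t : T, t = 0 := by
      intro t
      have h2 := hD 0 (Nat.zero_le _) t
      have h3 : eW k F (0 : L → Fin 3) = 1 := by
        rw [eW]; exact Finset.prod_eq_one fun s _ => eS_zero k F s
      rw [h3, map_one] at h2
      exact h2
    rw [← Hmap_id (Compat.id (GLrep τ)) i x]
    exact Hmap_zero_φ _ (LinearMap.ext fun y => h1 _) _ _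
  have hG' := hG (by omega)
  have c1 : Compat (GLrep τ) (1 : Representation k (Matrix L L F)ˣ (LinearMap.range (τ 0)))
      (MonoidHom.id _) (τ 0).rangeRestrict := by
    intro g m
    apply Subtype.ext
    show τ 0 (τ g.val m) = τ 0 m
    rw [← hτ, zero_mul]
  have c2 : Compat (1 : Representation k (Matrix L L F)ˣ (LinearMap.range (τ 0))) (GLrep τ)
      (MonoidHom.id _) (LinearMap.range (τ 0)).subtype := by
    rintro g ⟨_, m, rfl⟩
    show τ 0 m = τ g.val (τ 0 m)
    rw [← hτ, mul_zero]
  have d1 : Compat (GLrep τ) (GLrep (redRep τ))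
      (MonoidHom.id _) ((LinearMap.id - τ 0).codRestrict (LinearMap.ker (τ 0)) (fun m => by
        rw [LinearMap.mem_ker, LinearMap.sub_apply, map_sub, ← hτ, mul_zero]; simp)) := by
    intro g m
    apply Subtype.ext
    show τ g.val m - τ 0 (τ g.val m) = τ g.val (m - τ 0 m)
    rw [map_sub, ← hτ, ← hτ, zero_mul, mul_zero]
  have d2 : Compat (GLrep (redRep τ)) (GLrep τ)
      (MonoidHom.id _) (LinearMap.ker (τ 0)).subtype := fun g m => rfl
  have c3 := Hmap_comp c2 c1 i x
  have d3 := Hmap_comp d2 d1 i x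
  have z1 : ∀ y : Hm (1 : Representation k (Matrix L L F)ˣ (LinearMap.range (τ 0))) i, y = 0 :=
    triv_vanish hG' _ (fun _ _ => rfl)
  have z2 : ∀ y : Hm (GLrep (redRep τ)) i, y = 0 :=
    hV D _ (redRep τ) (hD.of_inj (LinearMap.ker (τ 0)).subtype (fun _ _ => rfl)
      Subtype.val_injective) h (fun y => Subtype.ext y.2)
  rw [z1 (Hmap _ _ c1 i x), map_zero] at c3
  rw [z2 (Hmap _ _ d1 i x), map_zero] at d3
  have := Hmap_add_φ (Compat.comp c2 c1) (Compat.comp d2 d1) (Compat.id (GLrep τ)) (by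
    ext m
    show m = τ 0 m + (m - τ 0 m)
    abel) i x
  refine (Hmap_id (Compat.id (GLrep τ)) i x).symm.trans (Eq.trans this ?_)
  exact (congrArg₂ (· + ·) c3.symm d3.symm).trans (add_zero _)

end red

theorem VV_all (hq : (Fintype.card F : k) = 0) (hq2 : Fintype.card F ≠ 2) (i : ℕ) :
    ∀ n, VV k F i (Idx n) := by
  classical
  induction i using Nat.strong_induction_on with
  | _ i ih =>
  rcases Nat.eq_zero_or_pos i with h0 | h0
  · subst h0
    intro n D T _ _ τ hD hn hred x
    exact H0_red hq τ hD (by omega) hred x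
  have hII := II_of hq hq2 i ih
  intro n
  induction n with
  | zero =>
    intro D T _ _ τ hD hn hred x
    rw [Idx.card] at hn
    omega
  | succ n ihn =>
  intro D T _ _ τ hD hn hred x
  rw [Idx.card] at hn
  by_cases hD2 : D < 2
  · have hD1 : DegLt (Drep τ) 1 := hD.mono (by omega)
    have h1 : ∀ t : T, t = 0 := by
      intro t
      refine expand (Drep τ) LinearMap.id (fun x => ?_) (fun s x => ?_) t
      · show τ (Matrix.diagonal fun _ => 0) x = 0
        rw [Matrix.diagonal_zero, hred]
      · have h2 := hD1 (Function.update 0 s 1) (by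
          unfold wt
          rw [Finset.sum_eq_single s]
          · simp
          · intro b _ hb; simp [hb]
          · simp) x
        rw [eW_split _ s] at h2
        have h3 : eW k F (Function.update (Function.update (0 : Idx (n+1) → Fin 3) s 1) s 0) = 1 := by
          rw [Function.update_idem, eW]
          refine Finset.prod_eq_one fun s' _ => ?_
          by_cases hs : s' = s
          · subst hs; rw [Function.update_self]; exact eS_zero k F s'
          · rw [Function.update_of_ne hs]; exact eS_zero k F s'
        rw [h3, mul_one, Function.update_self] at h2
        have h4 : eS k F s ((1 : Fin 3) : ℕ) = 1 - MonoidAlgebra.of k _ (Pi.mulSingle s 0) := eS_one k F s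
        rw [h4, map_sub, LinearMap.sub_apply, map_one, asAlg_of] at h2
        exact h2
    rw [← Hmap_id (Compat.id (GLrep τ)) i x]
    exact Hmap_zero_φ _ (LinearMap.ext fun y => h1 _) _ _
  obtain ⟨D, rfl⟩ : ∃ D', D = D' + 2 := ⟨D - 2, by omega⟩
  have hn' : 2 * i + D ≤ 2 * n := by omega
  clear hn hD2
  have key : ∀ (τ : Representation k (Matrix (Idx n ⊕ Unit) (Idx n ⊕ Unit) F) T),
    DegLt (Drep τ) (D + 2) → (∀ x, τ 0 x = 0) → ∀ x : Hm (GLrep τ) i, x = 0 := by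
    clear x hred hD τ
    intro τ hD hred x
    refine transfer (ppH F (Idx n) Unit) ppH_inj i _ (ppH_index hq) ?_ x
    let X : EqRep k (Act.semi ((nAct F (Idx n) Unit).restr (Units.coeHom _))
      (Act.triv Unit _) (Act.triv Unit _) (fun _ _ _ => rfl)) T :=
      ⟨(GLrep τ).comp (ppH F (Idx n) Unit), 1, fun _ _ _ => rfl⟩
    let S := Split.semi ((nAct F (Idx n) Unit).restr (Units.coeHom _))
      (Act.triv Unit _) (Act.triv Unit _) (fun _ _ _ => rfl)
    refine S.vanish i X ?_
    intro a b hab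
    have hX : S.resN X = (nER τ).restr (Units.coeHom _) ((nAct F (Idx n) Unit).restr (Units.coeHom _))
        (fun _ => rfl) := by
      apply EqRep.ext'
      · refine MonoidHom.ext fun g => ?_
        show τ (ppH F (Idx n) Unit (SemidirectProduct.inl g)).val = τ (nuH F (Idx n) Unit g).val
        rw [ppH_inl]
      · refine MonoidHom.ext fun g => ?_
        show τ (ppH F (Idx n) Unit (SemidirectProduct.inr g)).val = τ (blk F (Idx n) Unit g.val)
        rw [ppH_inr]; rfl
    refine op_congr (X := S.resN X) hX ?_
    refine Hm_congr ((nER τ).restr_op (Units.coeHom _) _ (fun _ => rfl) b) ?_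
    have hdeg := nER_deg hq hq2 τ hD hred b
    rcases b with _ | b
    · obtain rfl : a = i := by omega
      exact gen_vanish ihn (fun h => hII _ h0 le_rfl n (by rwa [Idx.card] at h)) ((nER τ).op 0) hdeg
        (by rw [Idx.card]; omega)
    · exact ih a (by omega) n (D + 2 * (b + 1)) _ ((nER τ).op (b + 1)) hdeg
        (by rw [Idx.card]; omega) (nER_red hq τ b)
  exact key τ hD hred x

theorem II_all (hq : (Fintype.card F : k) = 0) (hq2 : Fintype.card F ≠ 2) (i n : ℕ) (h0 : 0 < i)
    (hn : i + 1 ≤ n) : GV k F (Idx n) i :=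
  II_of hq hq2 i (fun a _ => VV_all hq hq2 a) i h0 le_rfl n hn

end main

end SpH


namespace SpH

set_option linter.unusedSectionVars false
set_option linter.unusedSimpArgs false
set_option linter.style.haveILetI false

open Finsupp
open scoped Matrix

section sact

variable {F L : Type} [Field F] [Fintype L] [DecidableEq L]

/-- symmetric matrix attached to a function on unordered pairs -/
def symM (s : Sym2 L → F) : Matrix L L F := Matrix.of fun i j => s s(i, j)

lemma symM_apply (s : Sym2 L → F) (i j : L) : symM s i j = s s(i, j) := rfl

lemma symM_t (s : Sym2 L → F) : (symM s)ᵀ = symM s := by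
  ext i j
  rw [Matrix.transpose_apply, symM_apply, symM_apply, Sym2.eq_swap]

lemma symM_inj {s t : Sym2 L → F} (h : symM s = symM t) : s = t := by
  funext x
  induction x with
  | h i j => exact congrFun (congrFun h i) j

lemma symM_add (s t : Sym2 L → F) : symM (s + t) = symM s + symM t := rfl

lemma symM_zero : symM (0 : Sym2 L → F) = 0 := rfl

lemma symM_surj (B : Matrix L L F) (h : Bᵀ = B) : ∃ s, symM s = B := by
  refine ⟨Sym2.lift ⟨fun i j => B i j, fun i j => ?_⟩, ?_⟩
  · exact congrFun (congrFun h j) i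
  · ext i j; rfl

/-- conjugate of a symmetric matrix -/
def conjS (A : Matrix L L F) (s : Sym2 L → F) : Sym2 L → F :=
  Sym2.lift ⟨fun i j => (A * symM s * Aᵀ) i j, fun i j => by
    have : (A * symM s * Aᵀ)ᵀ = A * symM s * Aᵀ := by
      rw [Matrix.transpose_mul, Matrix.transpose_mul, Matrix.transpose_transpose, symM_t,
        Matrix.mul_assoc]
    exact congrFun (congrFun this j) i⟩

lemma symM_conjS (A : Matrix L L F) (s : Sym2 L → F) : symM (conjS A s) = A * symM s * Aᵀ := by
  ext i j; rfl

/-- action of matrices on symmetric matrices -/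
def sAct (F L : Type) [Field F] [Fintype L] [DecidableEq L] :
    Act (Matrix L L F) (Multiplicative (Sym2 L → F)) where
  hom A := AddMonoidHom.toMultiplicative
    { toFun := conjS A
      map_zero' := symM_inj (by rw [symM_conjS, symM_zero]; simp)
      map_add' := fun a b => symM_inj (by
        rw [symM_add, symM_conjS, symM_conjS, symM_conjS, symM_add, Matrix.mul_add, Matrix.add_mul]) }
  one := MonoidHom.ext fun x => congrArg Multiplicative.ofAdd (symM_inj (by
    show symM (conjS 1 x.toAdd) = symM x.toAdd
    rw [symM_conjS, Matrix.transpose_one, Matrix.mul_one, Matrix.one_mul]))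
  mul a b := MonoidHom.ext fun x => congrArg Multiplicative.ofAdd (symM_inj (by
    show symM (conjS (a * b) x.toAdd) = symM (conjS a (conjS b x.toAdd))
    rw [symM_conjS, symM_conjS, symM_conjS, Matrix.transpose_mul]
    simp only [Matrix.mul_assoc]))

lemma sAct_apply (A : Matrix L L F) (s : Multiplicative (Sym2 L → F)) :
    sAct F L A s = Multiplicative.ofAdd (conjS A s.toAdd) := rfl

lemma sAct_zero : sAct F L 0 = 1 :=
  MonoidHom.ext fun x => congrArg Multiplicative.ofAdd (symM_inj (by
    show symM (conjS 0 x.toAdd) = symM 0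
    rw [symM_conjS, Matrix.zero_mul, Matrix.zero_mul]; rfl))

variable {k : Type} [Field k] [Fintype F] {M : Type} [AddCommGroup M] [Module k M]

theorem S_deg (hq : (Fintype.card F : k) = 0) (hq2 : Fintype.card F ≠ 2)
    (X : EqRep k (sAct F L) M) (d : ℕ) (hd : DegLt (Drep X.τ) d) (b : ℕ) :
    DegLt (Drep (X.op b)) (d + 2 * b) := by
  let θ' : Act (L → F) (Multiplicative (Sym2 L → F)) :=
    piAct F (fun x : Sym2 L => symChar (F := F) x)
  have h : ∀ q, θ' q = sAct F L (diagH F L q) := by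
    intro q
    refine MonoidHom.ext fun B => congrArg Multiplicative.ofAdd ?_
    apply symM_inj
    show _ = symM (conjS (Matrix.diagonal q) B.toAdd)
    rw [symM_conjS, Matrix.diagonal_transpose]
    ext i j
    rw [Matrix.mul_diagonal, Matrix.diagonal_mul]
    show q i * q j * B.toAdd s(i, j) = q i * B.toAdd s(i, j) * q j
    ring
  have h1 := DegBound.sym (k := k) (ι := L) hq hq2 _ (X.restr (diagH F L) θ' h) d hd b
  have h2 := X.restr_op (diagH F L) θ' h b
  have h3 : DegLt ((X.op b).comp (diagH F L)) (d + 2 * b) := by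
    rw [← h2]; exact h1
  exact h3

theorem S_red (X : EqRep k (sAct F L) M) (b : ℕ) (x) : X.op (b + 1) 0 x = 0 := by
  rw [EqRep.op_apply]
  exact Hmap_one _ sAct_zero _ _

end sact

section grp

variable {F L : Type} [Field F] [Fintype L] [DecidableEq L]

/-- standard symplectic form -/
def omL (F L : Type) [Field F] [Fintype L] (v w : (L → F) × (L → F)) : F :=
  v.1 ⬝ᵥ w.2 - v.2 ⬝ᵥ w.1

/-- symplectic group -/
abbrev SSp (F L : Type) [Field F] [Fintype L] := ↥(bilinIsoms F (omL F L))

noncomputable instance [Fintype F] : Fintype (SSp F L) := by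
  haveI : Finite (((L → F) × (L → F)) ≃ₗ[F] ((L → F) × (L → F))) :=
    Finite.of_injective (fun g => (g : ((L → F) × (L → F)) → ((L → F) × (L → F))))
      DFunLike.coe_injective
  exact Fintype.ofFinite _

lemma SSp.ext' {g h : SSp F L} (H : ∀ x y, g.1 (x, y) = h.1 (x, y)) : g = h :=
  Subtype.ext (LinearEquiv.ext fun v => H v.1 v.2)

/-- unipotent element -/
def usp (s : Sym2 L → F) : SSp F L :=
  ⟨{ toFun := fun v => (v.1 + symM s *ᵥ v.2, v.2)
     invFun := fun v => (v.1 - symM s *ᵥ v.2, v.2)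
     map_add' := fun v w => by
      refine Prod.ext ?_ rfl
      simp only [Prod.fst_add, Prod.snd_add, Matrix.mulVec_add]; abel
     map_smul' := fun c v => by
      refine Prod.ext ?_ rfl
      simp only [Prod.smul_fst, Prod.smul_snd, Matrix.mulVec_smul, RingHom.id_apply, smul_add]
     left_inv := fun v => by simp
     right_inv := fun v => by simp }, by
    intro v w
    show (v.1 + symM s *ᵥ v.2) ⬝ᵥ w.2 - v.2 ⬝ᵥ (w.1 + symM s *ᵥ w.2) = v.1 ⬝ᵥ w.2 - v.2 ⬝ᵥ w.1
    rw [add_dotProduct, dotProduct_add, Matrix.dotProduct_mulVec, ← Matrix.mulVec_transpose,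
      symM_t]
    ring⟩

lemma usp_apply (s : Sym2 L → F) (x y) : (usp s).1 (x, y) = (x + symM s *ᵥ y, y) := rfl

/-- Levi element -/
def tsp (A : (Matrix L L F)ˣ) : SSp F L :=
  ⟨{ toFun := fun v => (A.val *ᵥ v.1, (A⁻¹).valᵀ *ᵥ v.2)
     invFun := fun v => ((A⁻¹).val *ᵥ v.1, A.valᵀ *ᵥ v.2)
     map_add' := fun v w => by
      refine Prod.ext ?_ ?_ <;> simp [Matrix.mulVec_add]
     map_smul' := fun c v => by
      refine Prod.ext ?_ ?_ <;> simp [Matrix.mulVec_smul]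
     left_inv := fun v => by
      refine Prod.ext ?_ ?_ <;> simp only [Matrix.mulVec_mulVec, ← Matrix.transpose_mul,
        Units.inv_mul, Units.mul_inv, Matrix.transpose_one, Matrix.one_mulVec]
     right_inv := fun v => by
      refine Prod.ext ?_ ?_ <;> simp only [Matrix.mulVec_mulVec, ← Matrix.transpose_mul,
        Units.inv_mul, Units.mul_inv, Matrix.transpose_one, Matrix.one_mulVec] }, by
    have key : ∀ x y : L → F, (A.val *ᵥ x) ⬝ᵥ ((A⁻¹).valᵀ *ᵥ y) = x ⬝ᵥ y := by
      intro x y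
      rw [Matrix.dotProduct_mulVec, Matrix.vecMul_transpose, Matrix.mulVec_mulVec, Units.inv_mul,
        Matrix.one_mulVec]
    intro v w
    show (A.val *ᵥ v.1) ⬝ᵥ ((A⁻¹).valᵀ *ᵥ w.2) - ((A⁻¹).valᵀ *ᵥ v.2) ⬝ᵥ (A.val *ᵥ w.1) =
      v.1 ⬝ᵥ w.2 - v.2 ⬝ᵥ w.1
    rw [key, dotProduct_comm _ (A.val *ᵥ w.1), key, dotProduct_comm w.1]⟩

lemma tsp_apply (A : (Matrix L L F)ˣ) (x y) :
    (tsp A).1 (x, y) = (A.val *ᵥ x, (A⁻¹).valᵀ *ᵥ y) := rfl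

lemma SSp.mul_apply (g h : SSp F L) (v) : (g * h).1 v = g.1 (h.1 v) := rfl

/-- unipotent radical -/
def uspH (F L : Type) [Field F] [Fintype L] [DecidableEq L] :
    Multiplicative (Sym2 L → F) →* SSp F L where
  toFun s := usp s.toAdd
  map_one' := SSp.ext' fun x y => by
    rw [usp_apply]
    show (x + symM 0 *ᵥ y, y) = (x, y)
    rw [symM_zero, Matrix.zero_mulVec, add_zero]
  map_mul' a b := SSp.ext' fun x y => by
    rw [SSp.mul_apply, usp_apply, usp_apply, usp_apply]
    show (x + symM (a.toAdd + b.toAdd) *ᵥ y, y) = _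
    rw [symM_add, Matrix.add_mulVec, add_comm (symM a.toAdd *ᵥ y), add_assoc]

/-- Levi subgroup -/
def tspH (F L : Type) [Field F] [Fintype L] [DecidableEq L] :
    (Matrix L L F)ˣ →* SSp F L where
  toFun A := tsp A
  map_one' := SSp.ext' fun x y => by
    rw [tsp_apply]; simp
  map_mul' a b := SSp.ext' fun x y => by
    rw [SSp.mul_apply, tsp_apply, tsp_apply, tsp_apply, Matrix.mulVec_mulVec, Matrix.mulVec_mulVec,
      ← Matrix.transpose_mul, mul_inv_rev]
    rfl

/-- action of the Levi -/
abbrev lAct (F L : Type) [Field F] [Fintype L] [DecidableEq L] :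
    Act (Matrix L L F)ˣ (Multiplicative (Sym2 L → F)) := (sAct F L).restr (Units.coeHom _)

lemma t_usp (s : Multiplicative (Sym2 L → F)) (A : (Matrix L L F)ˣ) :
    tspH F L A * uspH F L s = uspH F L (lAct F L A s) * tspH F L A := SSp.ext' fun x y => by
  show (A.val *ᵥ (x + symM s.toAdd *ᵥ y), (A⁻¹).valᵀ *ᵥ y) =
    (A.val *ᵥ x + symM (conjS A.val s.toAdd) *ᵥ ((A⁻¹).valᵀ *ᵥ y), (A⁻¹).valᵀ *ᵥ y)
  rw [symM_conjS, Matrix.mulVec_mulVec, Matrix.mul_assoc, ← Matrix.transpose_mul, Units.inv_mul,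
    Matrix.transpose_one, Matrix.mul_one, Matrix.mulVec_add, Matrix.mulVec_mulVec]

/-- Siegel parabolic -/
def siegel (F L : Type) [Field F] [Fintype L] [DecidableEq L] : Semi (lAct F L) →* SSp F L :=
  semiLift (lAct F L) (uspH F L) (tspH F L) t_usp

lemma siegel_apply (p : Semi (lAct F L)) (x y) : (siegel F L p).1 (x, y) =
    (p.right.val *ᵥ x + symM p.left.toAdd *ᵥ ((p.right⁻¹).valᵀ *ᵥ y), (p.right⁻¹).valᵀ *ᵥ y) := rfl

lemma siegel_inj : Function.Injective (siegel F L) := by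
  intro p q h
  have h1 : ∀ x y, (siegel F L p).1 (x, y) = (siegel F L q).1 (x, y) := fun x y => by rw [h]
  have h2 : p.right = q.right := by
    apply Units.ext
    apply Matrix.mulVec_injective
    funext x
    have := congrArg Prod.fst (h1 x 0)
    rw [siegel_apply, siegel_apply] at this
    simpa using this
  refine SemidirectProduct.ext ?_ h2
  apply symM_inj
  apply Matrix.mulVec_injective
  funext y
  have := congrArg Prod.fst (h1 0 (p.right.valᵀ *ᵥ y))
  rw [siegel_apply, siegel_apply, ← h2] at this
  simp only [Matrix.mulVec_zero, zero_add, Matrix.mulVec_mulVec, ← Matrix.transpose_mul,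
    Matrix.mul_assoc, Units.mul_inv, Matrix.transpose_one, Matrix.mul_one] at this
  exact this

lemma siegel_range {g : SSp F L} (h : ∀ x, (g.1 (x, 0)).2 = 0) : g ∈ (siegel F L).range := by
  let A : Matrix L L F := LinearMap.toMatrix' (LinearMap.fst F _ _ ∘ₗ g.1.toLinearMap ∘ₗ LinearMap.inl F _ _)
  let C : Matrix L L F := LinearMap.toMatrix' (LinearMap.fst F _ _ ∘ₗ g.1.toLinearMap ∘ₗ LinearMap.inr F _ _)
  let D : Matrix L L F := LinearMap.toMatrix' (LinearMap.snd F _ _ ∘ₗ g.1.toLinearMap ∘ₗ LinearMap.inr F _ _)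
  have hx : ∀ x, g.1 (x, 0) = (A *ᵥ x, 0) := fun x => Prod.ext (by
    simp only [A, LinearMap.toMatrix'_mulVec]; rfl) (h x)
  have hy : ∀ y, g.1 (0, y) = (C *ᵥ y, D *ᵥ y) := fun x => Prod.ext (by
    simp only [C, LinearMap.toMatrix'_mulVec]; rfl) (by
    simp only [D, LinearMap.toMatrix'_mulVec]; rfl)
  have hxy : ∀ x y, g.1 (x, y) = (A *ᵥ x + C *ᵥ y, D *ᵥ y) := by
    intro x y
    have : ((x, y) : (L → F) × (L → F)) = (x, 0) + (0, y) := by simp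
    rw [this, map_add, hx, hy]; simp
  have h1 : Aᵀ * D = 1 := by
    apply Matrix.ext_of_mulVec_single
    intro j
    apply dotProduct_eq
    intro x
    have := g.2 (x, 0) (0, Pi.single j 1)
    rw [hx, hy] at this
    simp only [omL, zero_dotProduct, dotProduct_zero, sub_zero] at this
    rw [dotProduct_comm, Matrix.one_mulVec, dotProduct_comm _ x, ← this, ← Matrix.mulVec_mulVec,
      Matrix.dotProduct_mulVec, Matrix.vecMul_transpose]
  have h2 : D * Aᵀ = 1 := mul_eq_one_comm.1 h1
  have h3 : Cᵀ * D = Dᵀ * C := by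
    apply Matrix.ext_of_mulVec_single
    intro j
    apply dotProduct_eq
    intro x
    have := g.2 (0, x) (0, Pi.single j 1)
    rw [hy, hy] at this
    simp only [omL, zero_dotProduct, dotProduct_zero, sub_zero] at this
    rw [dotProduct_comm, dotProduct_comm _ x, ← Matrix.mulVec_mulVec, ← Matrix.mulVec_mulVec,
      Matrix.dotProduct_mulVec, Matrix.dotProduct_mulVec _ Dᵀ, Matrix.vecMul_transpose,
      Matrix.vecMul_transpose]
    exact sub_eq_zero.1 this
  have h4 : A * Dᵀ = 1 := by
    have := congrArg Matrix.transpose h2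
    simpa [Matrix.transpose_mul] using this
  have h5 : Dᵀ * A = 1 := mul_eq_one_comm.1 h4
  obtain ⟨s, hs⟩ := symM_surj (C * Aᵀ) (by
    rw [Matrix.transpose_mul, Matrix.transpose_transpose]
    calc A * Cᵀ = A * Cᵀ * (D * Aᵀ) := by rw [h2, Matrix.mul_one]
      _ = A * (Cᵀ * D) * Aᵀ := by simp only [Matrix.mul_assoc]
      _ = (A * Dᵀ) * C * Aᵀ := by rw [h3]; simp only [Matrix.mul_assoc]
      _ = C * Aᵀ := by rw [h4, Matrix.one_mul])
  refine ⟨⟨Multiplicative.ofAdd s, ⟨A, Dᵀ, h4, h5⟩⟩, SSp.ext' fun x y => ?_⟩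
  rw [siegel_apply, hxy]
  show (A *ᵥ x + symM s *ᵥ (Dᵀᵀ *ᵥ y), Dᵀᵀ *ᵥ y) = _
  rw [hs, Matrix.transpose_transpose, Matrix.mulVec_mulVec, Matrix.mul_assoc, h1, Matrix.mul_one]

lemma siegel_stab {g : SSp F L} (h : g ∈ (siegel F L).range) (x) : (g.1 (x, 0)).2 = 0 := by
  obtain ⟨p, rfl⟩ := h
  rw [siegel_apply]; simp

lemma sym_trans {b : L → F} (hb : b ≠ 0) (c : L → F) : ∃ s : Sym2 L → F, symM s *ᵥ b = c := by
  obtain ⟨i, hi⟩ := Function.ne_iff.1 hb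
  have hi : b i ≠ 0 := hi
  let e : L → F := Pi.single i 1
  have he : e ⬝ᵥ b = b i := by simp [e]
  obtain ⟨s, hs⟩ := symM_surj ((b i)⁻¹ • (Matrix.vecMulVec c e + Matrix.vecMulVec e c)
    - ((c ⬝ᵥ b) * (b i)⁻¹ * (b i)⁻¹) • Matrix.vecMulVec e e) (by
      ext x y
      simp [Matrix.vecMulVec_apply]; ring)
  refine ⟨s, ?_⟩
  rw [hs, Matrix.sub_mulVec, Matrix.smul_mulVec, Matrix.smul_mulVec, Matrix.add_mulVec,
    Matrix.vecMulVec_mulVec, Matrix.vecMulVec_mulVec, Matrix.vecMulVec_mulVec, he]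
  ext x
  simp
  field_simp
  ring

lemma siegel_fix {g : SSp F L} (h : ∀ s, g⁻¹ * (usp s * g) ∈ (siegel F L).range) :
    g ∈ (siegel F L).range := by
  by_cases hg : ∀ x, (g.1 (x, 0)).2 = 0
  · exact siegel_range hg
  push Not at hg
  obtain ⟨x, hx⟩ := hg
  rw [← inv_mem_iff]
  apply siegel_range
  intro c
  obtain ⟨s, hs⟩ := sym_trans hx c
  have h1 := siegel_stab (h s) x
  rw [SSp.mul_apply, SSp.mul_apply] at h1
  have h2 : (usp s).1 (g.1 (x, 0)) = g.1 (x, 0) + (c, 0) := by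
    rw [← hs]
    show ((g.1 (x, 0)).1 + symM s *ᵥ (g.1 (x, 0)).2, (g.1 (x, 0)).2) = _
    refine Prod.ext rfl ?_
    simp
  have h3 : (g⁻¹).1 (g.1 (x, 0)) = (x, 0) := by
    rw [← SSp.mul_apply, inv_mul_cancel]; rfl
  rw [h2, map_add, h3] at h1
  simpa using h1

lemma siegel_index [Fintype F] {p r : ℕ} [hp : Fact p.Prime] (hc : Fintype.card F = p ^ r) :
    ((siegel F L).range.index : ZMod p) ≠ 0 := by
  let U := Multiplicative (Sym2 L → F)
  let Y := SSp F L ⧸ (siegel F L).range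
  letI : MulAction U Y := MulAction.compHom Y (uspH F L)
  have hU : IsPGroup p U := by
    refine IsPGroup.of_card (n := r * Fintype.card (Sym2 L)) ?_
    show Nat.card (Sym2 L → F) = _
    rw [Nat.card_eq_fintype_card, Fintype.card_fun, hc, pow_mul]
  have h1 := hU.card_modEq_card_fixedPoints Y
  have h2 : Nat.card (MulAction.fixedPoints U Y) = 1 := by
    rw [Nat.card_eq_one_iff_unique]
    refine ⟨⟨?_⟩, ⟨((1 : SSp F L) : Y), ?_⟩⟩
    · have key : ∀ a : MulAction.fixedPoints U Y, a.1 = ((1 : SSp F L) : Y) := by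
        rintro ⟨a, ha⟩
        obtain ⟨g, rfl⟩ := QuotientGroup.mk_surjective a
        show (g : Y) = _
        rw [QuotientGroup.eq, mul_one, inv_mem_iff]
        apply siegel_fix
        intro s
        have := ha (Multiplicative.ofAdd s)
        have h3 : ((usp s * g : SSp F L) : Y) = (g : Y) := this
        exact QuotientGroup.eq.1 h3.symm
      intro a b
      exact Subtype.ext ((key a).trans (key b).symm)
    · intro u
      show ((uspH F L u * 1 : SSp F L) : Y) = ((1 : SSp F L) : Y)
      rw [QuotientGroup.eq, mul_one, mul_one, inv_mem_iff]
      refine ⟨⟨u, 1⟩, ?_⟩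
      show uspH F L u * tspH F L 1 = _
      rw [map_one, mul_one]
  rw [h2] at h1
  have h3 : ((Nat.card Y : ℕ) : ZMod p) = ((1 : ℕ) : ZMod p) := (ZMod.natCast_eq_natCast_iff _ _ _).2 h1
  have h4 : (((siegel F L).range.index : ℕ) : ZMod p) = 1 := by
    rw [Subgroup.index, h3, Nat.cast_one]
  rw [h4]
  exact one_ne_zero

end grp

end SpH


namespace SpH

set_option linter.unusedSectionVars false
set_option linter.unusedSimpArgs false
set_option linter.style.haveILetI false

open Finsupp
open scoped Matrix

theorem SSp_vanish {F : Type} [Field F] [Fintype F] {p r : ℕ} [hp : Fact p.Prime]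
    (hc : Fintype.card F = p ^ r) (hr : 1 ≤ r) (hq2 : Fintype.card F ≠ 2) (n d : ℕ) (hd : 0 < d)
    (hdn : d < n) (x : Hm (1 : Representation (ZMod p) (SSp F (Idx n)) (ZMod p)) d) : x = 0 := by
  have hq : (Fintype.card F : ZMod p) = 0 := by
    rw [hc, Nat.cast_pow, ZMod.natCast_self, zero_pow (by omega)]
  refine transfer (siegel F (Idx n)) siegel_inj d _ (siegel_index hc) ?_ x
  let X : EqRep (ZMod p) (Act.semi (lAct F (Idx n))
      (Act.triv Unit _) (Act.triv Unit _) (fun _ _ _ => rfl)) (ZMod p) :=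
    ⟨(1 : Representation (ZMod p) (SSp F (Idx n)) (ZMod p)).comp (siegel F (Idx n)), 1,
      fun _ _ _ => rfl⟩
  let S := Split.semi (lAct F (Idx n)) (Act.triv Unit _) (Act.triv Unit _) (fun _ _ _ => rfl)
  refine S.vanish d X ?_
  intro a b hab
  have hX : S.resN X = (trivER (ZMod p) (sAct F (Idx n))).restr (Units.coeHom _) (lAct F (Idx n))
      (fun _ => rfl) := by
    apply EqRep.ext'
    · rfl
    · rfl
  refine op_congr (X := S.resN X) hX ?_
  refine Hm_congr ((trivER (ZMod p) (sAct F (Idx n))).restr_op (Units.coeHom _) _ (fun _ => rfl) b) ?_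
  have hdeg := S_deg hq hq2 (trivER (ZMod p) (sAct F (Idx n))) 1
    (DegLt.triv hq _ (fun q m => rfl)) b
  rcases b with _ | b
  · exact gen_vanish (VV_all hq hq2 a n)
      (fun h => II_all hq hq2 a n (by omega) (by rwa [Idx.card] at h)) _ hdeg
      (by rw [Idx.card]; omega)
  · exact VV_all hq hq2 a n _ _ _ hdeg (by rw [Idx.card]; omega) (S_red _ b)

/-- coordinates -/
noncomputable def spE (F : Type) [Field F] {n : ℕ} {L : Type} (e : Fin n ≃ L) :
    (Fin n → F × F) ≃ₗ[F] (L → F) × (L → F) where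
  toFun v := (fun l => (v (e.symm l)).1, fun l => (v (e.symm l)).2)
  invFun w i := (w.1 (e i), w.2 (e i))
  map_add' _ _ := rfl
  map_smul' _ _ := rfl
  left_inv v := by funext i; simp
  right_inv w := by simp

lemma spE_om {F : Type} [Field F] {n : ℕ} {L : Type} [Fintype L] (e : Fin n ≃ L) (v w) :
    omL F L (spE F e v) (spE F e w) = pairForm F (sympPair F) n v w := by
  unfold omL pairForm sympPair dotProduct
  rw [← Finset.sum_sub_distrib]
  exact (Equiv.sum_comp e.symm (fun i => (v i).1 * (w i).2 - (v i).2 * (w i).1))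

/-- isomorphism of symplectic groups -/
noncomputable def spIso (F : Type) [Field F] {n : ℕ} {L : Type} [Fintype L] (e : Fin n ≃ L) :
    SSp F L ≃* ↥(bilinIsoms F (pairForm F (sympPair F) n)) where
  toFun g := ⟨(spE F e).trans (g.1.trans (spE F e).symm), fun v w => by
    rw [← spE_om e, ← spE_om e]
    simp only [LinearEquiv.trans_apply, LinearEquiv.apply_symm_apply]
    exact g.2 _ _⟩
  invFun g := ⟨(spE F e).symm.trans (g.1.trans (spE F e)), fun v w => by
    simp only [LinearEquiv.trans_apply]
    rw [spE_om, g.2, ← spE_om e]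
    simp only [LinearEquiv.apply_symm_apply]⟩
  left_inv g := by
    apply Subtype.ext
    apply LinearEquiv.ext
    intro v
    simp
  right_inv g := by
    apply Subtype.ext
    apply LinearEquiv.ext
    intro v
    simp
  map_mul' g h := by
    apply Subtype.ext
    apply LinearEquiv.ext
    intro v
    show (spE F e).symm (g.1 (h.1 _)) = (spE F e).symm (g.1 (spE F e ((spE F e).symm (h.1 _))))
    rw [LinearEquiv.apply_symm_apply]

lemma d_eq_bd {k : Type} [Field k] {G : Type} [Group G] (n : ℕ) (x : (Fin (n + 1) → G) →₀ k) :
    GroupHomologyBar.d G k n x = bd (1 : Representation k G k) n x := by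
  induction x using Finsupp.induction_linear with
  | zero => rw [map_zero, map_zero]
  | add a b ha hb => rw [map_add, map_add, ha, hb]
  | single g a =>
    rw [GroupHomologyBar.d_single, bd_single]
    congr 1
    refine Finset.sum_congr rfl fun j _ => ?_
    rcases neg_one_pow_eq_or ℤ ((j : ℕ) + 1) with h | h
    · have h' : (-1 : k) ^ ((j : ℕ) + 1) = 1 := by exact_mod_cast congrArg (Int.cast : ℤ → k) h
      rw [h, h', one_smul, one_smul]
    · have h' : (-1 : k) ^ ((j : ℕ) + 1) = -1 := by exact_mod_cast congrArg (Int.cast : ℤ → k) h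
      rw [h, h', neg_smul, neg_smul, one_smul, one_smul]

lemma bridge {k : Type} [Field k] {G : Type} [Group G] (n : ℕ)
    (h : ∀ x : Hm (1 : Representation k G k) (n + 1), x = 0) :
    Subsingleton (GroupHomologyBar.Homology G k (n + 1)) := by
  refine subsingleton_of_forall_eq 0 fun y => ?_
  obtain ⟨⟨z, hz⟩, rfl⟩ := Submodule.mkQ_surjective _ y
  have hz' : z ∈ cyc (1 : Representation k G k) (n + 1) := by
    rw [mem_cyc_succ, ← d_eq_bd]; exact hz
  have h1 := (cls_eq_zero ⟨z, hz'⟩).1 (h _)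
  obtain ⟨w, hw⟩ := h1
  refine (Submodule.Quotient.mk_eq_zero _).2 ?_
  exact ⟨w, (d_eq_bd _ w).trans hw⟩

theorem final (ℓ r : ℕ) (hℓ : ℓ.Prime) (hr : 1 ≤ r)
    (F : Type) [Field F] [Fintype F] (hcard : Fintype.card F = ℓ ^ r) (hne : ℓ ^ r ≠ 2)
    (n d : ℕ) (hd0 : 0 < d) (hdn : d < n) :
    Subsingleton (GroupHomologyBar.Homology
      (↥(bilinIsoms F (pairForm F (sympPair F) n))) (ZMod ℓ) d) := by
  haveI : Fact ℓ.Prime := ⟨hℓ⟩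
  obtain ⟨d, rfl⟩ : ∃ d', d = d' + 1 := ⟨d - 1, by omega⟩
  apply bridge
  intro x
  let e : Fin n ≃ Idx n := Fintype.equivOfCardEq (by rw [Fintype.card_fin, Idx.card])
  obtain ⟨y, rfl⟩ := (Hmap_bij (ρ := (1 : Representation (ZMod ℓ) (SSp F (Idx n)) (ZMod ℓ)))
    (ρ' := (1 : Representation (ZMod ℓ) (↥(bilinIsoms F (pairForm F (sympPair F) n))) (ZMod ℓ)))
    (spIso F e) (LinearEquiv.refl _ _) (fun _ _ => rfl) (d + 1)).2 x
  rw [SSp_vanish hcard hr (by rwa [hcard]) n (d + 1) hd0 hdn y, map_zero]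

end SpH

open GroupHomologyBar in
/-- Vanishing of the homology of the symplectic groups over the finite field
`𝔽_{ℓ^r} ≠ 𝔽₂`, at the characteristic: `H_d(Sp_{2n}(𝔽_{ℓ^r}); 𝔽_ℓ) = 0` for `0 < d < n`.
Here `Sp_{2n}(F)` is realized as the group of linear automorphisms of `F^{2n} = (F²)ⁿ`
preserving the form `ω(v, w) = ∑ᵢ (vᵢ w_{n+i} - v_{n+i} wᵢ)`, where the `i`-th copy of
`F²` carries the pair of coordinates `(vᵢ, v_{n+i})`. -/
theorem Sp_homology_vanishing (ℓ r : ℕ) (hℓ : ℓ.Prime) (hr : 1 ≤ r)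
    (F : Type) [Field F] [Fintype F] (hcard : Fintype.card F = ℓ ^ r) (hne : ℓ ^ r ≠ 2)
    (n d : ℕ) (hd0 : 0 < d) (hdn : d < n) :
    Subsingleton (Homology (↥(bilinIsoms F (pairForm F (sympPair F) n))) (ZMod ℓ) d) := by
  exact SpH.final ℓ r hℓ hr F hcard hne n d hd0 hdn
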